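/- For every fixed A > 0 there exist constants c = c(A) > 0 and C = C(A) > 0 such that for all real x ≥ 2, all positive integers q ≤ (log x)^A, and all integers a with gcd(a, q) = 1, one has |π(x; q, a) − li x / φ(q)| ≤ C · x · exp(−c·√(log x)). -/

import Mathlib

/-- The number of primes `p ≤ x` with `p ≡ a (mod q)`, for real `x`. -/
noncomputable def primePiMod (x : ℝ) (q a : ℕ) : ℕ :=
  {p : ℕ | p.Prime ∧ (p : ℝ) ≤ x ∧ p ≡ a [MOD q]}.ncard

/-- The logarithmic integral `li x = ∫₂ˣ dt / log t`. -/
noncomputable def li (x : ℝ) : ℝ := ∫ t in (2:ℝ)..x, 1 / Real.log t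

section

open Complex Metric Set Filter Topology ComplexConjugate MeasureTheory

theorem norm_logDeriv_le_of_ne_zero {h : ℂ → ℂ} {c : ℂ} {R M : ℝ} (hR : 0 < R) (hM : 0 < M)
    (hd : DifferentiableOn ℂ h (ball c R)) (h0 : ∀ z ∈ ball c R, h z ≠ 0)
    (hb : ∀ z ∈ ball c R, ‖h z‖ ≤ Real.exp M * ‖h c‖) {z : ℂ} (hz : z ∈ closedBall c (R / 2)) :
    ‖deriv h z / h z‖ ≤ 24 * M / R := by
  have hq : DifferentiableOn ℂ (fun z => deriv h z / h z) (ball c R) :=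
    (hd.deriv isOpen_ball).div hd h0
  have hc : c ∈ ball c R := mem_ball_self hR
  obtain ⟨k₀, hk₀⟩ := hq.isExactOn_ball
  set k : ℂ → ℂ := fun z => k₀ z - k₀ c with hk
  have hkd : ∀ z ∈ ball c R, HasDerivAt k (deriv h z / h z) z := fun z hz =>
    (hk₀ z hz).sub_const _
  have hconst : ∀ z ∈ ball c R, h z * exp (-k z) = h c := by
    have hder : ∀ z ∈ ball c R, HasDerivAt (fun z => h z * exp (-k z)) 0 z := by
      intro z hz
      have h1 := (hd.differentiableAt (isOpen_ball.mem_nhds hz)).hasDerivAt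
      have h2 := (hkd z hz).neg.cexp
      have h3 : deriv h z * exp (-k z) + h z * (exp (-k z) * -(deriv h z / h z)) = 0 := by
        field_simp [h0 z hz]
        ring
      exact h3 ▸ h1.mul h2
    intro z hz
    have := isOpen_ball.eqOn_of_deriv_eq (convex_ball c R).isPreconnected
      (f := fun z => h z * exp (-k z)) (g := fun _ => h c)
      (fun z hz => (hder z hz).differentiableAt.differentiableWithinAt)
      (differentiableOn_const _) (fun z hz => by simp [(hder z hz).deriv]) hc (by simp [hk])
    exact this hz
  have hre : ∀ z ∈ ball c R, (k z).re ≤ M := by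
    intro z hz
    have h1 : h z = h c * exp (k z) := by
      rw [← hconst z hz, mul_assoc, ← Complex.exp_add]; simp
    have h2 := hb z hz
    rw [h1, norm_mul, Complex.norm_exp, mul_comm] at h2
    have h3 : 0 < ‖h c‖ := norm_pos_iff.mpr (h0 c hc)
    exact Real.exp_le_exp.mp (le_of_mul_le_mul_right h2 h3)
  have hkb : ∀ z ∈ closedBall c (3 * R / 4), ‖k z‖ ≤ 6 * M := by
    intro z hz
    rw [mem_closedBall, dist_eq_norm] at hz
    have hmaps : ∀ w ∈ ball (0 : ℂ) R, c + w ∈ ball c R := by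
      intro w hw; simpa [dist_eq_norm] using hw
    have := borelCaratheodory_zero (f := fun w => k (c + w)) (z := z - c) hM (R := R)
      (fun w hw => ((hkd _ (hmaps w hw)).differentiableAt.comp w
        (by fun_prop : DifferentiableAt ℂ (fun w => c + w) w)).differentiableWithinAt)
      (fun w hw => hre _ (hmaps w hw)) hR (by rw [mem_ball_zero_iff]; linarith) (by simp [hk])
    simp only [add_sub_cancel] at this
    refine this.trans ?_
    rw [div_le_iff₀ (by linarith)]
    nlinarith
  rw [mem_closedBall, dist_eq_norm] at hz
  have hsub : closedBall z (R / 4) ⊆ closedBall c (3 * R / 4) := by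
    intro w hw
    rw [mem_closedBall, dist_eq_norm] at hw ⊢
    calc ‖w - c‖ = ‖(w - z) + (z - c)‖ := by ring_nf
      _ ≤ ‖w - z‖ + ‖z - c‖ := norm_add_le _ _
      _ ≤ _ := by linarith
  have hsub' : closedBall c (3 * R / 4) ⊆ ball c R := closedBall_subset_ball (by linarith)
  have hdc : DiffContOnCl ℂ k (ball z (R / 4)) := by
    apply DifferentiableOn.diffContOnCl
    rw [closure_ball _ (by positivity)]
    exact fun w hw => (hkd w (hsub' (hsub hw))).differentiableAt.differentiableWithinAt
  have := Complex.norm_deriv_le_of_forall_mem_sphere_norm_le (by positivity) hdc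
    (fun w hw => hkb w (hsub (sphere_subset_closedBall hw)))
  rw [(hkd z (hsub' (hsub (mem_closedBall_self (by positivity))))).deriv] at this
  refine this.trans (le_of_eq ?_)
  field_simp
  norm_num

theorem Differentiable.exists_eq_pow_mul {f : ℂ → ℂ} (hf : Differentiable ℂ f) {c : ℂ}
    (hc : f c ≠ 0) (w : ℂ) :
    ∃ (n : ℕ) (g : ℂ → ℂ), Differentiable ℂ g ∧ g w ≠ 0 ∧ ∀ z, f z = (z - w) ^ n * g z := by
  have han : AnalyticOnNhd ℂ f univ := hf.differentiableOn.analyticOnNhd isOpen_univ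
  have hne : ¬ ∀ᶠ z in 𝓝 w, f z = 0 := fun h =>
    hc (han.eqOn_zero_of_preconnected_of_eventuallyEq_zero isPreconnected_univ (mem_univ w) h
      (mem_univ c))
  obtain ⟨n, g₀, hg₀, hg₀w, hfg⟩ := (han w (mem_univ w)).exists_eventuallyEq_pow_smul_nonzero_iff.mpr hne
  simp only [smul_eq_mul] at hfg
  set g : ℂ → ℂ := fun z => if z = w then g₀ w else f z / (z - w) ^ n with hg
  have hgg : g =ᶠ[𝓝 w] g₀ := by
    filter_upwards [hfg] with z hz
    by_cases h : z = w
    · simp [hg, h]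
    · have : (z - w) ^ n ≠ 0 := pow_ne_zero _ (sub_ne_zero.mpr h)
      simp only [hg, h, if_false, hz]
      field_simp
  refine ⟨n, g, fun z => ?_, by simpa [hg] using hg₀w, fun z => ?_⟩
  · by_cases h : z = w
    · subst h; exact (hgg.differentiableAt_iff).mpr hg₀.differentiableAt
    · have : g =ᶠ[𝓝 z] fun z => f z / (z - w) ^ n := by
        filter_upwards [isOpen_ne.mem_nhds h] with y hy
        simp [hg, show y ≠ w from hy]
      rw [this.differentiableAt_iff]
      exact (hf z).div (by fun_prop) (pow_ne_zero _ (sub_ne_zero.mpr h))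
  · by_cases h : z = w
    · subst h; simpa [hg] using hfg.self_of_nhds
    · have : (z - w) ^ n ≠ 0 := pow_ne_zero _ (sub_ne_zero.mpr h)
      simp only [hg, h, if_false]
      field_simp

theorem Differentiable.exists_eq_prod_mul {f : ℂ → ℂ} (hf : Differentiable ℂ f) {c : ℂ}
    (hc : f c ≠ 0) {K : Set ℂ} (hK : IsCompact K) :
    ∃ (m : Multiset ℂ) (g : ℂ → ℂ), Differentiable ℂ g ∧ (∀ z ∈ K, g z ≠ 0) ∧
      (∀ w ∈ m, w ∈ K) ∧ ∀ z, f z = (m.map fun w => z - w).prod * g z := by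
  have hfin : ∀ f : ℂ → ℂ, Differentiable ℂ f → f c ≠ 0 → (K ∩ {z | f z = 0}).Finite := by
    intro f hf hc
    have han : AnalyticOnNhd ℂ f univ := hf.differentiableOn.analyticOnNhd isOpen_univ
    by_contra hinf
    obtain ⟨w, hwK, hw⟩ := (Set.Infinite.exists_accPt_of_subset_isCompact hinf hK inter_subset_left)
    have h1 : ∃ᶠ z in 𝓝[≠] w, f z = 0 :=
      (accPt_iff_frequently_nhdsNE.mp hw).mono fun z hz => hz.2
    exact hc (han.eqOn_zero_of_preconnected_of_frequently_eq_zero isPreconnected_univ (mem_univ w) h1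
      (mem_univ c))
  suffices H : ∀ (n : ℕ) (f : ℂ → ℂ), Differentiable ℂ f → f c ≠ 0 →
      (K ∩ {z | f z = 0}).ncard = n → ∃ (m : Multiset ℂ) (g : ℂ → ℂ), Differentiable ℂ g ∧
      (∀ z ∈ K, g z ≠ 0) ∧ (∀ w ∈ m, w ∈ K) ∧ ∀ z, f z = (m.map fun w => z - w).prod * g z from
    H _ f hf hc rfl
  intro n
  induction n with
  | zero =>
    intro f hf hc hn
    rw [Set.ncard_eq_zero (hfin f hf hc)] at hn
    exact ⟨0, f, hf, fun z hz h => (hn ▸ (⟨hz, h⟩ : z ∈ K ∩ {z | f z = 0}) : z ∈ (∅ : Set ℂ)),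
      by simp, by simp⟩
  | succ n ih =>
    intro f hf hc hn
    obtain ⟨w, hwK, hw⟩ : (K ∩ {z | f z = 0}).Nonempty := by
      rw [← Set.ncard_pos (hfin f hf hc)]; omega
    obtain ⟨k, g, hg, hgw, hfg⟩ := hf.exists_eq_pow_mul hc w
    have hgc : g c ≠ 0 := fun h => hc (by rw [hfg, h, mul_zero])
    have hset : K ∩ {z | g z = 0} = (K ∩ {z | f z = 0}) \ {w} := by
      ext z
      simp only [mem_inter_iff, mem_ofPred_eq, Set.mem_sdiff, mem_singleton_iff]
      constructor
      · rintro ⟨hz, h⟩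
        exact ⟨⟨hz, by rw [hfg, h, mul_zero]⟩, fun e => hgw (e ▸ h)⟩
      · rintro ⟨⟨hz, h⟩, hne⟩
        refine ⟨hz, ?_⟩
        rw [hfg, mul_eq_zero] at h
        exact h.resolve_left (pow_ne_zero _ (sub_ne_zero.mpr hne))
    obtain ⟨m, g', hg', hg'K, hm, hmg⟩ := ih g hg hgc (by
      rw [hset, Set.ncard_sdiff_singleton_of_mem (show w ∈ K ∩ {z | f z = 0} from ⟨hwK, hw⟩), hn]; rfl)
    refine ⟨Multiset.replicate k w + m, g', hg', hg'K, ?_, fun z => ?_⟩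
    · intro v hv
      rcases Multiset.mem_add.mp hv with h | h
      · exact (Multiset.eq_of_mem_replicate h) ▸ hwK
      · exact hm v h
    · rw [hfg, hmg]; simp [mul_assoc]

theorem logDeriv_multiset_map_prod (m : Multiset ℂ) {F : ℂ → ℂ → ℂ} {c : ℂ}
    (hd : ∀ w ∈ m, DifferentiableAt ℂ (F w) c) (h0 : ∀ w ∈ m, F w c ≠ 0) :
    logDeriv (fun z => (m.map fun w => F w z).prod) c = (m.map fun w => logDeriv (F w) c).sum ∧
      DifferentiableAt ℂ (fun z => (m.map fun w => F w z).prod) c := by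
  induction m using Multiset.induction_on with
  | empty => simp [logDeriv_apply]
  | cons a m ih =>
    obtain ⟨ih1, ih2⟩ := ih (fun w hw => hd w (Multiset.mem_cons_of_mem hw))
      (fun w hw => h0 w (Multiset.mem_cons_of_mem hw))
    have ha := hd a (Multiset.mem_cons_self a m)
    simp only [Multiset.map_cons, Multiset.prod_cons, Multiset.sum_cons]
    refine ⟨?_, ha.mul ih2⟩
    rw [logDeriv_mul _ (h0 a (Multiset.mem_cons_self a m)) _ ha ih2, ih1]
    refine Multiset.prod_ne_zero fun h => ?_
    obtain ⟨w, hw, hw0⟩ := Multiset.mem_map.mp h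
    exact h0 w (Multiset.mem_cons_of_mem hw) hw0

theorem norm_multiset_map_prod (m : Multiset ℂ) (F : ℂ → ℂ) :
    ‖(m.map F).prod‖ = (m.map fun w => ‖F w‖).prod := by
  induction m using Multiset.induction_on with
  | empty => simp
  | cons a m ih => simp [ih]

theorem neg_re_logDeriv_le {f : ℂ → ℂ} (hf : Differentiable ℂ f) {c : ℂ} {R M : ℝ} (hR : 0 < R)
    (hM : 0 < M) (hb : ∀ z ∈ closedBall c R, ‖f z‖ ≤ Real.exp M * ‖f c‖) (hc : f c ≠ 0)
    (hz : ∀ z ∈ closedBall c R, f z = 0 → z.re ≤ c.re) (S : Finset ℂ)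
    (hS : ∀ w ∈ S, w ∈ closedBall c R ∧ f w = 0) :
    -(deriv f c / f c).re ≤ 24 * M / R - ∑ w ∈ S, ((1 / (c - w)).re - (c - w).re / R ^ 2) := by
  obtain ⟨m, g, hg, hgK, hmK, hfg⟩ := hf.exists_eq_prod_mul hc (isCompact_closedBall c R)
  have hR' : (R : ℂ) ≠ 0 := by exact_mod_cast hR.ne'
  have hcK : c ∈ closedBall c R := mem_closedBall_self hR.le
  have hm0 : ∀ w ∈ m, f w = 0 := by
    intro w hw
    rw [hfg, Multiset.prod_eq_zero, zero_mul]
    exact Multiset.mem_map.mpr ⟨w, hw, sub_self w⟩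
  have hmc : ∀ w ∈ m, c - w ≠ 0 := fun w hw h => hc (by rw [sub_eq_zero.mp h]; exact hm0 w hw)
  set B : ℂ → ℂ → ℂ := fun w z => (R ^ 2 - conj (w - c) * (z - c)) / R with hB
  have hBd : ∀ w, Differentiable ℂ (B w) := fun w => by simp only [hB]; fun_prop
  have hBc : ∀ w, B w c = R := fun w => by simp [hB]; field_simp
  set P : ℂ → ℂ := fun z => (m.map fun w => B w z).prod with hP
  have hPd : Differentiable ℂ P := by
    intro z
    have : ∀ m : Multiset ℂ, DifferentiableAt ℂ (fun z => (m.map fun w => B w z).prod) z := by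
      intro m
      induction m using Multiset.induction_on with
      | empty => simp
      | cons a m ih =>
        simp only [Multiset.map_cons, Multiset.prod_cons]
        exact (hBd a z).mul ih
    exact this m
  have hB0 : ∀ w ∈ m, ∀ z ∈ ball c R, B w z ≠ 0 := by
    intro w hw z hz h
    have h1 := hmK w hw
    rw [mem_closedBall, dist_eq_norm] at h1
    rw [mem_ball, dist_eq_norm] at hz
    simp only [hB, div_eq_zero_iff, hR', or_false, sub_eq_zero] at h
    have h2 := congrArg norm h
    simp only [norm_pow, norm_real, Real.norm_eq_abs, abs_of_pos hR, norm_mul, RCLike.norm_conj] at h2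
    nlinarith [norm_nonneg (w - c), norm_nonneg (z - c)]
  have hBs : ∀ w, ∀ z ∈ sphere c R, ‖B w z‖ = ‖z - w‖ := by
    intro w z hz
    rw [mem_sphere, dist_eq_norm] at hz
    have h1 : (R : ℂ) ^ 2 = conj (z - c) * (z - c) := by
      rw [← normSq_eq_conj_mul_self, normSq_eq_norm_sq, hz]; push_cast; rfl
    have h2 : (R : ℂ) ^ 2 - conj (w - c) * (z - c) = conj (z - w) * (z - c) := by
      rw [h1, ← sub_mul, ← map_sub]; congr 2; ring
    simp only [hB, h2, norm_div, norm_mul, RCLike.norm_conj, hz, norm_real, Real.norm_eq_abs,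
      abs_of_pos hR]
    field_simp
  set h : ℂ → ℂ := fun z => P z * g z with hh
  have hhd : Differentiable ℂ h := hPd.mul hg
  have hhs : ∀ z ∈ sphere c R, ‖h z‖ = ‖f z‖ := by
    intro z hz
    simp only [hh, hP, hfg z, norm_mul, norm_multiset_map_prod]
    congr 2
    exact Multiset.map_congr rfl fun w _ => hBs w z hz
  have hhc : ‖f c‖ ≤ ‖h c‖ := by
    simp only [hh, hP, hfg c, norm_mul, norm_multiset_map_prod]
    gcongr
    refine Multiset.prod_map_le_prod_map₀ _ _ (fun w _ => norm_nonneg _) fun w hw => ?_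
    have h1 := hmK w hw
    rw [mem_closedBall, dist_eq_norm, norm_sub_rev] at h1
    rw [hBc]
    simpa [abs_of_pos hR] using h1
  have hhb : ∀ z ∈ ball c R, ‖h z‖ ≤ Real.exp M * ‖h c‖ := by
    intro z hz
    refine le_trans (Complex.norm_le_of_forall_mem_frontier_norm_le isBounded_ball
      hhd.diffContOnCl (C := Real.exp M * ‖f c‖) ?_ (subset_closure hz)) (by gcongr)
    intro w hw
    have hw' : w ∈ sphere c R := by rwa [frontier_ball _ hR.ne'] at hw
    rw [hhs w hw']
    exact hb w (sphere_subset_closedBall hw')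
  have hP0 : ∀ z ∈ ball c R, P z ≠ 0 := by
    intro z hz
    refine Multiset.prod_ne_zero fun h => ?_
    obtain ⟨w, hw, hw0⟩ := Multiset.mem_map.mp h
    exact hB0 w hw z hz hw0
  have hh0 : ∀ z ∈ ball c R, h z ≠ 0 := fun z hz =>
    mul_ne_zero (hP0 z hz) (hgK z (ball_subset_closedBall hz))
  have key := norm_logDeriv_le_of_ne_zero hR hM hhd.differentiableOn hh0 hhb
    (mem_closedBall_self (by positivity) : c ∈ closedBall c (R / 2))
  have hcb : c ∈ ball c R := mem_ball_self hR
  obtain ⟨hl1, hd1⟩ := logDeriv_multiset_map_prod m (F := fun w z => z - w) (c := c)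
    (fun w _ => by fun_prop) hmc
  obtain ⟨hl2, -⟩ := logDeriv_multiset_map_prod m (F := B) (c := c)
    (fun w _ => hBd w c) (fun w hw => hB0 w hw c hcb)
  have e1 : logDeriv f c = (m.map fun w => 1 / (c - w)).sum + logDeriv g c := by
    rw [show f = fun z => (m.map fun w => z - w).prod * g z from funext hfg,
      logDeriv_mul _ _ (hgK c hcK) hd1 (hg c), hl1]
    · congr 3
      ext w
      simp [logDeriv_apply]
    · intro h
      exact hc (by rw [hfg, h, zero_mul])
  have e2 : logDeriv h c = (m.map fun w => -conj (w - c) / (R : ℂ) ^ 2).sum + logDeriv g c := by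
    rw [hh, logDeriv_mul _ (hP0 c hcb) (hgK c hcK) (hPd c) (hg c), hl2]
    congr 3
    ext w
    have : HasDerivAt (B w) (-conj (w - c) / R) c := by
      have := (((hasDerivAt_id c).sub_const c).const_mul (conj (w - c))).const_sub ((R : ℂ) ^ 2)
      simpa [hB] using this.div_const (R : ℂ)
    rw [logDeriv_apply, this.deriv, hBc]
    field_simp
  have e3 : logDeriv f c = logDeriv h c +
      (m.map fun w => 1 / (c - w) - conj (c - w) / (R : ℂ) ^ 2).sum := by
    rw [e1, e2, Multiset.sum_map_sub]
    have : (m.map fun w => -conj (w - c) / (R : ℂ) ^ 2) = m.map fun w => conj (c - w) / (R : ℂ) ^ 2 := by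
      refine Multiset.map_congr rfl fun w _ => ?_
      rw [← map_neg, neg_sub]
    rw [this]; ring
  have e4 : (logDeriv f c).re = (logDeriv h c).re +
      (m.map fun w => (1 / (c - w)).re - (c - w).re / R ^ 2).sum := by
    rw [e3, add_re]
    congr 1
    rw [← Complex.reLm_coe, map_multiset_sum, Multiset.map_map]
    congr 1
    refine Multiset.map_congr rfl fun w _ => ?_
    simp only [Function.comp_apply, Complex.reLm_coe, sub_re]
    congr 1
    rw [← ofReal_pow, div_ofReal_re, conj_re, sub_re]
  have hpos : ∀ w ∈ m, 0 ≤ (1 / (c - w)).re - (c - w).re / R ^ 2 := by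
    intro w hw
    have h1 := hmK w hw
    rw [mem_closedBall, dist_eq_norm, norm_sub_rev] at h1
    have h2 : 0 ≤ (c - w).re := by
      simpa using hz w (hmK w hw) (hm0 w hw)
    have h3 : 0 < ‖c - w‖ := norm_pos_iff.mpr (hmc w hw)
    rw [one_div, inv_re, normSq_eq_norm_sq, sub_nonneg]
    gcongr
  have hSm : S.val ≤ m := by
    rw [Multiset.le_iff_subset S.nodup]
    intro w hw
    obtain ⟨hwK, hw0⟩ := hS w hw
    rw [hfg, mul_eq_zero] at hw0
    have := hw0.resolve_right (hgK w hwK)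
    rw [Multiset.prod_eq_zero_iff, Multiset.mem_map] at this
    obtain ⟨v, hv, hv0⟩ := this
    rwa [sub_eq_zero.mp hv0]
  have hsum : ∑ w ∈ S, ((1 / (c - w)).re - (c - w).re / R ^ 2) ≤
      (m.map fun w => (1 / (c - w)).re - (c - w).re / R ^ 2).sum := by
    obtain ⟨t, rfl⟩ := Multiset.le_iff_exists_add.mp hSm
    rw [Multiset.map_add, Multiset.sum_add]
    refine le_add_of_nonneg_right (Multiset.sum_nonneg fun x hx => ?_)
    obtain ⟨w, hw, rfl⟩ := Multiset.mem_map.mp hx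
    exact hpos w (Multiset.mem_add.mpr (Or.inr hw))
  have h5 : -(logDeriv h c).re ≤ 24 * M / R :=
    ((neg_le_abs _).trans (abs_re_le_norm _)).trans key
  have : (deriv f c / f c).re = (logDeriv f c).re := rfl
  rw [this, e4]
  linarith

theorem ZMod.sum_range_natCast {q : ℕ} [NeZero q] (f : ZMod q → ℂ) :
    ∑ k ∈ Finset.range q, f (k : ZMod q) = ∑ a, f a :=
  Finset.sum_nbij' (fun k : ℕ => (k : ZMod q)) (fun a : ZMod q => a.val) (by simp)
    (fun a _ => Finset.mem_range.mpr (ZMod.val_lt a))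
    (fun k hk => ZMod.val_cast_of_lt (Finset.mem_range.mp hk)) (by simp) (by simp)

theorem DirichletCharacter.norm_sum_range_le {q : ℕ} [NeZero q] {χ : DirichletCharacter ℂ q}
    (hχ : χ ≠ 1) (n : ℕ) : ‖∑ k ∈ Finset.range n, χ (k : ZMod q)‖ ≤ q := by
  induction n using Nat.strong_induction_on with
  | _ n ih =>
    rcases lt_or_ge n q with h | h
    · refine (norm_sum_le_of_le (n := fun _ => 1) _ fun k _ => χ.norm_le_one _).trans ?_
      simpa using h.le
    · obtain ⟨m, rfl⟩ := Nat.exists_eq_add_of_le' h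
      have hz : ∑ k ∈ Finset.range q, χ ((m + k : ℕ) : ZMod q) = 0 := by
        have := ZMod.sum_range_natCast (fun a => χ ((m : ZMod q) + a))
        push_cast
        rw [this]
        exact (Equiv.sum_comp (Equiv.addLeft (m : ZMod q)) (fun a => χ a)).trans
          (MulChar.sum_eq_zero_of_ne_one hχ)
      rw [Finset.sum_range_add, hz, add_zero]
      exact ih m (by have := NeZero.pos q; omega)

theorem DirichletCharacter.norm_sum_Icc_le {q : ℕ} [NeZero q] {χ : DirichletCharacter ℂ q}
    (hχ : χ ≠ 1) (n : ℕ) : ‖∑ k ∈ Finset.Icc 1 n, χ (k : ZMod q)‖ ≤ q := by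
  have hq : q ≠ 1 := by
    rintro rfl
    exact hχ (Subsingleton.elim _ _)
  have : ∑ k ∈ Finset.Icc 1 n, χ (k : ZMod q) = ∑ k ∈ Finset.range (n + 1), χ (k : ZMod q) := by
    rw [Finset.range_eq_Ico, Finset.sum_eq_sum_Ico_succ_bot (by omega)]
    have : Nontrivial (ZMod q) := ZMod.nontrivial_iff.mpr hq
    simp only [Nat.cast_zero, MulChar.map_zero, zero_add]
    rfl
  rw [this]
  exact norm_sum_range_le hχ _

/-- The Dirichlet integral `∫_1^∞ E(t) t^{-s-1} dt`. -/
noncomputable def tailIntegral (E : ℝ → ℂ) (s : ℂ) : ℂ :=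
  ∫ t in Ioi (1 : ℝ), E t * (t : ℂ) ^ (-(s + 1))

theorem norm_tailIntegral_le {E : ℝ → ℂ} {B : ℝ} (hB : ∀ t, 1 < t → ‖E t‖ ≤ B) {s : ℂ}
    (hs : 0 < s.re) : ‖tailIntegral E s‖ ≤ B / s.re := by
  have h1 : ∀ t ∈ Ioi (1 : ℝ), ‖E t * (t : ℂ) ^ (-(s + 1))‖ ≤ B * t ^ (-s.re - 1) := by
    intro t ht
    have ht0 : (0 : ℝ) < t := zero_lt_one.trans ht
    rw [norm_mul, norm_cpow_eq_rpow_re_of_pos ht0]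
    exact mul_le_mul (hB t ht) (le_of_eq (by congr 1; simp; ring)) (by positivity)
      ((norm_nonneg _).trans (hB t ht))
  have hi : IntegrableOn (fun t : ℝ => B * t ^ (-s.re - 1)) (Ioi 1) :=
    (integrableOn_Ioi_rpow_of_lt (by linarith) zero_lt_one).const_mul _
  refine (norm_integral_le_of_norm_le hi ((ae_restrict_iff' measurableSet_Ioi).mpr
    (Eventually.of_forall h1))).trans (le_of_eq ?_)
  rw [integral_const_mul, integral_Ioi_rpow_of_lt (by linarith) zero_lt_one]
  simp
  field_simp

theorem differentiableAt_tailIntegral {E : ℝ → ℂ} (hE : Measurable E) {B : ℝ}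
    (hB : ∀ t, 1 < t → ‖E t‖ ≤ B) {s : ℂ} (hs : 0 < s.re) :
    DifferentiableAt ℂ (tailIntegral E) s := by
  set F : ℝ → ℂ := (Ioi (1 : ℝ)).indicator E with hF
  have hFm : Measurable F := hE.indicator measurableSet_Ioi
  have hB0 : 0 ≤ B := (norm_nonneg _).trans (hB 2 (by norm_num))
  have hFB : ∀ t, ‖F t‖ ≤ B := by
    intro t
    by_cases h : t ∈ Ioi (1 : ℝ)
    · simpa [hF, h] using hB t h
    · simpa [hF, h] using hB0
  have heq : tailIntegral E = fun s => mellin F (-s) := by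
    ext s
    rw [tailIntegral, mellin, ← integral_indicator measurableSet_Ioi,
      ← integral_indicator measurableSet_Ioi]
    congr 1
    ext t
    by_cases h : (1 : ℝ) < t
    · have h0 : (0 : ℝ) < t := zero_lt_one.trans h
      simp [hF, indicator, h, h0, mul_comm, sub_eq_add_neg, add_comm]
    · by_cases h0 : (0 : ℝ) < t <;> simp [hF, indicator, h, h0]
  rw [heq]
  refine DifferentiableAt.comp s (f := fun s => -s) (g := mellin F) ?_ (by fun_prop)
  refine mellin_differentiableAt_of_isBigO_rpow (a := 0) (b := -s.re - 1) ?_ ?_ (by simpa) ?_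
    (by simp)
  · refine LocallyIntegrable.locallyIntegrableOn ?_ _
    exact (locallyIntegrable_const (B : ℝ)).mono hFm.aestronglyMeasurable
      (Eventually.of_forall fun t => by simpa [abs_of_nonneg hB0] using hFB t)
  · refine Asymptotics.IsBigO.of_bound B (Eventually.of_forall fun t => ?_)
    simpa using hFB t
  · refine (Asymptotics.isBigO_zero _ _).congr' ?_ EventuallyEq.rfl
    filter_upwards [mem_nhdsWithin_of_mem_nhds (Iio_mem_nhds zero_lt_one)] with t ht
    simp only [mem_Iio] at ht
    simp [hF, not_lt.mpr ht.le]

theorem eqOn_re_pos_of_eqOn_one_lt_re {f g : ℂ → ℂ}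
    (hf : ∀ s : ℂ, 0 < s.re → DifferentiableAt ℂ f s)
    (hg : ∀ s : ℂ, 0 < s.re → DifferentiableAt ℂ g s)
    (h : ∀ s : ℂ, 1 < s.re → f s = g s) {s : ℂ} (hs : 0 < s.re) : f s = g s := by
  have ho : IsOpen {s : ℂ | 0 < s.re} := isOpen_lt continuous_const continuous_re
  have hf' : AnalyticOnNhd ℂ f {s : ℂ | 0 < s.re} :=
    DifferentiableOn.analyticOnNhd (fun s hs => (hf s hs).differentiableWithinAt) ho
  have hg' : AnalyticOnNhd ℂ g {s : ℂ | 0 < s.re} :=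
    DifferentiableOn.analyticOnNhd (fun s hs => (hg s hs).differentiableWithinAt) ho
  refine hf'.eqOn_of_preconnected_of_eventuallyEq hg'
    (convex_halfSpace_re_gt 0).isPreconnected (z₀ := 2) (by simp) ?_ hs
  filter_upwards [(isOpen_lt continuous_const continuous_re).mem_nhds
    (show (1 : ℝ) < (2 : ℂ).re by simp)] with z hz
  exact h z hz

theorem DirichletCharacter.LFunction_eq_tailIntegral {q : ℕ} [NeZero q]
    {χ : DirichletCharacter ℂ q} (hχ : χ ≠ 1) {s : ℂ} (hs : 0 < s.re) :
    LFunction χ s = s * tailIntegral (fun t => ∑ k ∈ Finset.Icc 1 ⌊t⌋₊, χ (k : ZMod q)) s := by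
  have hm : Measurable fun t : ℝ => ∑ k ∈ Finset.Icc 1 ⌊t⌋₊, χ (k : ZMod q) :=
    (measurable_from_nat (f := fun n => ∑ k ∈ Finset.Icc 1 n, χ (k : ZMod q))).comp
      Nat.measurable_floor
  refine eqOn_re_pos_of_eqOn_one_lt_re (f := LFunction χ)
    (g := fun s => s * tailIntegral (fun t => ∑ k ∈ Finset.Icc 1 ⌊t⌋₊, χ (k : ZMod q)) s)
    (fun s _ => differentiable_LFunction hχ s)
    (fun s hs => differentiableAt_id.mul (differentiableAt_tailIntegral hm
      (fun t _ => norm_sum_Icc_le hχ ⌊t⌋₊) hs)) (fun s hs => ?_) hs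
  rw [LFunction_eq_LSeries χ hs, LSeries_eq_mul_integral _ le_rfl (by linarith)
    (LSeriesSummable_of_one_lt_re χ hs)]
  · rfl
  · refine Asymptotics.IsBigO.of_bound q (Eventually.of_forall fun n => ?_)
    simpa using norm_sum_Icc_le hχ n

theorem DirichletCharacter.norm_LFunction_le {q : ℕ} [NeZero q]
    {χ : DirichletCharacter ℂ q} (hχ : χ ≠ 1) {s : ℂ} (hs : 0 < s.re) :
    ‖LFunction χ s‖ ≤ ‖s‖ * (q / s.re) := by
  rw [LFunction_eq_tailIntegral hχ hs, norm_mul]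
  gcongr
  exact norm_tailIntegral_le (fun t _ => norm_sum_Icc_le hχ ⌊t⌋₊) hs

/-- The entire function `(s - 1) * ζ(s)`. -/
noncomputable def zetaOne (s : ℂ) : ℂ := Function.update (fun s => (s - 1) * riemannZeta s) 1 1 s

theorem zetaOne_of_ne_one {s : ℂ} (hs : s ≠ 1) : zetaOne s = (s - 1) * riemannZeta s := by
  simp [zetaOne, hs]

@[simp] theorem zetaOne_one : zetaOne 1 = 1 := by simp [zetaOne]

theorem differentiable_zetaOne : Differentiable ℂ zetaOne := by
  have := DirichletCharacter.differentiable_LFunctionTrivChar₁ 1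
  have h : zetaOne = DirichletCharacter.LFunctionTrivChar₁ 1 := by
    ext s
    simp [zetaOne, DirichletCharacter.LFunctionTrivChar₁, Function.update_apply,
      DirichletCharacter.LFunctionTrivChar]
  rwa [h]

/-- The fractional-part integral `∫_1^∞ (⌊t⌋ - t) t^{-s-1} dt`. -/
noncomputable def fracIntegral (s : ℂ) : ℂ := tailIntegral (fun t => ((⌊t⌋₊ : ℝ) - t : ℝ)) s

theorem measurable_floor_sub : Measurable fun t : ℝ => (((⌊t⌋₊ : ℝ) - t : ℝ) : ℂ) := by
  have : Measurable fun t : ℝ => (⌊t⌋₊ : ℝ) := measurable_from_nat.comp Nat.measurable_floor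
  exact measurable_ofReal.comp (this.sub measurable_id)

theorem norm_floor_sub_le (t : ℝ) (ht : 1 < t) : ‖(((⌊t⌋₊ : ℝ) - t : ℝ) : ℂ)‖ ≤ 1 := by
  rw [norm_real, Real.norm_eq_abs, abs_sub_le_iff]
  have h1 := Nat.floor_le (by linarith : 0 ≤ t)
  have h2 := Nat.lt_floor_add_one t
  constructor <;> linarith

theorem norm_fracIntegral_le {s : ℂ} (hs : 0 < s.re) : ‖fracIntegral s‖ ≤ 1 / s.re :=
  norm_tailIntegral_le norm_floor_sub_le hs

theorem differentiableAt_fracIntegral {s : ℂ} (hs : 0 < s.re) :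
    DifferentiableAt ℂ fracIntegral s :=
  differentiableAt_tailIntegral measurable_floor_sub norm_floor_sub_le hs

theorem zetaOne_eq {s : ℂ} (hs : 0 < s.re) : zetaOne s = s + (s - 1) * (s * fracIntegral s) := by
  refine eqOn_re_pos_of_eqOn_one_lt_re (f := zetaOne)
    (g := fun s => s + (s - 1) * (s * fracIntegral s)) (fun s _ => differentiable_zetaOne s)
    (fun s hs => ?_) (fun s hs => ?_) hs
  · have := differentiableAt_fracIntegral hs
    fun_prop
  · have hs0 : 0 < s.re := by linarith
    have hs1 : s ≠ 1 := by rintro rfl; simp at hs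
    have hs1' : s - 1 ≠ 0 := sub_ne_zero.mpr hs1
    have h1 : riemannZeta s = s * ∫ t in Ioi (1 : ℝ), (⌊t⌋₊ : ℂ) * (t : ℂ) ^ (-(s + 1)) := by
      rw [← LSeries_one_eq_riemannZeta hs, LSeries_eq_mul_integral _ zero_le_one hs
        (LSeriesSummable_one_iff.mpr hs)]
      · simp
      · refine Asymptotics.IsBigO.of_bound 1 (Eventually.of_forall fun n => ?_)
        simp
    have hint1 : IntegrableOn (fun t : ℝ => (t : ℂ) ^ (-s)) (Ioi 1) :=
      integrableOn_Ioi_cpow_of_lt (by simpa using hs) zero_lt_one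
    have hint2 : IntegrableOn (fun t : ℝ => (((⌊t⌋₊ : ℝ) - t : ℝ) : ℂ) * (t : ℂ) ^ (-(s + 1)))
        (Ioi 1) := by
      have : IntegrableOn (fun t : ℝ => (t : ℂ) ^ (-(s + 1))) (Ioi 1) :=
        integrableOn_Ioi_cpow_of_lt (by simpa using hs0) zero_lt_one
      refine this.bdd_mul measurable_floor_sub.aestronglyMeasurable (c := 1) ?_
      exact (ae_restrict_iff' measurableSet_Ioi).mpr (Eventually.of_forall norm_floor_sub_le)
    have h2 : ∫ t in Ioi (1 : ℝ), (⌊t⌋₊ : ℂ) * (t : ℂ) ^ (-(s + 1)) =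
        fracIntegral s + ∫ t in Ioi (1 : ℝ), (t : ℂ) ^ (-s) := by
      rw [fracIntegral, tailIntegral, ← integral_add hint2 hint1]
      refine setIntegral_congr_fun measurableSet_Ioi fun t ht => ?_
      have ht0 : (t : ℂ) ≠ 0 := by
        exact_mod_cast (zero_lt_one.trans (show (1 : ℝ) < t from ht)).ne'
      have : (t : ℂ) ^ (-s) = t * (t : ℂ) ^ (-(s + 1)) := by
        rw [show -s = 1 + -(s + 1) by ring, cpow_add _ _ ht0, cpow_one]
      simp only [this]
      push_cast
      ring
    rw [zetaOne_of_ne_one hs1, h1, h2, integral_Ioi_cpow_of_lt (by simpa using hs) zero_lt_one]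
    have : -s + 1 ≠ 0 := by
      intro h; apply hs1'; linear_combination -h
    simp only [ofReal_one, one_cpow]
    field_simp
    ring

/-- The entire function attached to a Dirichlet character: its `L`-function with the possible pole
at `s = 1` removed by a factor `s - 1`. -/
noncomputable def DirichletCharacter.entireL {q : ℕ} [NeZero q] (χ : DirichletCharacter ℂ q)
    (s : ℂ) : ℂ :=
  open Classical in
  if χ = 1 then zetaOne s * ∏ p ∈ q.primeFactors, (1 - (p : ℂ) ^ (-s)) else LFunction χ s

/-- The order of the pole at `s = 1` of the `L`-function of `χ`. -/
noncomputable def DirichletCharacter.poleOrder {q : ℕ} (χ : DirichletCharacter ℂ q) : ℂ :=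
  open Classical in if χ = 1 then 1 else 0

namespace DirichletCharacter

variable {q : ℕ} [NeZero q] (χ : DirichletCharacter ℂ q)

theorem entireL_one (s : ℂ) : entireL (1 : DirichletCharacter ℂ q) s =
    zetaOne s * ∏ p ∈ q.primeFactors, (1 - (p : ℂ) ^ (-s)) := by simp [entireL]

variable {χ} in
theorem entireL_of_ne_one (hχ : χ ≠ 1) : entireL χ = LFunction χ := by
  ext s; simp [entireL, hχ]

theorem entireL_one_eq_sub_mul {s : ℂ} (hs : s ≠ 1) : entireL (1 : DirichletCharacter ℂ q) s =
    (s - 1) * LFunction (1 : DirichletCharacter ℂ q) s := by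
  rw [entireL_one, zetaOne_of_ne_one hs]
  have := LFunctionTrivChar_eq_mul_riemannZeta (N := q) hs
  rw [LFunctionTrivChar] at this
  rw [this]
  ring

theorem differentiable_entireL : Differentiable ℂ (entireL χ) := by
  by_cases hχ : χ = 1
  · subst hχ
    have : entireL (1 : DirichletCharacter ℂ q) =
      fun s => zetaOne s * ∏ p ∈ q.primeFactors, (1 - (p : ℂ) ^ (-s)) := by
      ext s; exact entireL_one s
    rw [this]
    refine differentiable_zetaOne.mul (Differentiable.fun_finsetProd fun p hp => ?_)
    have : NeZero p := ⟨(Nat.prime_of_mem_primeFactors hp).ne_zero⟩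
    fun_prop
  · rw [entireL_of_ne_one hχ]
    exact differentiable_LFunction hχ

theorem norm_prod_primeFactors_le {s : ℂ} (hs : 0 ≤ s.re) :
    ‖∏ p ∈ q.primeFactors, (1 - (p : ℂ) ^ (-s))‖ ≤ q := by
  rw [norm_prod]
  calc ∏ p ∈ q.primeFactors, ‖1 - (p : ℂ) ^ (-s)‖ ≤ ∏ p ∈ q.primeFactors, (p : ℝ) := by
        refine Finset.prod_le_prod (fun _ _ => norm_nonneg _) fun p hp => ?_
        have hp2 := (Nat.prime_of_mem_primeFactors hp).two_le
        have h1 : ‖(p : ℂ) ^ (-s)‖ ≤ 1 := by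
          rw [norm_natCast_cpow_of_pos (by omega)]
          exact Real.rpow_le_one_of_one_le_of_nonpos (by exact_mod_cast (by omega : 1 ≤ p))
            (by simpa)
        calc ‖1 - (p : ℂ) ^ (-s)‖ ≤ 1 + 1 := (norm_sub_le _ _).trans (by simpa using h1)
          _ ≤ p := by norm_num; exact_mod_cast hp2
    _ ≤ q := by
      rw [← Nat.cast_prod]
      exact_mod_cast Nat.le_of_dvd (NeZero.pos q) (Nat.prod_primeFactors_dvd q)

theorem norm_zetaOne_le {s : ℂ} (hs : 1 / 2 ≤ s.re) : ‖zetaOne s‖ ≤ 3 * (‖s‖ + 1) ^ 2 := by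
  have h0 : 0 < s.re := by linarith
  rw [zetaOne_eq h0]
  have h1 : ‖fracIntegral s‖ ≤ 2 := (norm_fracIntegral_le h0).trans (by
    rw [div_le_iff₀ h0]; linarith)
  have h2 : ‖s - 1‖ ≤ ‖s‖ + 1 := (norm_sub_le _ _).trans (by simp)
  calc ‖s + (s - 1) * (s * fracIntegral s)‖ ≤ ‖s‖ + ‖s - 1‖ * (‖s‖ * ‖fracIntegral s‖) := by
        refine (norm_add_le _ _).trans ?_
        simp
    _ ≤ ‖s‖ + (‖s‖ + 1) * (‖s‖ * 2) := by gcongr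
    _ ≤ _ := by nlinarith [norm_nonneg s]

theorem norm_entireL_le {s : ℂ} (hs : 1 / 2 ≤ s.re) :
    ‖entireL χ s‖ ≤ 3 * q * (‖s‖ + 1) ^ 2 := by
  by_cases hχ : χ = 1
  · subst hχ
    rw [entireL_one, norm_mul]
    calc _ ≤ (3 * (‖s‖ + 1) ^ 2) * (q : ℝ) := by
          gcongr
          exacts [norm_zetaOne_le hs, norm_prod_primeFactors_le (by linarith)]
      _ = _ := by ring
  · rw [entireL_of_ne_one hχ]
    refine (norm_LFunction_le hχ (by linarith)).trans ?_
    have : (q : ℝ) / s.re ≤ 2 * q := by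
      rw [div_le_iff₀ (by linarith)]
      nlinarith [(Nat.cast_nonneg q : (0 : ℝ) ≤ q)]
    calc ‖s‖ * (q / s.re) ≤ ‖s‖ * (2 * q) := by gcongr
      _ = q * (2 * ‖s‖) := by ring
      _ ≤ q * (3 * (‖s‖ + 1) ^ 2) :=
        mul_le_mul_of_nonneg_left (by nlinarith [norm_nonneg s]) q.cast_nonneg
      _ = _ := by ring

theorem entireL_ne_zero {s : ℂ} (hs : 1 ≤ s.re) : entireL χ s ≠ 0 := by
  by_cases hχ : χ = 1
  · subst hχ
    by_cases h1 : s = 1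
    · subst h1
      rw [entireL_one, zetaOne_one, one_mul]
      refine Finset.prod_ne_zero_iff.mpr fun p hp => ?_
      have hp := Nat.prime_of_mem_primeFactors hp
      rw [cpow_neg_one, sub_ne_zero]
      intro h
      have : (p : ℂ) = 1 := by simpa using h.symm
      exact hp.ne_one (by exact_mod_cast this)
    · rw [entireL_one_eq_sub_mul h1]
      exact mul_ne_zero (sub_ne_zero.mpr h1) (LFunction_ne_zero_of_one_le_re 1 (.inr h1) hs)
  · rw [entireL_of_ne_one hχ]
    exact LFunction_ne_zero_of_one_le_re χ (.inl hχ) hs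

theorem norm_riemannZeta_le {σ : ℝ} (hσ : 1 < σ) (hσ2 : σ ≤ 2) :
    ‖riemannZeta σ‖ ≤ 3 / (σ - 1) := by
  have h1 : (σ : ℂ) ≠ 1 := by exact_mod_cast hσ.ne'
  have h2 := zetaOne_of_ne_one h1
  have h0 : 0 < (σ : ℂ).re := by simp; linarith
  have hs : (0 : ℝ) < σ - 1 := by linarith
  have h3 : ‖zetaOne σ‖ ≤ 3 := by
    rw [zetaOne_eq h0]
    have hf := norm_fracIntegral_le h0
    simp only [ofReal_re] at hf
    have hσ' : ‖(σ : ℂ)‖ = σ := by simp; linarith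
    have hσ'' : ‖(σ : ℂ) - 1‖ = σ - 1 := by
      rw [← ofReal_one, ← ofReal_sub, norm_real, Real.norm_eq_abs, abs_of_pos hs]
    calc _ ≤ ‖(σ : ℂ)‖ + ‖(σ : ℂ) - 1‖ * (‖(σ : ℂ)‖ * ‖fracIntegral σ‖) := by
          refine (norm_add_le _ _).trans ?_
          simp
      _ ≤ σ + (σ - 1) * (σ * (1 / σ)) := by rw [hσ', hσ'']; gcongr
      _ = σ + (σ - 1) := by field_simp
      _ ≤ 3 := by linarith
  rw [h2, norm_mul, ← ofReal_one, ← ofReal_sub, norm_real, Real.norm_eq_abs, abs_of_pos hs] at h3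
  rw [le_div_iff₀ hs]
  linarith

theorem norm_LSeries_le_of_norm_le_one {f : ℕ → ℂ} (hf : ∀ n, ‖f n‖ ≤ 1) {s : ℂ} (hs : 1 < s.re)
    (hs2 : s.re ≤ 2) : ‖LSeries f s‖ ≤ 3 / (s.re - 1) := by
  refine le_trans ?_ (norm_riemannZeta_le hs hs2)
  have hz : (1 : ℝ) < (s.re : ℂ).re := by simpa
  have hsum : LSeriesSummable 1 (s.re : ℂ) := LSeriesSummable_one_iff.mpr hz
  have hle : ∀ n, ‖LSeries.term f s n‖ ≤ ‖LSeries.term 1 (s.re : ℂ) n‖ := by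
    intro n
    rw [LSeries.norm_term_eq, LSeries.norm_term_eq]
    split_ifs
    · rfl
    · simp only [ofReal_re, Pi.one_apply, norm_one]
      gcongr
      exact hf n
  have hnn : ∀ n, LSeries.term 1 (s.re : ℂ) n = ((‖LSeries.term 1 (s.re : ℂ) n‖ : ℝ) : ℂ) := by
    intro n
    rw [LSeries.norm_term_eq, LSeries.term_def]
    split_ifs
    · simp
    · simp [ofReal_cpow]
  rw [← LSeries_one_eq_riemannZeta hz]
  have h1 : LSeries 1 (s.re : ℂ) = ((∑' n, ‖LSeries.term 1 (s.re : ℂ) n‖ : ℝ) : ℂ) := by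
    rw [ofReal_tsum, LSeries]
    exact tsum_congr hnn
  rw [h1, norm_real, Real.norm_of_nonneg (tsum_nonneg fun _ => norm_nonneg _), LSeries]
  exact tsum_of_norm_bounded hsum.norm.hasSum hle

theorem le_norm_LFunction {s : ℂ} (hs : 1 < s.re) (hs2 : s.re ≤ 2) :
    (s.re - 1) / 3 ≤ ‖LFunction χ s‖ := by
  rw [LFunction_eq_LSeries χ hs]
  have h1 := LSeries.mul_mu_eq_one χ hs
  have h2 : ‖LSeries ((fun n : ℕ => χ n) * fun n : ℕ => ((ArithmeticFunction.moebius n : ℤ) : ℂ)) s‖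
      ≤ 3 / (s.re - 1) := by
    refine norm_LSeries_le_of_norm_le_one (fun n => ?_) hs hs2
    simp only [Pi.mul_apply, norm_mul]
    refine mul_le_one₀ (χ.norm_le_one _) (norm_nonneg _) ?_
    rw [norm_intCast]
    exact_mod_cast ArithmeticFunction.abs_moebius_le_one
  have h3 := congrArg norm h1
  rw [norm_mul, norm_one] at h3
  have hs' : 0 < s.re - 1 := by linarith
  rw [div_le_iff₀ (by norm_num)]
  rw [le_div_iff₀ hs'] at h2
  nlinarith [norm_nonneg (LSeries (fun n : ℕ => χ n) s)]

theorem le_norm_entireL {s : ℂ} (hs : 1 < s.re) (hs2 : s.re ≤ 2) :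
    (s.re - 1) ^ 2 / 3 ≤ ‖entireL χ s‖ := by
  have h := le_norm_LFunction χ hs hs2
  have hs' : 0 < s.re - 1 := by linarith
  by_cases hχ : χ = 1
  · subst hχ
    have h1 : s ≠ 1 := by rintro rfl; simp at hs
    rw [entireL_one_eq_sub_mul h1, norm_mul]
    have : s.re - 1 ≤ ‖s - 1‖ := by simpa using re_le_norm (s - 1)
    calc _ = (s.re - 1) * ((s.re - 1) / 3) := by ring
      _ ≤ _ := by gcongr
  · rw [entireL_of_ne_one hχ]
    nlinarith

/-- The Dirichlet series `-L'/L` on `re s > 1`. -/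
noncomputable def mangoldtL (χ : DirichletCharacter ℂ q) (s : ℂ) : ℂ :=
  LSeries ((fun n : ℕ => χ n) * fun n : ℕ => (ArithmeticFunction.vonMangoldt n : ℂ)) s

theorem mangoldtL_eq {s : ℂ} (hs : 1 < s.re) :
    mangoldtL χ s = -(deriv (entireL χ) s / entireL χ s) + poleOrder χ / (s - 1) := by
  have h1 : s ≠ 1 := by rintro rfl; simp at hs
  have h2 : mangoldtL χ s = -(deriv (LFunction χ) s / LFunction χ s) := by
    rw [mangoldtL, LSeries_twist_vonMangoldt_eq χ hs, deriv_LFunction_eq_deriv_LSeries χ hs,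
      LFunction_eq_LSeries χ hs, neg_div]
  rw [h2]
  by_cases hχ : χ = 1
  · subst hχ
    have hd : DifferentiableAt ℂ (LFunction (1 : DirichletCharacter ℂ q)) s :=
      differentiableAt_LFunction _ _ (.inl h1)
    have he : entireL (1 : DirichletCharacter ℂ q) =ᶠ[𝓝 s]
        fun s => (s - 1) * LFunction (1 : DirichletCharacter ℂ q) s := by
      filter_upwards [isOpen_ne.mem_nhds h1] with z hz
      exact entireL_one_eq_sub_mul hz
    have hL : LFunction (1 : DirichletCharacter ℂ q) s ≠ 0 :=
      LFunction_ne_zero_of_one_le_re 1 (.inr h1) hs.le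
    have h1' : s - 1 ≠ 0 := sub_ne_zero.mpr h1
    rw [he.deriv_eq, he.eq_of_nhds, deriv_fun_mul (by fun_prop) hd]
    simp only [poleOrder, if_true, deriv_sub_const, deriv_id'']
    field_simp
    ring
  · simp [entireL_of_ne_one hχ, poleOrder, hχ]

theorem conj_LSeries_of_conj {f : ℕ → ℂ} (hf : ∀ n, conj (f n) = f n) (s : ℂ) :
    LSeries f (conj s) = conj (LSeries f s) := by
  rw [LSeries, LSeries, conj_tsum]
  refine tsum_congr fun n => ?_
  rw [LSeries.term_def, LSeries.term_def]
  split_ifs with h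
  · simp
  · rw [map_div₀, hf, show (n : ℂ) ^ (conj s) = conj ((n : ℂ) ^ s) from ?_]
    rw [cpow_conj _ _ (by rw [natCast_arg]; exact Real.pi_ne_zero.symm), conj_natCast]

variable {χ} in
theorem conj_apply_of_sq_eq_one (hχ : χ ^ 2 = 1) (a : ZMod q) : conj (χ a) = χ a := by
  by_cases ha : IsUnit a
  · have h : χ a * χ a = 1 := by
      rw [← sq, ← MulChar.pow_apply' χ two_ne_zero, hχ, MulChar.one_apply ha]
    rcases mul_self_eq_one_iff.mp h with h | h <;> simp [h]
  · simp [χ.map_nonunit ha]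

variable {χ} in
theorem LFunction_conj (hχ : χ ≠ 1) (hχ2 : χ ^ 2 = 1) {s : ℂ} (hs : 0 < s.re) :
    LFunction χ (conj s) = conj (LFunction χ s) := by
  have := eqOn_re_pos_of_eqOn_one_lt_re (f := LFunction χ)
    (g := fun s => conj (LFunction χ (conj s))) (fun s _ => differentiable_LFunction hχ s)
    (fun s _ => differentiableAt_conj_conj_iff.mpr (differentiable_LFunction hχ (conj s))) (fun s hs => ?_) hs
  · rw [this]; simp
  · rw [LFunction_eq_LSeries χ hs, LFunction_eq_LSeries χ (by simpa using hs),
      conj_LSeries_of_conj (fun n => conj_apply_of_sq_eq_one hχ2 _)]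
    simp

end DirichletCharacter

namespace DirichletCharacter

variable {q : ℕ} [NeZero q] (χ : DirichletCharacter ℂ q)

theorem neg_re_logDeriv_entireL_le {δ t ℒ : ℝ} (hδ : 0 < δ) (hδ2 : δ ≤ 1 / 2) (hℒ : 1 ≤ ℒ)
    (hq : q * (|t| + 4) ≤ Real.exp ℒ) (hδℒ : 1 / δ ≤ Real.exp (13 * ℒ)) (S : Finset ℂ)
    (hS : ∀ w ∈ S, w ∈ closedBall ((1 + δ : ℝ) + t * I : ℂ) (1 / 2) ∧ entireL χ w = 0)
    (hcard : S.card ≤ 2) :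
    -(deriv (entireL χ) ((1 + δ : ℝ) + t * I) / entireL χ ((1 + δ : ℝ) + t * I)).re ≤
      1492 * ℒ - ∑ w ∈ S, (1 / (((1 + δ : ℝ) + t * I : ℂ) - w)).re := by
  set c : ℂ := (1 + δ : ℝ) + t * I with hc
  have hcre : c.re = 1 + δ := by simp [hc]
  have hq1 : (1 : ℝ) ≤ q := by exact_mod_cast NeZero.pos q
  have hcn : ‖c‖ ≤ 3 / 2 + |t| := by
    refine (norm_add_le _ _).trans ?_
    rw [norm_real, Real.norm_of_nonneg (by linarith), norm_mul, norm_I, norm_real,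
      Real.norm_eq_abs]
    linarith
  have hlow := le_norm_entireL χ (s := c) (by linarith) (by linarith)
  have hb : ∀ z ∈ closedBall c (1 / 2), ‖entireL χ z‖ ≤ Real.exp (31 * ℒ) * ‖entireL χ c‖ := by
    intro z hz
    have hz' : ‖z - c‖ ≤ 1 / 2 := by simpa [dist_eq_norm] using hz
    have hre : 1 / 2 ≤ z.re := by
      have := (abs_re_le_norm (z - c)).trans hz'
      rw [sub_re, abs_le] at this
      linarith [this.1]
    have hzn : ‖z‖ ≤ 2 + |t| := by
      have : ‖z‖ ≤ ‖z - c‖ + ‖c‖ := by simpa using norm_add_le (z - c) c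
      linarith
    have h9 : (9 : ℝ) ≤ Real.exp (3 * ℒ) := by
      have h1 : (2.7 : ℝ) ≤ Real.exp 1 := by linarith [Real.exp_one_gt_d9]
      have h2 : Real.exp 3 = Real.exp 1 ^ 3 := by rw [← Real.exp_nat_mul]; norm_num
      have h3 : Real.exp 3 ≤ Real.exp (3 * ℒ) := Real.exp_le_exp.mpr (by linarith)
      have h4 : (2.7 : ℝ) ^ 3 ≤ Real.exp 1 ^ 3 := by gcongr
      norm_num at h4
      linarith
    have hqt : (q : ℝ) * (|t| + 4) ^ 2 ≤ Real.exp ℒ ^ 2 := by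
      calc (q : ℝ) * (|t| + 4) ^ 2 ≤ q ^ 2 * (|t| + 4) ^ 2 := by gcongr; nlinarith
        _ = (q * (|t| + 4)) ^ 2 := by ring
        _ ≤ _ := by gcongr
    calc ‖entireL χ z‖ ≤ 3 * q * (‖z‖ + 1) ^ 2 := norm_entireL_le χ hre
      _ ≤ 3 * q * (|t| + 4) ^ 2 := by gcongr 3 * q * ?_ ^ 2; linarith
      _ ≤ 3 * Real.exp ℒ ^ 2 := by nlinarith
      _ = 9 * Real.exp ℒ ^ 2 * (1 / δ) ^ 2 * (δ ^ 2 / 3) := by field_simp; norm_num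
      _ ≤ Real.exp (3 * ℒ) * Real.exp ℒ ^ 2 * (Real.exp (13 * ℒ)) ^ 2 * ‖entireL χ c‖ := by
          gcongr
          rwa [hcre, add_sub_cancel_left] at hlow
      _ = _ := by
          rw [← Real.exp_nat_mul, ← Real.exp_nat_mul, ← Real.exp_add, ← Real.exp_add]
          congr 2
          push_cast
          ring
  have hmain := neg_re_logDeriv_le (differentiable_entireL χ) (R := 1 / 2) (M := 31 * ℒ)
    (by norm_num) (by linarith) hb (entireL_ne_zero χ (by linarith)) (fun z _ hz0 => by
      by_contra h
      exact entireL_ne_zero χ (by linarith) hz0) S hS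
  refine hmain.trans ?_
  have hsum : ∑ w ∈ S, (c - w).re / (1 / 2 : ℝ) ^ 2 ≤ 4 := by
    calc ∑ w ∈ S, (c - w).re / (1 / 2 : ℝ) ^ 2 ≤ S.card • (2 : ℝ) := by
          refine Finset.sum_le_card_nsmul _ _ _ fun w hw => ?_
          have h1 : ‖w - c‖ ≤ 1 / 2 := by simpa [dist_eq_norm] using (hS w hw).1
          have h2 := (re_le_norm (c - w)).trans (norm_sub_rev w c ▸ h1)
          rw [div_le_iff₀ (by norm_num)]
          linarith
      _ ≤ 4 := by
          rw [nsmul_eq_mul]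
          have : (S.card : ℝ) ≤ 2 := by exact_mod_cast hcard
          linarith
  rw [Finset.sum_sub_distrib]
  linarith

omit [NeZero q] in
theorem mangoldtL_summable {s : ℂ} (hs : 1 < s.re) :
    Summable fun n => LSeries.term ((fun n : ℕ => χ n) *
      fun n : ℕ => (ArithmeticFunction.vonMangoldt n : ℂ)) s n :=
  LSeriesSummable_twist_vonMangoldt χ hs

omit [NeZero q] in
theorem mangoldtL_term (σ t : ℝ) (n : ℕ) : LSeries.term ((fun n : ℕ => χ n) *
      fun n : ℕ => (ArithmeticFunction.vonMangoldt n : ℂ)) (σ + t * I) n =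
    ((ArithmeticFunction.vonMangoldt n * (n : ℝ) ^ (-σ) : ℝ) : ℂ) *
      (χ n * (n : ℂ) ^ (-(t * I))) := by
  rcases eq_or_ne n 0 with rfl | hn
  · simp
  · have hn' : (n : ℂ) ≠ 0 := by exact_mod_cast hn
    rw [LSeries.term_of_ne_zero hn, Pi.mul_apply, div_eq_mul_inv, ← cpow_neg, neg_add,
      cpow_add _ _ hn', ofReal_mul, ofReal_cpow n.cast_nonneg]
    push_cast
    ring

theorem three_add_four_mul_re_add_re_sq_nonneg {z : ℂ} (hz : ‖z‖ = 1) :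
    0 ≤ 3 + 4 * z.re + (z ^ 2).re := by
  have : z.re ^ 2 + z.im ^ 2 = 1 := by
    have := normSq_eq_norm_sq z
    rw [hz, normSq_apply] at this
    linarith
  rw [sq, mul_re]
  nlinarith [sq_nonneg (z.re + 1)]

theorem three_four_one_nonneg {σ : ℝ} (hσ : 1 < σ) (t : ℝ) :
    0 ≤ 3 * (mangoldtL (1 : DirichletCharacter ℂ 1) σ).re + 4 * (mangoldtL χ (σ + t * I)).re +
      (mangoldtL (χ ^ 2) (σ + (2 * t : ℝ) * I)).re := by
  have hs0 := mangoldtL_summable (1 : DirichletCharacter ℂ 1) (s := (σ : ℂ) + (0 : ℝ) * I)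
    (by simpa)
  have hs1 := mangoldtL_summable χ (s := (σ : ℂ) + t * I) (by simpa)
  have hs2 := mangoldtL_summable (χ ^ 2) (s := (σ : ℂ) + (2 * t : ℝ) * I) (by simpa)
  have h0 : (σ : ℂ) = σ + (0 : ℝ) * I := by simp
  rw [h0]
  conv_rhs => enter [1, 2, 2, 1, 2, 1]; rw [← h0]
  conv_rhs => enter [2, 1, 2, 1]; rw [← h0]
  rw [mangoldtL, mangoldtL, mangoldtL, LSeries, LSeries, LSeries, re_tsum hs0, re_tsum hs1,
    re_tsum hs2, ← tsum_mul_left, ← tsum_mul_left,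
    ← ((hasSum_re hs0.hasSum).summable.mul_left 3).tsum_add
      ((hasSum_re hs1.hasSum).summable.mul_left 4),
    ← (((hasSum_re hs0.hasSum).summable.mul_left 3).add
      ((hasSum_re hs1.hasSum).summable.mul_left 4)).tsum_add (hasSum_re hs2.hasSum).summable]
  refine tsum_nonneg fun n => ?_
  rw [mangoldtL_term, mangoldtL_term, mangoldtL_term, re_ofReal_mul, re_ofReal_mul, re_ofReal_mul]
  have hA : 0 ≤ ArithmeticFunction.vonMangoldt n * (n : ℝ) ^ (-σ) :=
    mul_nonneg ArithmeticFunction.vonMangoldt_nonneg (by positivity)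
  rcases eq_or_ne n 0 with rfl | hn
  · simp
  have hn' : (n : ℂ) ≠ 0 := by exact_mod_cast hn
  set z : ℂ := χ n * (n : ℂ) ^ (-(t * I)) with hz
  have hz2 : (χ ^ 2) n * (n : ℂ) ^ (-((2 * t : ℝ) * I)) = z ^ 2 := by
    rw [hz, MulChar.pow_apply' χ two_ne_zero, mul_pow, ← cpow_nat_mul]
    congr 2
    push_cast
    ring
  have h1 : ((1 : DirichletCharacter ℂ 1) n * (n : ℂ) ^ (-((0 : ℝ) * I : ℂ))).re = 1 := by
    rw [MulChar.one_apply (isUnit_of_subsingleton _)]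
    simp
  rw [hz2, h1]
  have key : 0 ≤ 3 + 4 * z.re + (z ^ 2).re := by
    have hnorm : ‖(n : ℂ) ^ (-(t * I))‖ = 1 := by
      rw [norm_natCast_cpow_of_pos (Nat.pos_of_ne_zero hn)]
      simp
    by_cases hu : IsUnit (n : ZMod q)
    · have hzn : ‖z‖ = 1 := by
        rw [hz, norm_mul, hnorm, mul_one]
        exact χ.unit_norm_eq_one hu.unit
      exact three_add_four_mul_re_add_re_sq_nonneg hzn
    · have : z = 0 := by rw [hz, χ.map_nonunit hu, zero_mul]
      simp [this]
  nlinarith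

omit [NeZero q] in
theorem one_add_re_mangoldtL_nonneg {σ : ℝ} (hσ : 1 < σ) :
    0 ≤ (mangoldtL (1 : DirichletCharacter ℂ 1) σ).re + (mangoldtL χ σ).re := by
  have hs0 := mangoldtL_summable (1 : DirichletCharacter ℂ 1) (s := (σ : ℂ) + (0 : ℝ) * I)
    (by simpa)
  have hs1 := mangoldtL_summable χ (s := (σ : ℂ) + (0 : ℝ) * I) (by simpa)
  have h0 : (σ : ℂ) = σ + (0 : ℝ) * I := by simp
  rw [h0, mangoldtL, mangoldtL, LSeries, LSeries, re_tsum hs0, re_tsum hs1,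
    ← (hasSum_re hs0.hasSum).summable.tsum_add (hasSum_re hs1.hasSum).summable]
  refine tsum_nonneg fun n => ?_
  rw [mangoldtL_term, mangoldtL_term, re_ofReal_mul, re_ofReal_mul]
  have hA : 0 ≤ ArithmeticFunction.vonMangoldt n * (n : ℝ) ^ (-σ) :=
    mul_nonneg ArithmeticFunction.vonMangoldt_nonneg (by positivity)
  have h1 : ((1 : DirichletCharacter ℂ 1) n).re = 1 := by
    rw [MulChar.one_apply (isUnit_of_subsingleton _), one_re]
  have h2 := (abs_re_le_norm (χ n)).trans (χ.norm_le_one n)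
  simp only [ofReal_zero, zero_mul, neg_zero, cpow_zero, mul_one, h1]
  nlinarith [(abs_le.mp h2).1]

end DirichletCharacter

theorem re_one_div_add_mul_I (x y : ℝ) : (1 / ((x : ℂ) + y * I)).re = x / (x ^ 2 + y ^ 2) := by
  rw [one_div, inv_re, normSq_add_mul_I]
  simp

theorem div_sq_add_sq_le {x y c : ℝ} (hx : 0 < x) (hc : 0 < c) (hy : c ≤ y ^ 2) :
    x / (x ^ 2 + y ^ 2) ≤ x / c :=
  div_le_div_of_nonneg_left hx.le hc (hy.trans (le_add_of_nonneg_left (sq_nonneg x)))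

theorem zetaOne_ne_zero_of_norm_lt {s : ℂ} (hs : ‖s - 1‖ < s.re) : zetaOne s ≠ 0 := by
  have h0 : 0 < s.re := (norm_nonneg _).trans_lt hs
  have hs0 : s ≠ 0 := by rintro rfl; simp at h0
  rw [zetaOne_eq h0]
  intro h
  have h1 : (s - 1) * fracIntegral s = -1 := by
    apply mul_left_cancel₀ hs0
    linear_combination h
  have h2 := congrArg norm h1
  rw [norm_mul, norm_neg, norm_one] at h2
  have h3 := norm_fracIntegral_le h0
  have : ‖s - 1‖ * ‖fracIntegral s‖ < 1 := by
    calc ‖s - 1‖ * ‖fracIntegral s‖ ≤ ‖s - 1‖ * (1 / s.re) := by gcongr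
      _ < 1 := by rw [mul_one_div, div_lt_one h0]; exact hs
  linarith

namespace DirichletCharacter

variable {q : ℕ} [NeZero q] (χ : DirichletCharacter ℂ q)

theorem zetaOne_eq_zero_of_entireL_one_eq_zero {s : ℂ} (hs : 0 < s.re)
    (h : entireL (1 : DirichletCharacter ℂ q) s = 0) : zetaOne s = 0 := by
  rw [entireL_one, mul_eq_zero] at h
  refine h.resolve_right (Finset.prod_ne_zero_iff.mpr fun p hp => ?_)
  have hp := Nat.prime_of_mem_primeFactors hp
  intro h0
  have h1 : ‖(p : ℂ) ^ (-s)‖ = 1 := by rw [← sub_eq_zero.mp h0, norm_one]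
  rw [norm_natCast_cpow_of_pos hp.pos] at h1
  have := Real.rpow_lt_one_of_one_lt_of_neg (x := (p : ℝ)) (z := (-s).re)
    (by exact_mod_cast hp.one_lt) (by simpa)
  linarith

theorem re_mangoldtL_le {δ t ℒ : ℝ} (hδ : 0 < δ) (hδ2 : δ ≤ 1 / 2) (hℒ : 1 ≤ ℒ)
    (hq : q * (|t| + 4) ≤ Real.exp ℒ) (hδℒ : 1 / δ ≤ Real.exp (13 * ℒ)) (S : Finset ℂ)
    (hS : ∀ w ∈ S, w ∈ closedBall ((1 + δ : ℝ) + t * I : ℂ) (1 / 2) ∧ entireL χ w = 0)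
    (hcard : S.card ≤ 2) :
    (mangoldtL χ ((1 + δ : ℝ) + t * I)).re ≤ 1492 * ℒ + (poleOrder χ / (δ + t * I)).re -
      ∑ w ∈ S, (1 / (((1 + δ : ℝ) + t * I : ℂ) - w)).re := by
  rw [mangoldtL_eq χ (by simpa), add_re, neg_re]
  have := neg_re_logDeriv_entireL_le χ hδ hδ2 hℒ hq hδℒ S hS hcard
  have h1 : ((1 + δ : ℝ) : ℂ) + t * I - 1 = δ + t * I := by push_cast; ring
  rw [h1]
  linarith

set_option maxHeartbeats 1000000 in
theorem re_le_of_entireL_eq_zero {ρ : ℂ} {ℒ : ℝ} (hℒ : q * (2 * |ρ.im| + 4) ≤ Real.exp ℒ)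
    (h0 : entireL χ ρ = 0) (hex : χ ^ 2 = 1 → χ ≠ 1 → ρ.im ≠ 0) :
    ρ.re ≤ 1 - 1 / (750000 * ℒ) := by
  have hq1 : (1 : ℝ) ≤ q := by exact_mod_cast NeZero.pos q
  have hγ0 := abs_nonneg ρ.im
  have hℒ1 : 1 ≤ ℒ := by
    by_contra h
    have : Real.exp ℒ ≤ Real.exp 1 := Real.exp_le_exp.mpr (by linarith)
    have := Real.exp_one_lt_d9
    nlinarith
  set δ : ℝ := 1 / (50000 * ℒ) with hδdef
  have hδ : 0 < δ := by positivity
  have hℒδ : ℒ = 1 / 50000 * (1 / δ) := by rw [hδdef]; field_simp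
  have hδ1 : δ ≤ 1 / 50000 := by
    rw [hδdef]
    exact one_div_le_one_div_of_le (by norm_num) (by linarith)
  have hgoal : 1 / (750000 * ℒ) = δ / 15 := by rw [hδdef]; field_simp; norm_num
  rw [hgoal]
  by_contra! hlt
  have hβ1 : ρ.re < 1 := by
    by_contra! h
    exact entireL_ne_zero χ h h0
  have hδℒ : 1 / δ ≤ Real.exp (13 * ℒ) := by
    have h1 : (2.7 : ℝ) ≤ Real.exp 1 := by linarith [Real.exp_one_gt_d9]
    have h2 : Real.exp 12 = Real.exp 1 ^ 12 := by rw [← Real.exp_nat_mul]; norm_num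
    have h3 : Real.exp 12 ≤ Real.exp (12 * ℒ) := Real.exp_le_exp.mpr (by linarith)
    have h4 : (2.7 : ℝ) ^ 12 ≤ Real.exp 1 ^ 12 := by gcongr
    norm_num at h4
    have h5 : ℒ ≤ Real.exp ℒ := by linarith [Real.add_one_le_exp ℒ]
    have h6 : Real.exp (13 * ℒ) = Real.exp (12 * ℒ) * Real.exp ℒ := by
      rw [← Real.exp_add]; ring_nf
    rw [h6]
    calc 1 / δ = 50000 * ℒ := by rw [hδdef]; field_simp
      _ ≤ _ := by gcongr; linarith
  set u : ℝ := 1 + δ - ρ.re with hu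
  have huδ : δ < u := by linarith
  have huδ2 : u < 16 / 15 * δ := by linarith
  have hu0 : 0 < u := hδ.trans huδ
  have hu' : 15 / 16 * (1 / δ) < 1 / u := by
    rw [mul_one_div, div_lt_div_iff₀ hδ hu0]
    linarith
  have hz0 := re_mangoldtL_le (1 : DirichletCharacter ℂ 1) (t := 0) hδ (by linarith) hℒ1
    (by simp; nlinarith) hδℒ ∅ (by simp) (by simp)
  have hp1 : (poleOrder (1 : DirichletCharacter ℂ 1) / (δ + (0 : ℝ) * I)).re = 1 / δ := by
    rw [show (δ : ℂ) + (0 : ℝ) * I = δ by simp]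
    simp only [poleOrder, if_true]
    rw [← ofReal_one, ← ofReal_div, ofReal_re]
  have hI0 : ((1 + δ : ℝ) : ℂ) + (0 : ℝ) * I = (1 + δ : ℝ) := by simp
  rw [hp1, Finset.sum_empty, sub_zero, hI0] at hz0
  by_cases hD : χ ^ 2 = 1 ∧ χ ≠ 1 ∧ |ρ.im| < δ / 2
  · obtain ⟨hχ2, hχ1, hγ⟩ := hD
    have him := hex hχ2 hχ1
    have hne : ρ ≠ conj ρ := by
      intro h
      exact him (conj_eq_iff_im.mp h.symm)
    have hr : ∀ w : ℂ, w.re = ρ.re → |w.im| < δ / 2 →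
        w ∈ closedBall ((1 + δ : ℝ) + (0 : ℝ) * I : ℂ) (1 / 2) := by
      intro w hw1 hw2
      rw [mem_closedBall, dist_eq_norm]
      refine (norm_le_abs_re_add_abs_im _).trans ?_
      simp only [sub_re, sub_im, add_re, add_im, ofReal_re, ofReal_im, mul_re, mul_im, I_re, I_im,
        mul_zero, zero_mul, sub_zero, add_zero, hw1]
      rw [abs_sub_comm, ← hu, abs_of_pos hu0]
      linarith
    have hz1 := re_mangoldtL_le χ (t := 0) hδ (by linarith) hℒ1
      (by simp; nlinarith) hδℒ {ρ, conj ρ} (by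
        intro w hw
        rw [Finset.mem_insert, Finset.mem_singleton] at hw
        rcases hw with rfl | rfl
        · exact ⟨hr _ rfl hγ, h0⟩
        · refine ⟨hr _ (by simp) (by simpa using hγ), ?_⟩
          rw [entireL_of_ne_one hχ1] at h0 ⊢
          rw [LFunction_conj hχ1 hχ2 (by linarith), h0, map_zero]) Finset.card_le_two
    rw [Finset.sum_pair hne, hI0] at hz1
    have e1 : ((1 + δ : ℝ) : ℂ) - ρ = u + (-ρ.im : ℝ) * I := by
      apply Complex.ext <;> simp [hu]
    have e2 : ((1 + δ : ℝ) : ℂ) - conj ρ = u + (ρ.im : ℝ) * I := by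
      apply Complex.ext <;> simp [hu]
    rw [e1, e2, re_one_div_add_mul_I, re_one_div_add_mul_I] at hz1
    simp only [poleOrder, hχ1, if_false, zero_div, zero_re, neg_sq] at hz1
    have hpos := one_add_re_mangoldtL_nonneg χ (σ := 1 + δ) (by linarith)
    have hlow : 0.8 * (1 / u) ≤ u / (u ^ 2 + ρ.im ^ 2) := by
      have : ρ.im ^ 2 ≤ u ^ 2 / 4 := by
        rw [← sq_abs]
        nlinarith
      rw [mul_one_div, div_le_div_iff₀ hu0 (by positivity)]
      nlinarith
    have : 0 < 1 / δ := by positivity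
    linarith
  · have hz1 := re_mangoldtL_le χ (t := ρ.im) hδ (by linarith) hℒ1
      (le_trans (by gcongr; linarith) hℒ) hδℒ {ρ} (by
        intro w hw
        rw [Finset.mem_singleton] at hw
        subst hw
        refine ⟨?_, h0⟩
        rw [mem_closedBall, dist_eq_norm]
        refine (norm_le_abs_re_add_abs_im _).trans ?_
        simp only [sub_re, sub_im, add_re, add_im, ofReal_re, ofReal_im, mul_re, mul_im, I_re,
          I_im, mul_zero, add_zero, zero_add, mul_one, sub_self, abs_zero]
        rw [abs_sub_comm, ← hu, abs_of_pos hu0]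
        linarith) (by simp)
    have hz2 := re_mangoldtL_le (χ ^ 2) (t := 2 * ρ.im) hδ (by linarith) hℒ1
      (by rwa [abs_mul, abs_two]) hδℒ ∅ (by simp) (by simp)
    have h341 := three_four_one_nonneg χ (σ := 1 + δ) (by linarith) ρ.im
    rw [Finset.sum_empty, sub_zero] at hz2
    have e1 : ((1 + δ : ℝ) : ℂ) + ρ.im * I - ρ = (u : ℝ) := by
      apply Complex.ext <;> simp [hu]
    rw [Finset.sum_singleton, e1, ← ofReal_one, ← ofReal_div, ofReal_re] at hz1
    have hpos : 0 < 1 / δ := by positivity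
    by_cases hχ2 : χ ^ 2 = 1
    · by_cases hχ1 : χ = 1
      · have hγ : 1 / 2 ≤ |ρ.im| := by
          by_contra! hγ
          subst hχ1
          refine zetaOne_ne_zero_of_norm_lt ?_
            (zetaOne_eq_zero_of_entireL_one_eq_zero (by linarith) h0)
          refine (norm_le_abs_re_add_abs_im _).trans_lt ?_
          rw [sub_re, sub_im, one_re, one_im, sub_zero, abs_of_neg (by linarith)]
          linarith
        have hγ2 : 1 / 4 ≤ ρ.im ^ 2 := by rw [← sq_abs]; nlinarith
        simp only [poleOrder, hχ1, one_pow, if_true, re_one_div_add_mul_I] at hz1 hz2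
        have b1 : δ / (δ ^ 2 + ρ.im ^ 2) ≤ 4 * δ := by
          refine (div_sq_add_sq_le hδ (by norm_num) hγ2).trans (by linarith)
        have b2 : δ / (δ ^ 2 + (2 * ρ.im) ^ 2) ≤ δ := by
          refine (div_sq_add_sq_le (c := 1) hδ one_pos (by linarith)).trans (by linarith)
        have b3 : δ ≤ 1 / 2500000000 * (1 / δ) := by
          rw [mul_one_div, le_div_iff₀ hδ]
          nlinarith
        simp only [hχ1, one_pow] at h341
        linarith
      · have hγ : δ / 2 ≤ |ρ.im| := by
          by_contra! hγ
          exact hD ⟨hχ2, hχ1, hγ⟩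
        have hγ2 : δ ^ 2 / 4 ≤ ρ.im ^ 2 := by rw [← sq_abs ρ.im]; nlinarith
        simp only [poleOrder, hχ1, hχ2, if_true, if_false, re_one_div_add_mul_I, zero_div,
          zero_re] at hz1 hz2
        have b2 : δ / (δ ^ 2 + (2 * ρ.im) ^ 2) ≤ 1 / 2 * (1 / δ) := by
          have h4 : 0 < δ ^ 2 := by positivity
          rw [mul_one_div, div_le_div_iff₀ (by positivity) hδ]
          linarith
        rw [hχ2] at h341
        linarith
    · have hχ1 : χ ≠ 1 := by rintro rfl; simp at hχ2
      simp only [poleOrder, hχ1, hχ2, if_false, zero_div, zero_re] at hz1 hz2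
      linarith

end DirichletCharacter

section
open scoped ComplexOrder

theorem iteratedDeriv_alternating_of_deriv_eq {F D : ℂ → ℂ} {c : ℂ} (hF : AnalyticAt ℂ F c)
    (hD : AnalyticAt ℂ D c) (h : deriv F =ᶠ[𝓝 c] -(D * F))
    (hDpos : ∀ k, 0 ≤ (-1) ^ k * iteratedDeriv k D c) (h0 : 0 ≤ F c) (k : ℕ) :
    0 ≤ (-1) ^ k * iteratedDeriv k F c := by
  induction k using Nat.strong_induction_on with
  | _ k ih =>
    cases k with
    | zero => simpa
    | succ k =>
      rw [iteratedDeriv_succ', h.iteratedDeriv_eq, iteratedDeriv_neg,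
        iteratedDeriv_mul hD.contDiffAt hF.contDiffAt, pow_succ, mul_neg_one, neg_mul_neg,
        Finset.mul_sum]
      refine Finset.sum_nonneg fun i hi => ?_
      have hi' : i ≤ k := Nat.lt_succ_iff.mp (Finset.mem_range.mp hi)
      have e : (-1 : ℂ) ^ k * (k.choose i * iteratedDeriv i D c * iteratedDeriv (k - i) F c) =
          k.choose i * (((-1) ^ i * iteratedDeriv i D c) *
            ((-1) ^ (k - i) * iteratedDeriv (k - i) F c)) := by
        obtain ⟨j, rfl⟩ := Nat.exists_eq_add_of_le hi'
        rw [Nat.add_sub_cancel_left, pow_add]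
        ring
      rw [e]
      exact mul_nonneg (by exact_mod_cast Nat.zero_le _)
        (mul_nonneg (hDpos i) (ih _ (by omega)))

theorem iteratedDeriv_inv_sub_one_two (k : ℕ) :
    iteratedDeriv k (fun s : ℂ => (s - 1)⁻¹) 2 = (-1) ^ k * k.factorial := by
  rw [iteratedDeriv_comp_sub_const k (fun s : ℂ => s⁻¹) 1, iteratedDeriv_eq_iterate]
  have := iter_deriv_inv (𝕜 := ℂ) k (2 - 1)
  rw [show (fun s : ℂ => s⁻¹) = Inv.inv from rfl]
  beta_reduce
  rw [this]
  norm_num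

/-- Estermann's inequality, bounding the value at `1` of a function with a real zero near `1` and
an alternating Taylor expansion at `2`. -/
theorem one_sub_le_of_alternating {P : ℂ → ℂ} (hP : Differentiable ℂ P) {B : ℝ}
    (hB : ∀ s ∈ closedBall (2 : ℂ) (3 / 2), ‖P s‖ ≤ B) (h2 : P 2 = 1)
    (hpos : ∀ k, 0 ≤ (-1) ^ k * iteratedDeriv k (fun s => P s * (s - 1)⁻¹) 2)
    {σ : ℝ} (hσ : 7 / 8 ≤ σ) (hσ1 : σ < 1) (h0 : P σ = 0) {M : ℕ} (hM0 : 0 < M)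
    (hM : 32 * B * (3 / 4 : ℝ) ^ M ≤ 1) : (1 - σ) / 2 ≤ ‖P 1‖ * (2 - σ) ^ M := by
  set g : ℂ → ℂ := dslope P 1 with hg
  have hgd : Differentiable ℂ g := by
    rw [← differentiableOn_univ, hg, Complex.differentiableOn_dslope univ_mem]
    exact hP.differentiableOn
  have hgne : ∀ s : ℂ, s ≠ 1 → g s = P s * (s - 1)⁻¹ - P 1 * (s - 1)⁻¹ := by
    intro s hs
    rw [hg, dslope_of_ne _ hs, slope_def_field]
    ring
  have hB1 : ‖P 1‖ ≤ B := hB 1 (by rw [mem_closedBall, dist_eq_norm]; norm_num)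
  have hB0 : 1 ≤ B := by
    have := hB 2 (by simp; norm_num)
    rwa [h2, norm_one] at this
  have hgB : ∀ s ∈ sphere (2 : ℂ) (3 / 2), ‖g s‖ ≤ 4 * B := by
    intro s hs
    have hs' : ‖s - 2‖ = 3 / 2 := by simpa [dist_eq_norm] using hs
    have h1 : 1 / 2 ≤ ‖s - 1‖ := by
      have : ‖s - 2‖ ≤ ‖s - 1‖ + ‖(1 : ℂ)‖ := by
        refine le_trans (le_of_eq ?_) (norm_sub_le _ _); congr 1; ring
      rw [hs', norm_one] at this
      linarith
    have hs1 : s ≠ 1 := by rintro rfl; norm_num at h1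
    rw [hgne s hs1, ← sub_mul, norm_mul, norm_inv]
    have h3 : ‖P s - P 1‖ ≤ 2 * B :=
      (norm_sub_le _ _).trans (by linarith [hB s (sphere_subset_closedBall hs)])
    have h4 : ‖s - 1‖⁻¹ ≤ 2 := by
      rw [inv_le_comm₀ (by linarith) (by norm_num)]; linarith
    calc _ ≤ (2 * B) * 2 := by gcongr
      _ = _ := by ring
  set b : ℕ → ℂ := fun k => (-1) ^ k * iteratedDeriv k (fun s => P s * (s - 1)⁻¹) 2 /
    k.factorial with hb
  have hia : AnalyticAt ℂ (fun s : ℂ => (s - 1)⁻¹) 2 :=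
    (analyticAt_id.sub analyticAt_const).inv (by norm_num)
  have hcoef : ∀ k, iteratedDeriv k g 2 / k.factorial = (-1) ^ k * (b k - P 1) := by
    intro k
    have he : g =ᶠ[𝓝 2] (fun s => P s * (s - 1)⁻¹) - fun s => P 1 * (s - 1)⁻¹ := by
      filter_upwards [isOpen_ne.mem_nhds (show (2 : ℂ) ≠ 1 by norm_num)] with s hs
      exact hgne s hs
    have hf : (k.factorial : ℂ) ≠ 0 := by exact_mod_cast k.factorial_ne_zero
    have hsq : ((-1 : ℂ) ^ k) * (-1) ^ k = 1 := by rw [← mul_pow]; norm_num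
    have h1 : AnalyticAt ℂ (fun s => P s * (s - 1)⁻¹) 2 := (hP.analyticAt 2).mul hia
    have h2 : AnalyticAt ℂ (fun s => P 1 * (s - 1)⁻¹) 2 := analyticAt_const.mul hia
    rw [he.iteratedDeriv_eq, iteratedDeriv_sub h1.contDiffAt
      h2.contDiffAt, iteratedDeriv_const_mul_field,
      iteratedDeriv_inv_sub_one_two]
    simp only [hb]
    generalize iteratedDeriv k (fun s => P s * (s - 1)⁻¹) 2 = X
    field_simp
    linear_combination (-X) * hsq
  have hx1 : 1 < 2 - σ := by linarith
  have hxc : ((σ : ℂ) - 2) = -((2 - σ : ℝ) : ℂ) := by push_cast; ring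
  have hmem : (σ : ℂ) ∈ ball (2 : ℂ) (3 / 2) := by
    rw [mem_ball, dist_eq_norm, hxc, norm_neg, norm_real, Real.norm_of_nonneg (by linarith)]
    linarith
  have hterm : ∀ k, ((k.factorial : ℂ))⁻¹ • ((σ : ℂ) - 2) ^ k • iteratedDeriv k g 2 =
      (b k - P 1) * ((2 - σ : ℝ) : ℂ) ^ k := by
    intro k
    have h1 := hcoef k
    have hsq : ((-1 : ℂ) ^ k) * (-1) ^ k = 1 := by rw [← mul_pow]; norm_num
    rw [hxc, neg_pow, smul_eq_mul, smul_eq_mul]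
    rw [div_eq_mul_inv] at h1
    linear_combination ((-1) ^ k * ((2 - σ : ℝ) : ℂ) ^ k) * h1 +
      ((b k - P 1) * ((2 - σ : ℝ) : ℂ) ^ k) * hsq
  have hsum : HasSum (fun k => (b k - P 1) * ((2 - σ : ℝ) : ℂ) ^ k) (g σ) := by
    have := Complex.hasSum_taylorSeries_on_ball (f := g) hgd.differentiableOn hmem
    simpa only [hterm] using this
  have hbd : ∀ k, ‖(b k - P 1) * ((2 - σ : ℝ) : ℂ) ^ k‖ ≤ 4 * B * (3 / 4) ^ k := by
    intro k
    have h1 := Complex.norm_iteratedDeriv_le_of_forall_mem_sphere_norm_le k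
      (by norm_num : (0 : ℝ) < 3 / 2) hgd.diffContOnCl hgB
    have hf : (0 : ℝ) < k.factorial := by exact_mod_cast k.factorial_pos
    rw [← hterm, norm_smul, norm_smul, norm_inv, Complex.norm_natCast, norm_pow, hxc, norm_neg, norm_real,
      Real.norm_of_nonneg (by linarith)]
    calc _ ≤ (k.factorial : ℝ)⁻¹ * ((9 / 8) ^ k * (k.factorial * (4 * B) / (3 / 2) ^ k)) := by
          gcongr
          linarith
      _ = 4 * B * ((9 / 8) ^ k / (3 / 2) ^ k) := by field_simp
      _ = _ := by rw [← div_pow]; norm_num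
  have htail : ‖g σ - ∑ k ∈ Finset.range M, (b k - P 1) * ((2 - σ : ℝ) : ℂ) ^ k‖ ≤ 1 / 2 := by
    have h1 := (hasSum_nat_add_iff' M).mpr hsum
    have h2 : HasSum (fun k => 4 * B * (3 / 4 : ℝ) ^ (k + M)) (4 * B * (3 / 4) ^ M * 4) := by
      have := (hasSum_geometric_of_lt_one (r := (3 / 4 : ℝ)) (by norm_num) (by norm_num)).mul_left
        (4 * B * (3 / 4 : ℝ) ^ M)
      norm_num at this
      refine (funext fun k => ?_ : (fun k => 4 * B * (3 / 4 : ℝ) ^ (k + M)) = _) ▸ this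
      rw [pow_add]; ring
    refine (h1.norm_le_of_bounded h2 fun k => hbd _).trans (by linarith)
  have hgσ : g σ = P 1 / ((1 - σ : ℝ) : ℂ) := by
    have : (σ : ℂ) ≠ 1 := by exact_mod_cast hσ1.ne
    rw [hgne _ this, h0]
    have h1 : (σ : ℂ) - 1 ≠ 0 := sub_ne_zero.mpr this
    have h3 : (1 : ℂ) - σ ≠ 0 := sub_ne_zero.mpr this.symm
    push_cast
    field_simp
    ring
  have hgeom : ∑ k ∈ Finset.range M, (b k - P 1) * ((2 - σ : ℝ) : ℂ) ^ k =
      ∑ k ∈ Finset.range M, b k * ((2 - σ : ℝ) : ℂ) ^ k -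
        P 1 * ((((2 - σ : ℝ) : ℂ) ^ M - 1) / ((1 - σ : ℝ) : ℂ)) := by
    have : ((2 - σ : ℝ) : ℂ) ≠ 1 := by exact_mod_cast hx1.ne'
    rw [show ((1 - σ : ℝ) : ℂ) = ((2 - σ : ℝ) : ℂ) - 1 by push_cast; ring, ← geom_sum_eq this,
      Finset.mul_sum, ← Finset.sum_sub_distrib]
    exact Finset.sum_congr rfl fun k _ => by ring
  have hσc : ((1 - σ : ℝ) : ℂ) ≠ 0 := by exact_mod_cast (sub_pos.mpr hσ1).ne'
  have hkey : g σ - ∑ k ∈ Finset.range M, (b k - P 1) * ((2 - σ : ℝ) : ℂ) ^ k =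
      P 1 * ((2 - σ : ℝ) : ℂ) ^ M / ((1 - σ : ℝ) : ℂ) -
        ∑ k ∈ Finset.range M, b k * ((2 - σ : ℝ) : ℂ) ^ k := by
    rw [hgeom, hgσ]
    field_simp
    ring
  have hbre : ∀ k, 0 ≤ (b k).re ∧ (b k).im = 0 := by
    intro k
    have h1 : 0 ≤ b k := by
      simp only [hb]
      exact div_nonneg (hpos k) (by exact_mod_cast Nat.zero_le _)
    exact ⟨(Complex.le_def.mp h1).1, (Complex.le_def.mp h1).2.symm⟩
  have hre : 1 ≤ (∑ k ∈ Finset.range M, b k * ((2 - σ : ℝ) : ℂ) ^ k).re := by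
    rw [re_sum]
    have h1 : ∀ k, (b k * ((2 - σ : ℝ) : ℂ) ^ k).re = (b k).re * (2 - σ) ^ k := by
      intro k
      rw [← ofReal_pow, re_mul_ofReal]
    have h3 : (b 0 * ((2 - σ : ℝ) : ℂ) ^ 0).re = 1 := by
      simp [hb, h2]
      norm_num
    rw [← h3]
    refine Finset.single_le_sum (f := fun k => (b k * ((2 - σ : ℝ) : ℂ) ^ k).re) (fun k _ => ?_)
      (Finset.mem_range.mpr hM0)
    rw [h1]
    exact mul_nonneg (hbre k).1 (by positivity)
  rw [hkey] at htail
  have h4 : 1 / 2 ≤ ‖P 1 * ((2 - σ : ℝ) : ℂ) ^ M / ((1 - σ : ℝ) : ℂ)‖ := by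
    have h5 := norm_sub_norm_le (∑ k ∈ Finset.range M, b k * ((2 - σ : ℝ) : ℂ) ^ k)
      (P 1 * ((2 - σ : ℝ) : ℂ) ^ M / ((1 - σ : ℝ) : ℂ))
    have h6 := re_le_norm (∑ k ∈ Finset.range M, b k * ((2 - σ : ℝ) : ℂ) ^ k)
    rw [norm_sub_rev] at h5
    linarith
  rw [norm_div, norm_mul, norm_pow, norm_real, norm_real, Real.norm_of_nonneg (by linarith),
    Real.norm_of_nonneg (by linarith), le_div_iff₀ (by linarith)] at h4
  linarith

end

theorem norm_tailIntegral_le_of_rpow {E : ℝ → ℂ} {B δ : ℝ}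
    (hB : ∀ t, 1 < t → ‖E t‖ ≤ B * t ^ δ) {s : ℂ}
    (hs : δ < s.re) : ‖tailIntegral E s‖ ≤ B / (s.re - δ) := by
  have h1 : ∀ t ∈ Ioi (1 : ℝ), ‖E t * (t : ℂ) ^ (-(s + 1))‖ ≤ B * t ^ (-(s.re - δ) - 1) := by
    intro t ht
    have ht0 : (0 : ℝ) < t := zero_lt_one.trans ht
    rw [norm_mul, norm_cpow_eq_rpow_re_of_pos ht0,
      show -(s.re - δ) - 1 = δ + (-(s + 1)).re by simp; ring, Real.rpow_add ht0, ← mul_assoc]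
    gcongr
    exact hB t ht
  have hi : IntegrableOn (fun t : ℝ => B * t ^ (-(s.re - δ) - 1)) (Ioi 1) :=
    (integrableOn_Ioi_rpow_of_lt (by linarith) zero_lt_one).const_mul _
  refine (norm_integral_le_of_norm_le hi ((ae_restrict_iff' measurableSet_Ioi).mpr
    (Eventually.of_forall h1))).trans (le_of_eq ?_)
  rw [integral_const_mul, integral_Ioi_rpow_of_lt (by linarith) zero_lt_one]
  have : s.re - δ ≠ 0 := by linarith
  simp only [sub_add_cancel, Real.one_rpow]
  rw [neg_div_neg_eq]
  field_simp

namespace DirichletCharacter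

variable {q : ℕ} [NeZero q] {χ : DirichletCharacter ℂ q}

theorem norm_sum_Icc_le_rpow (hχ : χ ≠ 1) {t δ : ℝ} (ht : 1 ≤ t) (hδ : 0 ≤ δ) (hδ1 : δ ≤ 1) :
    ‖∑ k ∈ Finset.Icc 1 ⌊t⌋₊, χ (k : ZMod q)‖ ≤ (q : ℝ) ^ δ * t ^ (1 - δ) := by
  have h1 := norm_sum_Icc_le hχ ⌊t⌋₊
  have h2 : ‖∑ k ∈ Finset.Icc 1 ⌊t⌋₊, χ (k : ZMod q)‖ ≤ t := by
    refine (norm_sum_le _ _).trans ((Finset.sum_le_sum fun k _ => χ.norm_le_one _).trans ?_)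
    simpa using Nat.floor_le (by linarith)
  calc _ = ‖∑ k ∈ Finset.Icc 1 ⌊t⌋₊, χ (k : ZMod q)‖ ^ δ *
        ‖∑ k ∈ Finset.Icc 1 ⌊t⌋₊, χ (k : ZMod q)‖ ^ (1 - δ) := by
        rw [← Real.rpow_add_of_nonneg (norm_nonneg _) hδ (by linarith)]; simp
    _ ≤ (q : ℝ) ^ δ * t ^ (1 - δ) := by gcongr

theorem norm_LFunction_le_rpow (hχ : χ ≠ 1) {η : ℝ} (hη : 0 < η) (hη1 : η ≤ 1 / 2) {s : ℂ}
    (hs : 1 - η ≤ s.re) : ‖LFunction χ s‖ ≤ ‖s‖ * ((q : ℝ) ^ (2 * η) / η) := by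
  rw [LFunction_eq_tailIntegral hχ (by linarith), norm_mul]
  gcongr
  refine (norm_tailIntegral_le_of_rpow (δ := 1 - 2 * η) (fun t ht =>
    norm_sum_Icc_le_rpow hχ ht.le (by linarith) (by linarith)) (by linarith)).trans ?_
  gcongr
  linarith

/-- The product `(s - 1) ζ(s) L(s, χ) L(s, ψ) L(s, χψ)`. -/
noncomputable def quadProd (χ ψ : DirichletCharacter ℂ q) (s : ℂ) : ℂ :=
  zetaOne s * entireL χ s * entireL ψ s * entireL (χ * ψ) s

variable {ψ : DirichletCharacter ℂ q}

theorem differentiable_quadProd : Differentiable ℂ (quadProd χ ψ) := by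
  have := differentiable_zetaOne
  have h1 := differentiable_entireL χ
  have h2 := differentiable_entireL ψ
  have h3 := differentiable_entireL (χ * ψ)
  unfold quadProd
  fun_prop

theorem entireL_one_level_one (s : ℂ) : entireL (1 : DirichletCharacter ℂ 1) s = zetaOne s := by
  simp [entireL_one]

theorem norm_quadProd_le {s : ℂ} (hs : s ∈ closedBall (2 : ℂ) (3 / 2)) :
    ‖quadProd χ ψ s‖ ≤ 61 ^ 4 * (q : ℝ) ^ 3 := by
  rw [mem_closedBall, dist_eq_norm] at hs
  have h1 : 1 / 2 ≤ s.re := by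
    have := (abs_le.mp ((abs_re_le_norm (s - 2)).trans hs)).1
    simp at this
    linarith
  have h2 : ‖s‖ ≤ 7 / 2 := by
    have := norm_sub_norm_le s 2
    simp at this
    linarith
  have h3 : (‖s‖ + 1) ^ 2 ≤ 61 / 3 := by
    have := norm_nonneg s
    nlinarith
  have hL : ∀ θ : DirichletCharacter ℂ q, ‖entireL θ s‖ ≤ 61 * q := fun θ =>
    (norm_entireL_le θ h1).trans (by
      calc _ ≤ 3 * (q : ℝ) * (61 / 3) := by gcongr
        _ = _ := by ring)
  have hz : ‖zetaOne s‖ ≤ 61 := (norm_zetaOne_le h1).trans (by linarith)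
  rw [quadProd, norm_mul, norm_mul, norm_mul]
  calc _ ≤ 61 * (61 * (q : ℝ)) * (61 * q) * (61 * q) := by gcongr <;> apply hL
    _ = _ := by ring

theorem le_norm_quadProd_two : 1 / 81 ≤ ‖quadProd χ ψ 2‖ := by
  have hL : ∀ {m : ℕ} [NeZero m] (θ : DirichletCharacter ℂ m), 1 / 3 ≤ ‖entireL θ 2‖ := by
    intro m _ θ
    have := le_norm_entireL θ (s := 2) (by simp) (by simp)
    simp at this ⊢
    norm_num at this
    linarith
  have hz := hL (1 : DirichletCharacter ℂ 1)
  rw [entireL_one_level_one] at hz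
  rw [quadProd, norm_mul, norm_mul, norm_mul]
  calc (1 / 81 : ℝ) = 1 / 3 * (1 / 3) * (1 / 3) * (1 / 3) := by norm_num
    _ ≤ _ := by gcongr <;> apply hL

/-- The coefficients of the Dirichlet series of `-F'/F` for `F = ζ L(χ) L(ψ) L(χψ)`. -/
noncomputable def quadCoeff (χ ψ : DirichletCharacter ℂ q) (n : ℕ) : ℂ :=
  (1 + χ n) * (1 + ψ n) * (ArithmeticFunction.vonMangoldt n : ℂ)

open scoped ComplexOrder in
theorem one_add_apply_nonneg (hχ : χ ^ 2 = 1) (a : ZMod q) : 0 ≤ 1 + χ a := by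
  have h1 := conj_eq_iff_real.mp (conj_apply_of_sq_eq_one hχ a)
  obtain ⟨r, hr⟩ := h1
  have h2 := χ.norm_le_one a
  rw [hr, norm_real, Real.norm_eq_abs] at h2
  rw [hr, ← ofReal_one, ← ofReal_add, zero_le_real]
  linarith [(abs_le.mp h2).1]

open scoped ComplexOrder in
theorem quadCoeff_nonneg (hχ : χ ^ 2 = 1) (hψ : ψ ^ 2 = 1) : 0 ≤ quadCoeff χ ψ := fun n =>
  mul_nonneg (mul_nonneg (one_add_apply_nonneg hχ _) (one_add_apply_nonneg hψ _))
    (by rw [zero_le_real]; exact ArithmeticFunction.vonMangoldt_nonneg)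

/-- The Dirichlet coefficients of `-L'/L`. -/
noncomputable def mangoldtCoeff {m : ℕ} (χ : DirichletCharacter ℂ m) : ℕ → ℂ :=
  (fun n : ℕ => χ n) * fun n : ℕ => (ArithmeticFunction.vonMangoldt n : ℂ)

omit [NeZero q] in
theorem quadCoeff_eq : quadCoeff χ ψ =
    (mangoldtCoeff (1 : DirichletCharacter ℂ 1) + mangoldtCoeff χ) +
      (mangoldtCoeff ψ + mangoldtCoeff (χ * ψ)) := by
  ext n
  simp only [quadCoeff, mangoldtCoeff, Pi.add_apply, Pi.mul_apply, MulChar.coeToFun_mul,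
    MulChar.one_apply (isUnit_of_subsingleton _)]
  ring

omit [NeZero q] in
theorem summable_mangoldtCoeff (χ : DirichletCharacter ℂ q) {s : ℂ} (hs : 1 < s.re) :
    LSeriesSummable (mangoldtCoeff χ) s :=
  mangoldtL_summable χ hs

omit [NeZero q] in
theorem summable_quadCoeff {s : ℂ} (hs : 1 < s.re) : LSeriesSummable (quadCoeff χ ψ) s := by
  rw [quadCoeff_eq]
  exact ((summable_mangoldtCoeff 1 hs).add (summable_mangoldtCoeff χ hs)).add
    ((summable_mangoldtCoeff ψ hs).add (summable_mangoldtCoeff (χ * ψ) hs))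

omit [NeZero q] in
theorem LSeries_quadCoeff {s : ℂ} (hs : 1 < s.re) : LSeries (quadCoeff χ ψ) s =
    mangoldtL (1 : DirichletCharacter ℂ 1) s + mangoldtL χ s + (mangoldtL ψ s +
      mangoldtL (χ * ψ) s) := by
  have h0 := summable_mangoldtCoeff (1 : DirichletCharacter ℂ 1) hs
  have h1 := summable_mangoldtCoeff χ hs
  have h2 := summable_mangoldtCoeff ψ hs
  have h3 := summable_mangoldtCoeff (χ * ψ) hs
  rw [quadCoeff_eq, LSeries_add (h0.add h1) (h2.add h3), LSeries_add h0 h1, LSeries_add h2 h3]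
  rfl

theorem quadProd_ne_zero {s : ℂ} (hs : 1 ≤ s.re) : quadProd χ ψ s ≠ 0 := by
  rw [quadProd, ← entireL_one_level_one]
  exact mul_ne_zero (mul_ne_zero (mul_ne_zero (entireL_ne_zero _ hs) (entireL_ne_zero _ hs))
    (entireL_ne_zero _ hs)) (entireL_ne_zero _ hs)

theorem deriv_quadProd_mul_inv (hχ : χ ≠ 1) (hψ : ψ ≠ 1) (hχψ : χ * ψ ≠ 1) (c : ℂ) {s : ℂ}
    (hs : 1 < s.re) : deriv (fun s => quadProd χ ψ s * c * (s - 1)⁻¹) s =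
      -(LSeries (quadCoeff χ ψ) s * (quadProd χ ψ s * c * (s - 1)⁻¹)) := by
  have h1 : s - 1 ≠ 0 := sub_ne_zero.mpr (by rintro rfl; simp at hs)
  rw [LSeries_quadCoeff hs, mangoldtL_eq _ hs, mangoldtL_eq _ hs, mangoldtL_eq _ hs,
    mangoldtL_eq _ hs]
  have e : ∀ {m : ℕ} [NeZero m] (θ : DirichletCharacter ℂ m),
      HasDerivAt (entireL θ) (deriv (entireL θ) s) s := fun θ =>
    (differentiable_entireL θ s).hasDerivAt
  have hd := ((((((e (1 : DirichletCharacter ℂ 1)).mul (e χ)).mul (e ψ)).mul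
    (e (χ * ψ))).mul_const c).mul (((hasDerivAt_id s).sub_const 1).inv h1)).deriv
  have n0 := entireL_ne_zero (1 : DirichletCharacter ℂ 1) hs.le
  have n1 := entireL_ne_zero χ hs.le
  have n2 := entireL_ne_zero ψ hs.le
  have n3 := entireL_ne_zero (χ * ψ) hs.le
  have hf : (fun s => quadProd χ ψ s * c * (s - 1)⁻¹) = fun s => entireL (1 : DirichletCharacter ℂ 1) s
      * entireL χ s * entireL ψ s * entireL (χ * ψ) s * c * (s - 1)⁻¹ := by
    ext s; rw [quadProd, entireL_one_level_one]
  have hd' : deriv (fun s => entireL (1 : DirichletCharacter ℂ 1) s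
      * entireL χ s * entireL ψ s * entireL (χ * ψ) s * c * (s - 1)⁻¹) s = _ := hd
  rw [hf, hd', quadProd, ← entireL_one_level_one]
  simp only [poleOrder, if_true, if_neg hχ, if_neg hψ, if_neg hχψ, Pi.mul_apply, Pi.inv_apply, id]
  field_simp
  ring

end DirichletCharacter

namespace DirichletCharacter

variable {q : ℕ} [NeZero q] {χ ψ : DirichletCharacter ℂ q}

open scoped ComplexOrder in
theorem quadProd_alternating (hχ2 : χ ^ 2 = 1) (hψ2 : ψ ^ 2 = 1) (hχ : χ ≠ 1) (hψ : ψ ≠ 1)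
    (hχψ : χ * ψ ≠ 1) (k : ℕ) : 0 ≤ (-1) ^ k * iteratedDeriv k
      (fun s => quadProd χ ψ s * (quadProd χ ψ 2)⁻¹ * (s - 1)⁻¹) 2 := by
  have hab : LSeries.abscissaOfAbsConv (quadCoeff χ ψ) < (2 : ℝ) := by
    refine lt_of_le_of_lt (LSeries.abscissaOfAbsConv_le_of_forall_lt_LSeriesSummable (x := 1)
      fun y hy => summable_quadCoeff (by simpa using hy)) ?_
    exact_mod_cast (by norm_num : (1 : ℝ) < 2)
  have h2 : (2 : ℂ) = ((2 : ℝ) : ℂ) := by norm_num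
  have hev : ∀ᶠ s : ℂ in 𝓝 2, 1 < s.re :=
    (isOpen_lt continuous_const continuous_re).mem_nhds (show (1 : ℝ) < (2 : ℂ).re by simp)
  have h0 : quadProd χ ψ 2 ≠ 0 := quadProd_ne_zero (by simp)
  refine iteratedDeriv_alternating_of_deriv_eq (D := LSeries (quadCoeff χ ψ)) ?_ ?_ ?_ ?_ ?_ k
  · exact ((differentiable_quadProd.analyticAt 2).mul analyticAt_const).mul
      ((analyticAt_id.sub analyticAt_const).inv (by norm_num))
  · refine LSeries_analyticOnNhd _ _ ?_
    simpa using hab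
  · filter_upwards [hev] with s hs
    rw [deriv_quadProd_mul_inv hχ hψ hχψ _ hs]
    rfl
  · intro k
    have := LSeries.iteratedDeriv_alternating (quadCoeff_nonneg hχ2 hψ2) hab k
    rwa [h2]
  · simp only [mul_inv_cancel₀ h0]
    norm_num

theorem one_sub_le_norm_quadProd_one (hχ2 : χ ^ 2 = 1) (hψ2 : ψ ^ 2 = 1) (hχ : χ ≠ 1) (hψ : ψ ≠ 1)
    (hχψ : χ * ψ ≠ 1) {σ : ℝ} (hσ : 7 / 8 ≤ σ) (hσ1 : σ < 1) (h0 : entireL χ σ = 0) :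
    1 - σ ≤ 162 * Real.exp 13 * (q : ℝ) ^ (12 * (1 - σ)) * ‖quadProd χ ψ 1‖ := by
  have hq : (1 : ℝ) ≤ q := by exact_mod_cast NeZero.one_le
  have hP0 : quadProd χ ψ 2 ≠ 0 := quadProd_ne_zero (by simp)
  have hinv : ‖(quadProd χ ψ 2)⁻¹‖ ≤ 81 := by
    rw [norm_inv, inv_le_comm₀ (norm_pos_iff.mpr hP0) (by norm_num)]
    simpa using le_norm_quadProd_two (χ := χ) (ψ := ψ)
  set B : ℝ := 61 ^ 4 * (q : ℝ) ^ 3 * 81 with hB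
  set M : ℕ := ⌈4 * Real.log (32 * B)⌉₊ with hM
  have hB1 : 1 ≤ B := by
    have : (1 : ℝ) ≤ (q : ℝ) ^ 3 := one_le_pow₀ hq
    linarith
  have hlog : 0 < Real.log (32 * B) := Real.log_pos (by linarith)
  have hlog34 : Real.log (3 / 4) ≤ -(1 / 4) := by
    have := Real.log_le_sub_one_of_pos (show (0 : ℝ) < 3 / 4 by norm_num)
    linarith
  have hMle : 4 * Real.log (32 * B) ≤ M := Nat.le_ceil _
  have hMlt : (M : ℝ) < 4 * Real.log (32 * B) + 1 := Nat.ceil_lt_add_one (by linarith)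
  have hkey := one_sub_le_of_alternating (P := fun s => quadProd χ ψ s * (quadProd χ ψ 2)⁻¹)
    (differentiable_quadProd.mul_const _) (B := B)
    (fun s hs => by
      rw [norm_mul]
      have := norm_quadProd_le (χ := χ) (ψ := ψ) hs
      exact mul_le_mul this hinv (norm_nonneg _) (by positivity)) (mul_inv_cancel₀ hP0) (quadProd_alternating hχ2 hψ2 hχ hψ hχψ) hσ hσ1
      (by simp [quadProd, h0]) (M := M) (Nat.ceil_pos.mpr (by linarith)) (by
        rw [← Real.log_le_log_iff (by positivity) one_pos, Real.log_mul (by positivity)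
          (by positivity), Real.log_pow, Real.log_one]
        nlinarith)
  have hlogB : Real.log (32 * B) ≤ 25 + 3 * Real.log q := by
    rw [show 32 * B = (32 * 61 ^ 4 * 81) * (q : ℝ) ^ 3 by rw [hB]; ring, Real.log_mul (by norm_num)
      (by positivity), Real.log_pow]
    have : Real.log (32 * 61 ^ 4 * 81) ≤ 25 := by
      rw [Real.log_le_iff_le_exp (by norm_num), show (25 : ℝ) = (25 : ℕ) * 1 by norm_num,
        Real.exp_nat_mul]
      calc (32 * 61 ^ 4 * 81 : ℝ) ≤ 2.7182818283 ^ 25 := by norm_num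
        _ ≤ _ := by gcongr; exact Real.exp_one_gt_d9.le
    push_cast
    linarith
  have hlq : 0 ≤ Real.log q := Real.log_nonneg hq
  have hpow : (2 - σ) ^ M ≤ Real.exp 13 * (q : ℝ) ^ (12 * (1 - σ)) := by
    rw [Real.rpow_def_of_pos (by linarith), ← Real.exp_add]
    calc (2 - σ) ^ M ≤ Real.exp (1 - σ) ^ M := by
          have := Real.add_one_le_exp (1 - σ)
          gcongr
          · linarith
          · linarith
      _ = Real.exp (M * (1 - σ)) := by rw [Real.exp_nat_mul]
      _ ≤ _ := by
          apply Real.exp_le_exp.mpr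
          have : (M : ℝ) ≤ 101 + 12 * Real.log q := by linarith
          have h3 := mul_le_mul_of_nonneg_right this (sub_pos.mpr hσ1).le
          linarith
  have h1 : ‖quadProd χ ψ 1 * (quadProd χ ψ 2)⁻¹‖ ≤ ‖quadProd χ ψ 1‖ * 81 := by
    rw [norm_mul]; gcongr
  have := hkey.trans (mul_le_mul h1 hpow (by have : 0 ≤ 2 - σ := by linarith
                                             positivity) (by positivity))
  linarith

theorem norm_quadProd_le_rpow (hχ : χ ≠ 1) (hψ : ψ ≠ 1) (hχψ : χ * ψ ≠ 1) {η : ℝ} (hη : 0 < η)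
    (hη1 : η ≤ 1 / 4) {s : ℂ} (hs : ‖s - 1‖ ≤ η) :
    ‖quadProd χ ψ s‖ ≤ 32 * (q : ℝ) ^ (6 * η) / η ^ 3 := by
  have hq : (0 : ℝ) ≤ q := Nat.cast_nonneg _
  have h1 : 1 - η ≤ s.re := by
    have := (abs_le.mp ((abs_re_le_norm (s - 1)).trans hs)).1
    simp at this
    linarith
  have h2 : ‖s‖ ≤ 5 / 4 := by
    have := norm_sub_norm_le s 1
    simp at this
    linarith
  have hz : ‖zetaOne s‖ ≤ 16 := (norm_zetaOne_le (by linarith)).trans (by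
    have := norm_nonneg s
    nlinarith)
  have hL : ∀ θ : DirichletCharacter ℂ q, θ ≠ 1 →
      ‖entireL θ s‖ ≤ 5 / 4 * ((q : ℝ) ^ (2 * η) / η) := fun θ hθ => by
    rw [entireL_of_ne_one hθ]
    refine (norm_LFunction_le_rpow hθ hη (by linarith) h1).trans ?_
    gcongr
  rw [quadProd, norm_mul, norm_mul, norm_mul]
  have h6 : (q : ℝ) ^ (6 * η) = ((q : ℝ) ^ (2 * η)) ^ 3 := by
    rw [← Real.rpow_natCast, ← Real.rpow_mul hq]
    congr 1; push_cast; ring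
  calc _ ≤ 16 * (5 / 4 * ((q : ℝ) ^ (2 * η) / η)) * (5 / 4 * ((q : ℝ) ^ (2 * η) / η)) *
        (5 / 4 * ((q : ℝ) ^ (2 * η) / η)) := by
        gcongr
        exacts [hL _ hχ, hL _ hψ, hL _ hχψ]
    _ = 125 / 4 * (((q : ℝ) ^ (2 * η)) ^ 3 / η ^ 3) := by ring
    _ ≤ 32 * (((q : ℝ) ^ (2 * η)) ^ 3 / η ^ 3) := by gcongr; norm_num
    _ = _ := by rw [h6]; ring

theorem norm_quadProd_one_le (hχ : χ ≠ 1) (hψ : ψ ≠ 1) (hχψ : χ * ψ ≠ 1) {η : ℝ} (hη : 0 < η)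
    (hη1 : η ≤ 1 / 4) {β : ℝ} (hβ : 1 - η / 2 ≤ β) (hβ1 : β < 1) (h0 : entireL ψ β = 0) :
    ‖quadProd χ ψ 1‖ ≤ 64 * (q : ℝ) ^ (6 * η) / η ^ 4 * (1 - β) := by
  have hd : ∀ s ∈ closedBall (1 : ℂ) (η / 2), ‖deriv (quadProd χ ψ) s‖ ≤
      64 * (q : ℝ) ^ (6 * η) / η ^ 4 := by
    intro s hs
    rw [mem_closedBall, dist_eq_norm] at hs
    refine (Complex.norm_deriv_le_of_forall_mem_sphere_norm_le (half_pos hη)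
      differentiable_quadProd.diffContOnCl (C := 32 * (q : ℝ) ^ (6 * η) / η ^ 3)
      fun z hz => ?_).trans (le_of_eq ?_)
    · refine norm_quadProd_le_rpow hχ hψ hχψ hη hη1 ?_
      rw [mem_sphere, dist_eq_norm] at hz
      calc ‖z - 1‖ = ‖(z - s) + (s - 1)‖ := by congr 1; ring
        _ ≤ _ := norm_add_le _ _
        _ ≤ η := by linarith
    · field_simp
      ring
  have hβn : ‖(1 : ℂ) - β‖ = 1 - β := by
    rw [← ofReal_one, ← ofReal_sub, norm_real, Real.norm_of_nonneg (by linarith)]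
  have := Convex.norm_image_sub_le_of_norm_deriv_le (𝕜 := ℂ) (f := quadProd χ ψ)
    (fun s _ => differentiable_quadProd s) hd (convex_closedBall (1 : ℂ) (η / 2)) (x := (β : ℂ))
    (y := 1)
    (by rw [mem_closedBall, dist_comm, dist_eq_norm, hβn]; linarith)
    (mem_closedBall_self (by linarith))
  rwa [hβn, show quadProd χ ψ β = 0 by simp [quadProd, h0], sub_zero] at this

theorem one_sub_le_of_two_zeros (hχ2 : χ ^ 2 = 1) (hψ2 : ψ ^ 2 = 1) (hχ : χ ≠ 1) (hψ : ψ ≠ 1)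
    (hχψ : χ * ψ ≠ 1) {η : ℝ} (hη : 0 < η) (hη1 : η ≤ 1 / 8) {σ β : ℝ} (hσ : 1 - η ≤ σ)
    (hσ1 : σ < 1) (h0 : entireL χ σ = 0) (hβ : 1 - η / 2 ≤ β) (hβ1 : β < 1)
    (h0' : entireL ψ β = 0) :
    1 - σ ≤ 162 * Real.exp 13 * 64 / η ^ 4 * (q : ℝ) ^ (18 * η) * (1 - β) := by
  have hq : (1 : ℝ) ≤ q := by exact_mod_cast NeZero.one_le
  have h1 := one_sub_le_norm_quadProd_one hχ2 hψ2 hχ hψ hχψ (by linarith) hσ1 h0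
  have h2 := norm_quadProd_one_le hχ hψ hχψ hη (by linarith) hβ hβ1 h0'
  have hb : 0 ≤ 1 - β := by linarith
  calc _ ≤ _ := h1
    _ ≤ 162 * Real.exp 13 * (q : ℝ) ^ (12 * η) * (64 * (q : ℝ) ^ (6 * η) / η ^ 4 * (1 - β)) := by
        gcongr
        linarith
    _ = 162 * Real.exp 13 * 64 / η ^ 4 * ((q : ℝ) ^ (12 * η) * (q : ℝ) ^ (6 * η)) * (1 - β) := by
        ring
    _ = _ := by
        rw [← Real.rpow_add (by linarith)]
        ring_nf

theorem LFunction_changeLevel_eq_zero_iff {m : ℕ} [NeZero m] (h : m ∣ q)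
    {θ : DirichletCharacter ℂ m} (hθ : θ ≠ 1) {s : ℂ} (hs : 0 < s.re) :
    LFunction (changeLevel h θ) s = 0 ↔ LFunction θ s = 0 := by
  rw [LFunction_changeLevel h θ (.inl hθ), mul_eq_zero, or_iff_left]
  rw [Finset.prod_eq_zero_iff]
  rintro ⟨p, hp, hp0⟩
  have hp' := Nat.prime_of_mem_primeFactors hp
  have h1 : ‖θ p * (p : ℂ) ^ (-s)‖ < 1 := by
    rw [norm_mul, Complex.norm_natCast_cpow_of_pos hp'.pos]
    calc _ ≤ 1 * (p : ℝ) ^ ((-s).re) := by gcongr; exact θ.norm_le_one _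
      _ < 1 := by
        rw [one_mul]
        exact Real.rpow_lt_one_of_one_lt_of_neg (by exact_mod_cast hp'.one_lt) (by simpa using hs)
  rw [← sub_eq_zero.mp hp0, norm_one] at h1
  exact lt_irrefl _ h1

/-- Siegel's theorem on real zeros of quadratic `L`-functions. -/
theorem exists_le_one_sub_of_LFunction_eq_zero {ε : ℝ} (hε : 0 < ε) :
    ∃ c > 0, ∀ (q : ℕ) [NeZero q] (χ : DirichletCharacter ℂ q) (β : ℝ), χ ≠ 1 → χ ^ 2 = 1 →
      LFunction χ β = 0 → β ≤ 1 - c * (q : ℝ) ^ (-ε) := by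
  set η : ℝ := min (ε / 18) (1 / 8) with hη
  have hη0 : 0 < η := lt_min (by positivity) (by norm_num)
  have hη1 : η ≤ 1 / 8 := min_le_right _ _
  have hη2 : 18 * η ≤ ε := by have := min_le_left (ε / 18) (1 / 8 : ℝ); linarith
  have hqle : ∀ (q : ℕ) [NeZero q], (q : ℝ) ^ (-ε) ≤ 1 := fun q _ =>
    Real.rpow_le_one_of_one_le_of_nonpos (by exact_mod_cast NeZero.one_le) (by linarith)
  have hlt1 : ∀ (q : ℕ) [NeZero q] (χ : DirichletCharacter ℂ q) (β : ℝ), χ ≠ 1 →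
      LFunction χ β = 0 → β < 1 := fun q _ χ β hχ h0 => by
    by_contra! h
    exact LFunction_ne_zero_of_one_le_re χ (.inl hχ) (s := β) (by simpa using h) h0
  by_cases hex : ∃ (m : ℕ) (_ : NeZero m) (θ : DirichletCharacter ℂ m) (σ : ℝ), θ ≠ 1 ∧
      θ ^ 2 = 1 ∧ LFunction θ σ = 0 ∧ 1 - η ≤ σ
  · obtain ⟨m, _, θ, σ, hθ, hθ2, h0, hσ⟩ := hex
    have hσ1 := hlt1 m θ σ hθ h0
    have hm : (0 : ℝ) < m := by exact_mod_cast NeZero.pos m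
    obtain ⟨δ, hδ, hδ1⟩ : ∃ δ > 0, ∀ β : ℝ, LFunction θ β = 0 → β ≤ 1 - δ := by
      have hne : ∀ᶠ s in 𝓝 (1 : ℂ), LFunction θ s ≠ 0 :=
        (differentiable_LFunction hθ).continuous.continuousAt.eventually_ne
          (LFunction_apply_one_ne_zero hθ)
      obtain ⟨δ, hδ, h⟩ := Metric.eventually_nhds_iff.mp hne
      refine ⟨δ, hδ, fun β hβ => ?_⟩
      by_contra! hlt
      refine h ?_ hβ
      have := hlt1 m θ β hθ hβ
      rw [dist_comm, dist_eq_norm, ← ofReal_one, ← ofReal_sub, norm_real,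
        Real.norm_of_nonneg (by linarith)]
      linarith
    set K : ℝ := 162 * Real.exp 13 * 64 / η ^ 4 * (m : ℝ) ^ (18 * η) with hK
    have hK0 : 0 < K := by positivity
    refine ⟨min (η / 2) (min δ ((1 - σ) / K)), lt_min (by positivity) (lt_min hδ
      (div_pos (by linarith) hK0)), fun q _ χ β hχ hχ2 hβ => ?_⟩
    have hβ1 := hlt1 q χ β hχ hβ
    have hc0 : 0 ≤ min (η / 2) (min δ ((1 - σ) / K)) := le_min (by positivity) (le_min hδ.le
      (div_pos (by linarith) hK0).le)
    have hq1 : (1 : ℝ) ≤ q := by exact_mod_cast NeZero.one_le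
    by_cases hβ2 : β < 1 - η / 2
    · have := mul_le_mul (min_le_left (η / 2) (min δ ((1 - σ) / K))) (hqle q) (by positivity)
        (by positivity)
      linarith
    push Not at hβ2
    have hσ' : 0 < (σ : ℂ).re := by rw [ofReal_re]; linarith
    have hβ' : 0 < (β : ℂ).re := by rw [ofReal_re]; linarith
    have d1 : m ∣ m * q := dvd_mul_right _ _
    have d2 : q ∣ m * q := dvd_mul_left _ _
    set θ' := changeLevel d1 θ with hθ'
    set χ' := changeLevel d2 χ with hχ'
    have e1 : θ' ^ 2 = 1 := by rw [hθ', ← map_pow, hθ2, map_one]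
    have e2 : χ' ^ 2 = 1 := by rw [hχ', ← map_pow, hχ2, map_one]
    have n1 : θ' ≠ 1 := fun h => hθ ((changeLevel_eq_one_iff d1).mp h)
    have n2 : χ' ≠ 1 := fun h => hχ ((changeLevel_eq_one_iff d2).mp h)
    have z1 : LFunction θ' σ = 0 := (LFunction_changeLevel_eq_zero_iff d1 hθ hσ').mpr h0
    have z2 : LFunction χ' β = 0 := (LFunction_changeLevel_eq_zero_iff d2 hχ hβ').mpr hβ
    by_cases hprod : θ' * χ' = 1
    · have heq : θ' = χ' := by
        rw [sq] at e2
        exact mul_right_cancel (hprod.trans e2.symm)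
      rw [← heq, LFunction_changeLevel_eq_zero_iff d1 hθ hβ'] at z2
      have h3 := hδ1 β z2
      have := mul_le_mul ((min_le_right (η / 2) (min δ ((1 - σ) / K))).trans (min_le_left _ _))
        (hqle q) (by positivity) hδ.le
      linarith
    · have h3 := one_sub_le_of_two_zeros e1 e2 n1 n2 hprod hη0 hη1 hσ hσ1
        (by rw [entireL_of_ne_one n1, z1]) hβ2 hβ1 (by rw [entireL_of_ne_one n2, z2])
      push_cast at h3
      rw [Real.mul_rpow hm.le (by linarith)] at h3
      have h4 : (q : ℝ) ^ (18 * η) ≤ (q : ℝ) ^ ε := Real.rpow_le_rpow_of_exponent_le hq1 hη2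
      have hb : 0 ≤ 1 - β := by linarith
      have h5 : 1 - σ ≤ K * (q : ℝ) ^ ε * (1 - β) := by
        refine h3.trans ?_
        rw [← mul_assoc, hK]
        gcongr
      have h6 : min (η / 2) (min δ ((1 - σ) / K)) * (q : ℝ) ^ (-ε) ≤
          (1 - σ) / K * (q : ℝ) ^ (-ε) := by
        gcongr
        exact (min_le_right _ _).trans (min_le_right _ _)
      have h7 : (1 - σ) / K * (q : ℝ) ^ (-ε) ≤ 1 - β := by
        rw [Real.rpow_neg (by linarith), ← div_eq_mul_inv, div_div, div_le_iff₀ (by positivity)]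
        linarith
      linarith
  · push Not at hex
    refine ⟨η, hη0, fun q _ χ β hχ hχ2 hβ => ?_⟩
    have h1 := hex q ‹_› χ β hχ hχ2 hβ
    have := mul_le_mul_of_nonneg_left (hqle q) hη0.le
    linarith

end DirichletCharacter

namespace DirichletCharacter

/-- Zero-free region for moduli bounded by a power of the parameter `Y`. -/
theorem exists_re_le_of_entireL_eq_zero {A : ℝ} (hA : 0 < A) :
    ∃ κ > 0, κ ≤ 1 / 8 ∧ ∀ᶠ Y : ℝ in atTop, ∀ (q : ℕ) [NeZero q], (q : ℝ) ≤ Y ^ A →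
      ∀ (χ : DirichletCharacter ℂ q) (ρ : ℂ), |ρ.im| ≤ Real.exp Y + 1 → entireL χ ρ = 0 →
        ρ.re ≤ 1 - 3 * κ / Y := by
  obtain ⟨c, hc, h⟩ := exists_le_one_sub_of_LFunction_eq_zero (inv_pos.mpr hA)
  refine ⟨min (1 / 8) (min (1 / 6750000) (c / 3)), lt_min (by norm_num) (lt_min (by norm_num)
    (by positivity)), min_le_left _ _, ?_⟩
  filter_upwards [(isLittleO_rpow_exp_atTop A).bound one_pos, eventually_ge_atTop 2]
    with Y hY1 hY2 q _ hq χ ρ hρ h0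
  set κ := min (1 / 8 : ℝ) (min (1 / 6750000) (c / 3)) with hκ
  have hY0 : 0 < Y := by linarith
  have hκ1 : 3 * κ ≤ 1 / 2250000 := by
    have : κ ≤ 1 / 6750000 := (min_le_right _ _).trans (min_le_left _ _)
    linarith
  have hκ2 : 3 * κ ≤ c := by
    have : κ ≤ c / 3 := (min_le_right _ _).trans (min_le_right _ _)
    linarith
  rw [Real.norm_of_nonneg (by positivity), Real.norm_of_nonneg (by positivity), one_mul] at hY1
  by_cases hex : χ ^ 2 = 1 ∧ χ ≠ 1 ∧ ρ.im = 0
  · obtain ⟨h2, h1, him⟩ := hex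
    rw [entireL_of_ne_one h1] at h0
    have h3 := h q χ ρ.re h1 h2 (by rwa [show ((ρ.re : ℝ) : ℂ) = ρ from
      Complex.ext (by simp) (by simp [him])])
    have hq0 : (0 : ℝ) < q := by exact_mod_cast NeZero.pos q
    have h4 : (q : ℝ) ^ A⁻¹ ≤ Y := by
      calc _ ≤ (Y ^ A) ^ A⁻¹ := by gcongr
        _ = Y := Real.rpow_rpow_inv hY0.le hA.ne'
    have h5 : 3 * κ / Y ≤ c * (q : ℝ) ^ (-A⁻¹) := by
      rw [Real.rpow_neg hq0.le, ← div_eq_mul_inv]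
      gcongr
    linarith
  · have h3 := re_le_of_entireL_eq_zero χ (ρ := ρ) (ℒ := 3 * Y) (by
      have e2 : (6 : ℝ) ≤ Real.exp Y := by
        have := Real.quadratic_le_exp_of_nonneg hY0.le
        have h8 := Real.add_one_le_exp Y
        calc (6 : ℝ) ≤ 2.7182818283 ^ 2 := by norm_num
          _ ≤ Real.exp 1 ^ 2 := by gcongr; exact Real.exp_one_gt_d9.le
          _ = Real.exp 2 := by rw [← Real.exp_nat_mul]; norm_num
          _ ≤ _ := Real.exp_le_exp.mpr hY2
      rw [show 3 * Y = Y + (Y + Y) by ring, Real.exp_add, Real.exp_add]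
      have : 2 * |ρ.im| + 4 ≤ Real.exp Y * Real.exp Y := by nlinarith
      have hq' := hq.trans hY1
      gcongr) h0 (fun h2 h1 him => hex ⟨h2, h1, him⟩)
    refine h3.trans ?_
    have : 3 * κ / Y ≤ 1 / 2250000 / Y := by gcongr
    rw [div_div] at this
    rw [show 750000 * (3 * Y) = 2250000 * Y by ring]
    linarith

theorem exists_norm_logDeriv_entireL_le {A : ℝ} (hA : 0 < A) :
    ∃ κ > 0, κ ≤ 1 / 8 ∧ ∀ᶠ Y : ℝ in atTop, ∀ (q : ℕ) [NeZero q], (q : ℝ) ≤ Y ^ A →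
      ∀ (χ : DirichletCharacter ℂ q) (s : ℂ), |s.im| ≤ Real.exp Y → 1 - κ / Y ≤ s.re →
        s.re ≤ 1 + κ / Y → entireL χ s ≠ 0 ∧
        ‖deriv (entireL χ) s / entireL χ s‖ ≤ 66 / κ * Y ^ 2 := by
  obtain ⟨κ, hκ, hκ8, h⟩ := exists_re_le_of_entireL_eq_zero hA
  refine ⟨κ, hκ, hκ8, ?_⟩
  filter_upwards [(isLittleO_rpow_exp_atTop A).bound one_pos, eventually_ge_atTop 2,
    eventually_ge_atTop κ⁻¹, h] with Y hY1 hY2 hYκ hz q _ hq χ s him hre1 hre2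
  have hY0 : 0 < Y := by linarith
  rw [Real.norm_of_nonneg (by positivity), Real.norm_of_nonneg (by positivity), one_mul] at hY1
  have hδ : 0 < κ / Y := by positivity
  have hδ1 : κ / Y ≤ 1 / 16 := by
    rw [div_le_iff₀ hY0]; linarith
  set c : ℂ := ((1 + κ / Y : ℝ) : ℂ) + s.im * I with hc
  have hcre : c.re = 1 + κ / Y := by simp [hc]
  have hcim : c.im = s.im := by simp [hc]
  set R : ℝ := 4 * κ / Y with hR
  have hR0 : 0 < R := by positivity
  have hReq : R = 4 * (κ / Y) := by rw [hR]; ring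
  have hball : ∀ z ∈ ball c R, 1 - 3 * κ / Y < z.re ∧ |z.im| ≤ Real.exp Y + 1 ∧
      ‖z‖ ≤ Real.exp Y + 3 := by
    intro z hzb
    rw [mem_ball, dist_eq_norm] at hzb
    have h1 := abs_lt.mp ((abs_re_le_norm (z - c)).trans_lt hzb)
    have h2 := (abs_im_le_norm (z - c)).trans_lt hzb
    rw [sub_re, hcre] at h1
    rw [sub_im, hcim] at h2
    have h3 : 1 - 3 * κ / Y < z.re := by
      have : 3 * κ / Y = 3 * (κ / Y) := by ring
      linarith [h1.1]
    have h4 : |z.im| ≤ Real.exp Y + 1 := by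
      have := abs_sub_abs_le_abs_sub z.im s.im
      linarith
    refine ⟨h3, h4, (norm_le_abs_re_add_abs_im z).trans ?_⟩
    have : |z.re| ≤ 2 := by
      rw [abs_le]
      have : 3 * κ / Y = 3 * (κ / Y) := by ring
      constructor <;> linarith [h1.2]
    linarith
  have hne : ∀ z ∈ ball c R, entireL χ z ≠ 0 := fun z hzb h0 =>
    (hz q hq χ z (hball z hzb).2.1 h0).not_gt (hball z hzb).1
  have hs : s ∈ closedBall c (R / 2) := by
    rw [mem_closedBall, dist_eq_norm, show s - c = ((s.re - (1 + κ / Y) : ℝ) : ℂ) from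
      Complex.ext (by simp [hcre]) (by simp [hcim]), norm_real, Real.norm_eq_abs, abs_le]
    constructor <;> linarith
  refine ⟨hne s (closedBall_subset_ball (by linarith) hs), ?_⟩
  have hexp : 6 ≤ Real.exp Y := by
    calc (6 : ℝ) ≤ 2.7182818283 ^ 2 := by norm_num
      _ ≤ Real.exp 1 ^ 2 := by gcongr; exact Real.exp_one_gt_d9.le
      _ = Real.exp 2 := by rw [← Real.exp_nat_mul]; norm_num
      _ ≤ _ := Real.exp_le_exp.mpr hY2
  have hYe : Y ≤ Real.exp Y := by linarith [Real.add_one_le_exp Y]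
  have hκe : κ⁻¹ ≤ Real.exp Y := hYκ.trans hYe
  have hlow : 1 ≤ Real.exp Y ^ 5 * ‖entireL χ c‖ := by
    have h1 := le_norm_entireL χ (s := c) (by rw [hcre]; linarith) (by rw [hcre]; linarith)
    rw [hcre, add_sub_cancel_left] at h1
    have h2 : 1 ≤ Real.exp Y ^ 2 * (κ / Y) := by
      calc 1 = (Y * κ⁻¹) * (κ / Y) := by field_simp
        _ ≤ (Real.exp Y * Real.exp Y) * (κ / Y) := by gcongr
        _ = _ := by ring
    calc (1 : ℝ) ≤ (Real.exp Y ^ 2 * (κ / Y)) ^ 2 := one_le_pow₀ h2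
      _ = Real.exp Y ^ 4 * (3 * ((κ / Y) ^ 2 / 3)) := by ring
      _ ≤ Real.exp Y ^ 4 * (Real.exp Y * ‖entireL χ c‖) := by gcongr; linarith
      _ = _ := by ring
  have hbd : ∀ z ∈ ball c R, ‖entireL χ z‖ ≤ Real.exp (11 * Y) * ‖entireL χ c‖ := by
    intro z hzb
    obtain ⟨h1, -, h3⟩ := hball z hzb
    have h4 : 3 * κ / Y = 3 * (κ / Y) := by ring
    have hq' : (q : ℝ) ≤ Real.exp Y := hq.trans hY1
    calc _ ≤ 3 * q * (‖z‖ + 1) ^ 2 := norm_entireL_le χ (by linarith)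
      _ ≤ Real.exp Y * Real.exp Y * (Real.exp Y * Real.exp Y) ^ 2 := by
          gcongr
          · linarith
          · nlinarith
      _ = Real.exp Y ^ 6 * 1 := by ring
      _ ≤ Real.exp Y ^ 6 * (Real.exp Y ^ 5 * ‖entireL χ c‖) := by gcongr
      _ = _ := by
          rw [← mul_assoc, ← pow_add, ← Real.exp_nat_mul]
          norm_num
  refine (norm_logDeriv_le_of_ne_zero hR0 (by positivity : 0 < 11 * Y)
    (differentiable_entireL χ).differentiableOn hne hbd hs).trans (le_of_eq ?_)
  rw [hR]
  field_simp
  norm_num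

end DirichletCharacter

/-- The Mellin transform `1 / (s (s + 1))` of `u ↦ max 0 (1 - u)`. -/
noncomputable def rieszKernel (s : ℂ) : ℂ := 1 / s - 1 / (s + 1)

theorem rieszKernel_eq {s : ℂ} (hs : 0 < s.re) : rieszKernel s = 1 / (s * (s + 1)) := by
  have h1 : s ≠ 0 := by rintro rfl; simp at hs
  have h2 : s + 1 ≠ 0 := by
    intro h
    have := congrArg Complex.re h
    simp at this
    linarith
  rw [rieszKernel]
  field_simp
  ring

theorem differentiableAt_rieszKernel {s : ℂ} (hs : 0 < s.re) :
    DifferentiableAt ℂ rieszKernel s := by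
  have h1 : s ≠ 0 := by rintro rfl; simp at hs
  have h2 : s + 1 ≠ 0 := by
    intro h
    have := congrArg Complex.re h
    simp at this
    linarith
  unfold rieszKernel
  fun_prop (disch := assumption)

theorem norm_rieszKernel_le {s : ℂ} (hs : 1 / 2 ≤ s.re) : ‖rieszKernel s‖ ≤ 4 / (1 + s.im ^ 2) := by
  have h1 : 1 / 4 + s.im ^ 2 ≤ ‖s‖ ^ 2 := by
    rw [← normSq_eq_norm_sq, normSq_apply]; nlinarith
  have h2 : ‖s‖ ≤ ‖s + 1‖ := by
    rw [← sq_le_sq₀ (norm_nonneg _) (norm_nonneg _), ← normSq_eq_norm_sq, ← normSq_eq_norm_sq,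
      normSq_apply, normSq_apply]
    simp
    nlinarith
  have h0 : 0 < ‖s‖ := norm_pos_iff.mpr (by rintro rfl; norm_num at hs)
  rw [rieszKernel_eq (by linarith), norm_div, norm_one, norm_mul]
  rw [div_le_div_iff₀ (mul_pos h0 (h0.trans_le h2)) (by positivity)]
  nlinarith

theorem norm_rieszKernel_mul_le {s : ℂ} (hs : 1 / 2 ≤ s.re) :
    ‖rieszKernel s‖ * (1 + ‖s‖) ≤ 3 / (1 + |s.im|) * 2 := by
  have h0 : 1 / 2 ≤ ‖s‖ := hs.trans ((le_abs_self _).trans (abs_re_le_norm s))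
  have h2 : |s.im| ≤ ‖s + 1‖ := by simpa using abs_im_le_norm (s + 1)
  have h3 : 1 ≤ ‖s + 1‖ := by
    have := (le_abs_self _).trans (abs_re_le_norm (s + 1))
    simp at this
    linarith
  have ha := abs_nonneg s.im
  rw [rieszKernel_eq (by linarith), norm_div, norm_one, norm_mul, div_mul_eq_mul_div,
    div_mul_eq_mul_div, div_le_div_iff₀ (by positivity) (by positivity)]
  have h4 : 1 + ‖s‖ ≤ 3 * ‖s‖ := by linarith
  have h5 : 1 + |s.im| ≤ 2 * ‖s + 1‖ := by linarith
  have := mul_le_mul h4 h5 (by positivity) (by positivity)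
  linarith

theorem integrable_rieszKernel {σ : ℝ} (hσ : 1 / 2 ≤ σ) :
    Integrable fun t : ℝ => rieszKernel (σ + t * I) := by
  refine Integrable.mono' (integrable_inv_one_add_sq.const_mul 4) ?_ (Eventually.of_forall fun t => ?_)
  · refine Continuous.aestronglyMeasurable (continuous_iff_continuousAt.mpr fun t => ?_)
    refine ContinuousAt.comp (f := fun t : ℝ => (σ : ℂ) + t * I)
      (differentiableAt_rieszKernel (by simp; linarith)).continuousAt ?_
    fun_prop
  · simpa [div_eq_mul_inv] using norm_rieszKernel_le (s := σ + t * I) (by simpa using hσ)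

theorem integral_cpow_mul_rieszKernel {σ u : ℝ} (hσ : 1 / 2 ≤ σ) (hu : 0 < u) :
    ∫ t : ℝ, (u : ℂ) ^ (-(σ + t * I)) * rieszKernel (σ + t * I) =
      2 * Real.pi * (max 0 (1 - u) : ℝ) := by
  set f : ℝ → ℂ := fun u => (max 0 (1 - u) : ℝ) with hf
  have hm : ∀ s : ℂ, 0 < s.re → HasMellin f s (rieszKernel s) := by
    intro s hs
    have h1 := hasMellin_one_Ioc hs
    have h2 := hasMellin_cpow_Ioc 1 (s := s) (by simp; linarith)
    have h3 := hasMellin_sub h1.1 h2.1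
    rw [h1.2, h2.2] at h3
    have he : EqOn (fun t : ℝ => indicator (Ioc 0 1) (fun _ => 1 : ℝ → ℂ) t -
        indicator (Ioc 0 1) (fun t => (t : ℂ) ^ (1 : ℂ) : ℝ → ℂ) t) f (Ioi 0) := by
      intro t ht
      by_cases h : t ≤ 1
      · have : t ∈ Ioc (0 : ℝ) 1 := ⟨ht, h⟩
        simp only [indicator_of_mem this, hf, cpow_one]
        rw [max_eq_right (by linarith)]
        push_cast; rfl
      · have : t ∉ Ioc (0 : ℝ) 1 := fun h' => h h'.2
        simp only [indicator_of_notMem this, hf]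
        rw [max_eq_left (by linarith)]
        simp
    refine ⟨?_, ?_⟩
    · refine h3.1.congr_fun (fun t ht => ?_) measurableSet_Ioi
      simp only [he ht]
    · rw [← show mellin _ s = rieszKernel s from h3.2]
      refine setIntegral_congr_fun measurableSet_Ioi fun t ht => ?_
      simp only [he ht]
  have hmel : ∀ t : ℝ, mellin f (σ + t * I) = rieszKernel (σ + t * I) := fun t =>
    (hm _ (by simp; linarith)).2
  have hinv := mellinInv_mellin_eq σ f hu (hm σ (by simp; linarith)).1 (by
    have := integrable_rieszKernel hσ
    simpa only [VerticalIntegrable, hmel] using this) (by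
      have : Continuous f := by simp only [hf]; fun_prop
      exact this.continuousAt)
  rw [mellinInv] at hinv
  simp only [hmel, smul_eq_mul] at hinv
  have hpi : (Real.pi : ℂ) ≠ 0 := by exact_mod_cast Real.pi_ne_zero
  have h4 : ((max 0 (1 - u) : ℝ) : ℂ) = f u := rfl
  rw [h4, ← hinv, real_smul]
  push_cast
  rw [← mul_assoc, mul_one_div_cancel (mul_ne_zero two_ne_zero hpi), one_mul]

theorem two_pi_mul_tsum_riesz {a : ℕ → ℂ} {σ x : ℝ} (hσ : 1 / 2 ≤ σ) (hx : 0 < x)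
    (ha : LSeriesSummable a σ) :
    2 * Real.pi * ∑' n : ℕ, (if n = 0 then 0 else a n) * (max 0 (1 - n / x) : ℝ) =
      ∫ t : ℝ, (x : ℂ) ^ (σ + t * I) * rieszKernel (σ + t * I) * LSeries a (σ + t * I) := by
  have hxc : (x : ℂ) ≠ 0 := by exact_mod_cast hx.ne'
  set F : ℕ → ℝ → ℂ := fun n t => (x : ℂ) ^ (σ + t * I) * rieszKernel (σ + t * I) *
    LSeries.term a (σ + t * I) n with hF
  have hn : ∀ n (t : ℝ), ‖LSeries.term a (σ + t * I) n‖ = ‖LSeries.term a σ n‖ := by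
    intro n t
    rw [LSeries.norm_term_eq, LSeries.norm_term_eq]
    simp
  have hnF : ∀ n t, ‖F n t‖ = ‖rieszKernel (σ + t * I)‖ * (x ^ σ * ‖LSeries.term a σ n‖) := by
    intro n t
    rw [hF]
    simp only
    rw [norm_mul, norm_mul, hn, norm_cpow_eq_rpow_re_of_pos hx]
    simp
    ring
  have hFe : ∀ n t, F n t = (if n = 0 then 0 else a n) *
      (((n / x : ℝ) : ℂ) ^ (-(σ + t * I)) * rieszKernel (σ + t * I)) := by
    intro n t
    rw [hF]
    simp only [LSeries.term_def]
    split_ifs with h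
    · simp
    · have h1 : (0 : ℝ) ≤ n := Nat.cast_nonneg n
      have h2 : (n : ℂ) ^ ((σ : ℂ) + t * I) ≠ 0 := by simp [cpow_eq_zero_iff, h]
      rw [div_eq_mul_inv (n : ℝ), ofReal_mul, mul_cpow_ofReal_nonneg h1 (by positivity), ofReal_inv,
        ofReal_natCast, cpow_neg, inv_cpow, cpow_neg, inv_inv]
      · field_simp
      · rw [arg_ofReal_of_nonneg hx.le]; exact Real.pi_pos.ne
  have hinteg : ∀ n, Integrable (F n) := by
    intro n
    refine Integrable.mono' ((integrable_rieszKernel hσ).norm.mul_const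
      (x ^ σ * ‖LSeries.term a σ n‖)) ?_ (Eventually.of_forall fun t => (hnF n t).le)
    have hK := (integrable_rieszKernel hσ).aestronglyMeasurable
    have h1 : Continuous fun t : ℝ => (x : ℂ) ^ (σ + t * I) := by
      refine Continuous.const_cpow (by fun_prop) (.inl hxc)
    have h2 : Continuous fun t : ℝ => LSeries.term a (σ + t * I) n := by
      simp only [LSeries.term_def]
      split_ifs with h
      · fun_prop
      · have hn0 : (n : ℂ) ≠ 0 := by exact_mod_cast h
        refine Continuous.div continuous_const (Continuous.const_cpow (by fun_prop) (.inl hn0))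
          fun t => by simp [cpow_eq_zero_iff, h]
    exact (h1.aestronglyMeasurable.mul hK).mul h2.aestronglyMeasurable
  have hsum := hasSum_integral_of_summable_integral_norm hinteg (by
    simp only [hnF, integral_mul_const]
    exact (ha.norm.mul_left _).mul_left _)
  have hR : ∀ t : ℝ, ∑' n, F n t = (x : ℂ) ^ (σ + t * I) * rieszKernel (σ + t * I) *
      LSeries a (σ + t * I) := fun t => by rw [hF]; simp only; rw [tsum_mul_left, LSeries]
  simp only [hR] at hsum
  rw [← hsum.tsum_eq, ← tsum_mul_left]
  refine tsum_congr fun n => ?_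
  simp only [hFe]
  rw [integral_const_mul]
  by_cases h : n = 0
  · simp [h]
  · rw [integral_cpow_mul_rieszKernel hσ (by positivity)]
    ring

theorem setIntegral_Ioi_norm_rieszKernel_le {f : ℝ → ℂ} {D T : ℝ} (hT : 0 < T)
    (hf : ∀ t, T < t → ‖f t‖ ≤ D * (4 / (1 + t ^ 2))) (hD : 0 ≤ D) :
    ‖∫ t in Ioi T, f t‖ ≤ D * (4 / T) := by
  have hi : ∫ t in Ioi T, D * 4 * t ^ (-2 : ℝ) = D * (4 / T) := by
    rw [integral_const_mul, integral_Ioi_rpow_of_lt (by norm_num) hT]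
    rw [show (-2 : ℝ) + 1 = -1 by norm_num, Real.rpow_neg_one]
    field_simp
  rw [← hi]
  refine norm_integral_le_of_norm_le
    ((integrableOn_Ioi_rpow_of_lt (by norm_num) hT).const_mul _) ?_
  refine (ae_restrict_iff' measurableSet_Ioi).mpr (Eventually.of_forall fun t ht => ?_)
  have ht0 : 0 < t := hT.trans ht
  refine (hf t ht).trans ?_
  rw [Real.rpow_neg ht0.le, mul_assoc, ← div_eq_mul_inv]
  norm_cast
  gcongr
  linarith

/-- Shifting the line of integration to the left inside `|Im s| ≤ T`. -/
theorem norm_integral_cpow_mul_rieszKernel_le {G : ℂ → ℂ} {a b T B x : ℝ} (ha : 7 / 8 ≤ a)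
    (hab : a < b) (hb : b ≤ 9 / 8) (hT : 1 ≤ T) (hx : 1 ≤ x) (hB : 0 ≤ B)
    (hG : DifferentiableOn ℂ G (uIcc a b ×ℂ uIcc (-T) T))
    (hGB : ∀ s ∈ uIcc a b ×ℂ uIcc (-T) T, ‖G s‖ ≤ B * (1 + ‖s‖))
    (hc : Continuous fun t : ℝ => G (b + t * I))
    (hbB : ∀ t : ℝ, ‖G (b + t * I)‖ ≤ B) :
    ‖∫ t : ℝ, (x : ℂ) ^ (b + t * I) * rieszKernel (b + t * I) * G (b + t * I)‖ ≤
      12 * B * (x ^ a * T + x ^ b / T) := by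
  have hx0 : 0 < x := by linarith
  have hT0 : 0 < T := by linarith
  set F : ℂ → ℂ := fun s => (x : ℂ) ^ s * rieszKernel s * G s with hF
  have hxc : (x : ℂ) ≠ 0 := by exact_mod_cast hx0.ne'
  have hmem : ∀ s : ℂ, s ∈ uIcc a b ×ℂ uIcc (-T) T ↔ (a ≤ s.re ∧ s.re ≤ b) ∧ |s.im| ≤ T := by
    intro s
    rw [mem_reProdIm, uIcc_of_le hab.le, uIcc_of_le (by linarith), mem_Icc, mem_Icc, abs_le]
  have hFd : DifferentiableOn ℂ F (uIcc a b ×ℂ uIcc (-T) T) := by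
    intro s hs
    refine DifferentiableWithinAt.mul (DifferentiableAt.differentiableWithinAt ?_) (hG s hs)
    refine DifferentiableAt.mul ?_ (differentiableAt_rieszKernel ?_)
    · exact DifferentiableAt.const_cpow differentiableAt_id (Or.inl hxc)
    · have := ((hmem s).mp hs).1.1
      linarith
  have hFB : ∀ s ∈ uIcc a b ×ℂ uIcc (-T) T, ‖F s‖ ≤ x ^ s.re * B * (6 / (1 + |s.im|)) := by
    intro s hs
    have h1 := ((hmem s).mp hs).1.1
    simp only [hF]
    rw [norm_mul, norm_mul, norm_cpow_eq_rpow_re_of_pos hx0]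
    calc _ ≤ x ^ s.re * ‖rieszKernel s‖ * (B * (1 + ‖s‖)) := by gcongr; exact hGB s hs
      _ = x ^ s.re * B * (‖rieszKernel s‖ * (1 + ‖s‖)) := by ring
      _ ≤ x ^ s.re * B * (3 / (1 + |s.im|) * 2) :=
          mul_le_mul_of_nonneg_left (norm_rieszKernel_mul_le (by linarith)) (by positivity)
      _ = _ := by ring
  have hbF : ∀ t : ℝ, ‖F (b + t * I)‖ ≤ x ^ b * B * ‖rieszKernel (b + t * I)‖ := by
    intro t
    simp only [hF]
    rw [norm_mul, norm_mul, norm_cpow_eq_rpow_re_of_pos hx0]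
    simp only [add_re, ofReal_re, mul_re, I_re, mul_zero, ofReal_im, I_im, mul_one, sub_self,
      add_zero]
    calc _ ≤ x ^ b * ‖rieszKernel (b + t * I)‖ * B := by gcongr; exact hbB t
      _ = _ := by ring
  have hbK : ∀ t : ℝ, ‖F (b + t * I)‖ ≤ x ^ b * B * (4 / (1 + t ^ 2)) := by
    intro t
    refine (hbF t).trans ?_
    gcongr
    simpa using norm_rieszKernel_le (s := b + t * I) (by simp; linarith)
  have hFc : Continuous fun t : ℝ => F (b + t * I) := by
    simp only [hF]
    refine Continuous.mul (Continuous.mul ?_ ?_) hc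
    · exact Continuous.const_cpow (by fun_prop) (Or.inl hxc)
    · refine continuous_iff_continuousAt.mpr fun t => ?_
      refine ContinuousAt.comp (f := fun t : ℝ => (b : ℂ) + t * I)
        (differentiableAt_rieszKernel (by simp; linarith)).continuousAt ?_
      fun_prop
  have hFi : Integrable fun t : ℝ => F (b + t * I) :=
    ((integrable_rieszKernel (by linarith)).norm.const_mul (x ^ b * B)).mono'
      hFc.aestronglyMeasurable (Eventually.of_forall hbF)
  have hrect := integral_boundary_rect_eq_zero_of_differentiableOn F (a + (-T : ℝ) * I)
    (b + T * I) (by simpa using hFd)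
  simp only [add_re, ofReal_re, mul_re, I_re, mul_zero, ofReal_im, I_im, mul_one, sub_self,
    add_zero, add_im, mul_im, zero_add, smul_eq_mul] at hrect
  have hleft : ‖∫ y : ℝ in (-T)..T, F (a + y * I)‖ ≤ 12 * B * (x ^ a * T) := by
    refine (intervalIntegral.norm_integral_le_of_norm_le_const (C := 6 * B * x ^ a) ?_).trans ?_
    · intro y hy
      rw [uIoc_of_le (by linarith)] at hy
      have hy' : |y| ≤ T := abs_le.mpr ⟨hy.1.le, hy.2⟩
      refine (hFB _ ((hmem _).mpr (by simp [hab.le, hy']))).trans ?_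
      simp only [add_re, ofReal_re, mul_re, I_re, mul_zero, ofReal_im, I_im, mul_one, sub_self,
        add_zero, add_im, mul_im, zero_add]
      have : 6 / (1 + |y|) ≤ 6 := div_le_self (by norm_num) (by linarith [abs_nonneg y])
      calc x ^ a * B * (6 / (1 + |y|)) ≤ x ^ a * B * 6 := by gcongr
        _ = _ := by ring
    · rw [abs_of_nonneg (by linarith)]
      exact le_of_eq (by ring)
  have hhor : ∀ τ : ℝ, |τ| = T → ‖∫ u : ℝ in a..b, F (u + τ * I)‖ ≤ 2 * B * (x ^ b / T) := by
    intro τ hτ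
    refine (intervalIntegral.norm_integral_le_of_norm_le_const
      (C := x ^ b * B * (6 / T)) ?_).trans ?_
    · intro u hu
      rw [uIoc_of_le hab.le] at hu
      refine (hFB _ ((hmem _).mpr (by simp [hu.1.le, hu.2, hτ]))).trans ?_
      simp only [add_re, ofReal_re, mul_re, I_re, mul_zero, ofReal_im, I_im, mul_one, sub_self,
        add_zero, add_im, mul_im, zero_add, hτ]
      gcongr
      · exact hu.2
      · linarith
    · rw [abs_of_nonneg (by linarith)]
      have h1 : 0 ≤ B * (x ^ b / T) := by positivity
      calc _ = 6 * (b - a) * (B * (x ^ b / T)) := by ring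
        _ ≤ 2 * (B * (x ^ b / T)) := by gcongr; linarith
        _ = _ := by ring
  have htail1 : ‖∫ t in Ioi T, F (b + t * I)‖ ≤ x ^ b * B * (4 / T) :=
    setIntegral_Ioi_norm_rieszKernel_le hT0 (fun t _ => hbK t) (by positivity)
  have htail2 : ‖∫ t in Iic (-T), F (b + t * I)‖ ≤ x ^ b * B * (4 / T) := by
    have := integral_comp_neg_Ioi T (fun t : ℝ => F (b + t * I))
    rw [← this]
    exact setIntegral_Ioi_norm_rieszKernel_le hT0
      (fun t _ => by simpa only [neg_sq] using hbK (-t)) (by positivity)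
  have hsplit : ∫ t : ℝ, F (b + t * I) = (∫ t in Iic (-T), F (b + t * I)) +
      (∫ t in (-T)..T, F (b + t * I)) + ∫ t in Ioi T, F (b + t * I) := by
    rw [intervalIntegral.integral_of_le (by linarith),
      ← setIntegral_union (Iic_disjoint_Ioc le_rfl) measurableSet_Ioc
        hFi.integrableOn hFi.integrableOn, Iic_union_Ioc_eq_Iic (by linarith),
      ← setIntegral_union (Iic_disjoint_Ioi le_rfl) measurableSet_Ioi
        hFi.integrableOn hFi.integrableOn, Iic_union_Ioi, setIntegral_univ]
  have hmid : ‖∫ t in (-T)..T, F (b + t * I)‖ ≤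
      12 * B * (x ^ a * T) + 2 * B * (x ^ b / T) + 2 * B * (x ^ b / T) := by
    have h1 := hhor T (abs_of_pos hT0)
    have h2 := hhor (-T) (by rw [abs_neg, abs_of_pos hT0])
    have h3 : I * (∫ t in (-T)..T, F (b + t * I)) = I * (∫ t in (-T)..T, F (a + t * I)) +
        (∫ u : ℝ in a..b, F (u + T * I)) - ∫ u : ℝ in a..b, F (u + (-T : ℝ) * I) := by
      linear_combination hrect
    have h4 := congrArg norm h3
    rw [norm_mul, norm_I, one_mul] at h4
    rw [h4]
    refine (norm_sub_le _ _).trans (add_le_add ((norm_add_le _ _).trans (add_le_add ?_ h1)) h2)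
    rwa [norm_mul, norm_I, one_mul]
  rw [hsplit]
  refine (norm_add₃_le).trans ((add_le_add (add_le_add htail2 hmid) htail1).trans (le_of_eq ?_))
  ring

theorem abs_tsum_max_sub_le {x : ℝ} (hx : 1 ≤ x) :
    |∑' n : ℕ, (if n = 0 then 0 else 1) * max 0 (1 - n / x) - x / 2| ≤ 1 := by
  have hx0 : 0 < x := by linarith
  have h1 : ∑' n : ℕ, (if n = 0 then 0 else 1) * max 0 (1 - n / x) =
      ∑ n ∈ Finset.range (⌊x⌋₊ + 1), (if n = 0 then 0 else 1) * max 0 (1 - n / x) := by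
    refine tsum_eq_sum fun n hn => ?_
    have : x < n := Nat.lt_of_floor_lt (by simpa using hn)
    rw [max_eq_left, mul_zero]
    rw [sub_nonpos, le_div_iff₀ hx0]
    linarith
  have h2 : ∑ n ∈ Finset.range (⌊x⌋₊ + 1), (if n = 0 then 0 else 1) * max 0 (1 - n / x) =
      ∑ n ∈ Finset.range ⌊x⌋₊, (1 - ((n : ℝ) + 1) / x) := by
    rw [Finset.sum_range_succ']
    simp only [Nat.add_eq_zero_iff, one_ne_zero, and_false, if_false, one_mul, if_true, zero_mul,
      add_zero]
    refine Finset.sum_congr rfl fun n hn => ?_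
    rw [max_eq_right]
    · push_cast; ring
    · have := Nat.floor_le hx0.le
      have h3 : ((n + 1 : ℕ) : ℝ) ≤ ⌊x⌋₊ := by exact_mod_cast Finset.mem_range.mp hn
      rw [sub_nonneg, div_le_one hx0]
      linarith
  have h3 : ∀ N : ℕ, ∑ n ∈ Finset.range N, (1 - ((n : ℝ) + 1) / x) = N - N * (N + 1) / (2 * x) := by
    intro N
    induction N with
    | zero => simp
    | succ k ih =>
      rw [Finset.sum_range_succ, ih]
      push_cast
      field_simp
      ring
  rw [h1, h2, h3]
  set N := (⌊x⌋₊ : ℝ)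
  have hN : N ≤ x := Nat.floor_le hx0.le
  have hN' : x < N + 1 := Nat.lt_floor_add_one x
  have h4 : N - N * (N + 1) / (2 * x) - x / 2 = -(((x - N) ^ 2 + N) / (2 * x)) := by
    field_simp
    ring
  have h5 : 0 ≤ N := Nat.cast_nonneg _
  rw [h4, abs_neg, abs_of_nonneg (by positivity), div_le_one (by positivity)]
  nlinarith

namespace DirichletCharacter

variable {q : ℕ} [NeZero q] (χ : DirichletCharacter ℂ q)

omit [NeZero q] in
theorem norm_mangoldtL_le {s : ℂ} (hs : 1 < s.re) (hs2 : s.re ≤ 2) :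
    ‖mangoldtL χ s‖ ≤ 12 / (s.re - 1) ^ 2 := by
  set ε : ℝ := (s.re - 1) / 2 with hε
  have hε0 : 0 < ε := by rw [hε]; linarith
  set f : ℕ → ℂ := fun n => ε * (n : ℂ) ^ (-(ε : ℂ)) * mangoldtCoeff χ n
  have hf : ∀ n, ‖f n‖ ≤ 1 := by
    intro n
    rcases Nat.eq_zero_or_pos n with rfl | hn
    · simp [f, mangoldtCoeff]
    have hn0 : (0 : ℝ) < n := by exact_mod_cast hn
    have h1 : ‖mangoldtCoeff χ n‖ ≤ (n : ℝ) ^ ε / ε := by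
      simp only [mangoldtCoeff, Pi.mul_apply, norm_mul, norm_real, Real.norm_eq_abs,
        abs_of_nonneg ArithmeticFunction.vonMangoldt_nonneg]
      calc _ ≤ 1 * Real.log n := by
            gcongr
            · exact χ.norm_le_one _
            · exact ArithmeticFunction.vonMangoldt_le_log
        _ ≤ _ := by rw [one_mul]; exact Real.log_le_rpow_div hn0.le hε0
    have h2 : ‖(n : ℂ) ^ (-(ε : ℂ))‖ = ((n : ℝ) ^ ε)⁻¹ := by
      rw [norm_natCast_cpow_of_pos hn, neg_re, ofReal_re, Real.rpow_neg hn0.le]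
    simp only [f]
    rw [norm_mul, norm_mul, h2, norm_real, Real.norm_eq_abs, abs_of_pos hε0]
    have h3 : 0 < (n : ℝ) ^ ε := by positivity
    calc _ ≤ ε * ((n : ℝ) ^ ε)⁻¹ * ((n : ℝ) ^ ε / ε) := by gcongr
      _ = 1 := by field_simp
  have hL : mangoldtL χ s = (ε : ℂ)⁻¹ * LSeries f (s - ε) := by
    rw [mangoldtL, LSeries, LSeries, ← tsum_mul_left]
    refine tsum_congr fun n => ?_
    rcases Nat.eq_zero_or_pos n with rfl | hn
    · simp
    have hn0 : (n : ℂ) ≠ 0 := by exact_mod_cast hn.ne'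
    have hεc : (ε : ℂ) ≠ 0 := by exact_mod_cast hε0.ne'
    rw [LSeries.term_of_ne_zero hn.ne', LSeries.term_of_ne_zero hn.ne', cpow_sub _ _ hn0]
    simp only [f, cpow_neg]
    have h4 : (n : ℂ) ^ (ε : ℂ) ≠ 0 := by simp [cpow_eq_zero_iff, hn0]
    have h5 : (n : ℂ) ^ s ≠ 0 := by simp [cpow_eq_zero_iff, hn0]
    rw [mangoldtCoeff]
    field_simp
  have hre : (s - ε).re = 1 + ε := by rw [sub_re, ofReal_re, hε]; ring
  have h6 := norm_LSeries_le_of_norm_le_one hf (s := s - ε) (by linarith)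
    (by rw [hre, hε]; linarith)
  rw [hre, add_sub_cancel_left] at h6
  rw [hL, norm_mul, norm_inv, norm_real, Real.norm_eq_abs, abs_of_pos hε0]
  calc _ ≤ ε⁻¹ * (3 / ε) := by gcongr
    _ = _ := by
      have : s.re - 1 = 2 * ε := by rw [hε]; ring
      rw [this]
      field_simp
      norm_num

/-- The Dirichlet series of `Λ χ - δ`, continued beyond `Re s = 1`. -/
noncomputable def perronG (s : ℂ) : ℂ :=
  -(deriv (entireL χ) s / entireL χ s) - poleOrder χ * (1 + s * fracIntegral s)

omit [NeZero q] in
theorem norm_poleOrder_le : ‖poleOrder χ‖ ≤ 1 := by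
  unfold poleOrder; split_ifs <;> simp

theorem LSeriesSummable_const_of_one_lt {s : ℂ} (hs : 1 < s.re) (c : ℂ) :
    LSeriesSummable (fun _ => c) s := by
  have := (LSeriesSummable_one_iff.mpr hs).smul c
  refine (LSeriesSummable_congr s (fun {n} _ => ?_)).mp this
  simp

theorem LSeries_const_eq {s : ℂ} (hs : 1 < s.re) (c : ℂ) :
    LSeries (fun _ => c) s = c * riemannZeta s := by
  rw [← LSeries_one_eq_riemannZeta hs, ← LSeries_smul]
  refine LSeries_congr (fun {n} _ => ?_) s
  simp

omit [NeZero q] in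
theorem LSeries_sub_poleOrder {s : ℂ} (hs : 1 < s.re) :
    LSeries (mangoldtCoeff χ - fun _ => poleOrder χ) s = mangoldtL χ s - poleOrder χ * riemannZeta s := by
  rw [LSeries_sub (summable_mangoldtCoeff χ hs) (LSeriesSummable_const_of_one_lt hs _),
    LSeries_const_eq hs]
  rfl

theorem perronG_eq {s : ℂ} (hs : 1 < s.re) :
    perronG χ s = LSeries (mangoldtCoeff χ - fun _ => poleOrder χ) s := by
  have hs1 : s - 1 ≠ 0 := sub_ne_zero.mpr (by rintro rfl; simp at hs)
  have h1 := zetaOne_eq (s := s) (by linarith)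
  rw [zetaOne_of_ne_one (sub_ne_zero.mp hs1)] at h1
  have h2 : riemannZeta s = 1 + 1 / (s - 1) + s * fracIntegral s := by
    field_simp
    linear_combination h1
  rw [LSeries_sub_poleOrder χ hs, mangoldtL_eq χ hs, perronG, h2]
  ring

theorem differentiableAt_perronG {s : ℂ} (hs : 0 < s.re) (h0 : entireL χ s ≠ 0) :
    DifferentiableAt ℂ (perronG χ) s := by
  have h1 : DifferentiableAt ℂ (deriv (entireL χ)) s :=
    (((differentiable_entireL χ).differentiableOn (s := univ)).deriv isOpen_univ).differentiableAt
      univ_mem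
  have h2 := (differentiable_entireL χ) s
  have h3 := differentiableAt_fracIntegral hs
  unfold perronG
  fun_prop (disch := assumption)

theorem norm_perronG_le_of_one_lt {s : ℂ} (hs : 1 < s.re) (hs2 : s.re ≤ 2) :
    ‖perronG χ s‖ ≤ 12 / (s.re - 1) ^ 2 + 3 / (s.re - 1) := by
  rw [perronG_eq χ hs, LSeries_sub (summable_mangoldtCoeff χ hs)
    (LSeriesSummable_const_of_one_lt hs _)]
  exact (norm_sub_le _ _).trans (add_le_add (norm_mangoldtL_le χ hs hs2)
    (norm_LSeries_le_of_norm_le_one (fun _ => norm_poleOrder_le χ) hs hs2))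

theorem norm_perronG_le {s : ℂ} {M : ℝ} (hs : 1 / 2 ≤ s.re)
    (h : ‖deriv (entireL χ) s / entireL χ s‖ ≤ M) : ‖perronG χ s‖ ≤ (M + 2) * (1 + ‖s‖) := by
  have hM : 0 ≤ M := (norm_nonneg _).trans h
  have h1 : ‖fracIntegral s‖ ≤ 2 := (norm_fracIntegral_le (by linarith)).trans
    (by rw [div_le_iff₀ (by linarith)]; linarith)
  unfold perronG
  calc _ ≤ ‖deriv (entireL χ) s / entireL χ s‖ + ‖poleOrder χ‖ * ‖1 + s * fracIntegral s‖ := by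
        refine (norm_sub_le _ _).trans ?_
        rw [norm_neg, norm_mul (poleOrder χ)]
    _ ≤ M + 1 * (1 + ‖s‖ * 2) := by
        gcongr
        · exact norm_poleOrder_le χ
        · refine (norm_add_le _ _).trans ?_
          rw [norm_one, norm_mul]
          gcongr
    _ ≤ _ := by nlinarith [norm_nonneg s]

theorem two_pi_mul_tsum_eq {σ x : ℝ} (hσ : 1 < σ) (hx : 0 < x) :
    2 * Real.pi * (∑' n : ℕ, mangoldtCoeff χ n * (max 0 (1 - n / x) : ℝ) -
        poleOrder χ * (∑' n : ℕ, (if n = 0 then 0 else 1) * max 0 (1 - n / x) : ℝ)) =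
      ∫ t : ℝ, (x : ℂ) ^ (σ + t * I) * rieszKernel (σ + t * I) * perronG χ (σ + t * I) := by
  have h1 := two_pi_mul_tsum_riesz (a := mangoldtCoeff χ - fun _ => poleOrder χ) (σ := σ)
    (by linarith) hx ((summable_mangoldtCoeff χ (by simpa)).sub
      (LSeriesSummable_const_of_one_lt (by simpa) _))
  have h2 : ∀ t : ℝ, LSeries (mangoldtCoeff χ - fun _ => poleOrder χ) (σ + t * I) =
      perronG χ (σ + t * I) := fun t => (perronG_eq χ (by simpa)).symm
  simp only [h2] at h1
  rw [← h1]
  congr 1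
  have hfin : ∀ g : ℕ → ℂ, (∀ n : ℕ, x < n → g n = 0) → Summable g := by
    intro g hg
    refine summable_of_ne_finset_zero (s := Finset.range (⌊x⌋₊ + 1)) fun n hn => hg n ?_
    exact Nat.lt_of_floor_lt (by simpa using hn)
  have hmax : ∀ n : ℕ, x < n → max 0 (1 - n / x) = 0 := by
    intro n hn
    rw [max_eq_left]
    rw [sub_nonpos, le_div_iff₀ hx]
    linarith
  rw [ofReal_tsum, ← tsum_mul_left, ← Summable.tsum_sub]
  · refine tsum_congr fun n => ?_
    rcases Nat.eq_zero_or_pos n with rfl | hn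
    · simp [mangoldtCoeff]
    · simp [hn.ne', sub_mul]
  · exact hfin _ fun n hn => by simp only [hmax n hn, ofReal_zero, mul_zero]
  · exact hfin _ fun n hn => by simp only [hmax n hn, ofReal_zero, mul_zero]

end DirichletCharacter

namespace DirichletCharacter

theorem exists_riesz_sum_le {A : ℝ} (hA : 0 < A) : ∃ κ : ℝ, 0 < κ ∧ κ ≤ 1 ∧ ∃ C : ℝ, 0 < C ∧
    ∀ᶠ Y : ℝ in atTop, ∀ (q : ℕ) [NeZero q], (q : ℝ) ≤ Y ^ A → ∀ χ : DirichletCharacter ℂ q,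
      ‖∑' n : ℕ, mangoldtCoeff χ n * (max 0 (1 - n / Real.exp (Y ^ 2)) : ℝ) -
        poleOrder χ * (Real.exp (Y ^ 2) / 2 : ℝ)‖ ≤ C * (Real.exp (Y ^ 2) * Real.exp (-κ * Y)) := by
  obtain ⟨κ, hκ, hκ8, hev⟩ := exists_norm_logDeriv_entireL_le hA
  set D : ℝ := 66 / κ + 2 + (768 / κ ^ 2 + 24 / κ) with hD
  have hD0 : 0 < D := by positivity
  have hpoly : ∀ᶠ Y : ℝ in atTop, Y ^ 2 ≤ Real.exp (κ / 8 * Y) := by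
    have h1 := ((isLittleO_pow_exp_pos_mul_atTop 2 (by positivity : 0 < κ / 8)).bound one_pos)
    filter_upwards [h1] with Y hY
    simpa using hY
  refine ⟨κ / 4, by positivity, by linarith, 24 * D + 1, by positivity, ?_⟩
  filter_upwards [hev, hpoly, eventually_ge_atTop 1] with Y hY hYp hY1 q _ hq χ
  set x := Real.exp (Y ^ 2) with hx
  have hx1 : 1 ≤ x := Real.one_le_exp (by positivity)
  have hx0 : 0 < x := Real.exp_pos _
  have hY0 : 0 < Y := by linarith
  have hκY : κ / Y ≤ κ := div_le_self hκ.le hY1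
  have hκY0 : 0 < κ / Y := by positivity
  set T := Real.exp (κ / 2 * Y) with hT
  have hT1 : 1 ≤ T := Real.one_le_exp (by positivity)
  have hTY : T ≤ Real.exp Y := Real.exp_le_exp.mpr (by nlinarith)
  set a := 1 - κ / Y with ha
  set b := 1 + κ / Y / 8 with hb
  have hab : a < b := by rw [ha, hb]; linarith
  have hmem : ∀ s : ℂ, s ∈ uIcc a b ×ℂ uIcc (-T) T → (a ≤ s.re ∧ s.re ≤ b) ∧ |s.im| ≤ T := by
    intro s
    rw [mem_reProdIm, uIcc_of_le hab.le, uIcc_of_le (by linarith), mem_Icc, mem_Icc, abs_le]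
    exact id
  have hkey : ∀ s : ℂ, s ∈ uIcc a b ×ℂ uIcc (-T) T → entireL χ s ≠ 0 ∧
      ‖deriv (entireL χ) s / entireL χ s‖ ≤ 66 / κ * Y ^ 2 := by
    intro s hs
    obtain ⟨⟨h1, h2⟩, h3⟩ := hmem s hs
    exact hY q hq χ s (h3.trans hTY) h1 (by linarith)
  have hYsq : 1 ≤ Y ^ 2 := one_le_pow₀ hY1
  have hbre : ∀ t : ℝ, ((b : ℂ) + t * I).re = b := by intro t; simp
  have hinteg := norm_integral_cpow_mul_rieszKernel_le (G := perronG χ) (a := a) (b := b) (T := T)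
    (B := D * Y ^ 2) (x := x) (by linarith) hab (by linarith) hT1 hx1 (by positivity)
    (fun s hs => (differentiableAt_perronG χ (by have := (hmem s hs).1.1; linarith)
      (hkey s hs).1).differentiableWithinAt)
    (fun s hs => by
      have h1 := norm_perronG_le χ (by have := (hmem s hs).1.1; linarith) (hkey s hs).2
      refine h1.trans ?_
      gcongr
      rw [hD]
      have : 0 ≤ (768 / κ ^ 2 + 24 / κ) * Y ^ 2 := by positivity
      linarith)
    (continuous_iff_continuousAt.mpr fun t => by
      refine ContinuousAt.comp (f := fun t : ℝ => (b : ℂ) + t * I)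
        (differentiableAt_perronG χ (by rw [hbre]; linarith)
          (entireL_ne_zero χ (by rw [hbre]; linarith))).continuousAt ?_
      fun_prop)
    (fun t => by
      refine (norm_perronG_le_of_one_lt χ (by rw [hbre]; linarith) (by rw [hbre]; linarith)).trans ?_
      rw [hbre, hb, add_sub_cancel_left, hD]
      have h1 : 12 / (κ / Y / 8) ^ 2 = 768 / κ ^ 2 * Y ^ 2 := by field_simp; norm_num
      have h2 : 3 / (κ / Y / 8) = 24 / κ * Y := by field_simp; norm_num
      have h3 : 24 / κ * Y ≤ 24 / κ * Y ^ 2 := by gcongr; nlinarith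
      have h4 : 0 ≤ (66 / κ + 2) * Y ^ 2 := by positivity
      rw [h1, h2]
      linarith)
  rw [← two_pi_mul_tsum_eq χ (by linarith) hx0] at hinteg
  have hxa : x ^ a * T = x * Real.exp (-(κ / 2 * Y)) := by
    rw [hx, hT, ← Real.exp_mul, ← Real.exp_add, ← Real.exp_add, ha]
    congr 1
    field_simp
    ring
  have hxb : x ^ b / T = x * Real.exp (-(3 * κ / 8 * Y)) := by
    rw [hx, hT, ← Real.exp_mul, ← Real.exp_sub, ← Real.exp_add, hb]
    congr 1
    field_simp
    ring
  set S1 : ℂ := ∑' n : ℕ, mangoldtCoeff χ n * (max 0 (1 - n / x) : ℝ) with hS1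
  set S2 : ℝ := ∑' n : ℕ, (if n = 0 then 0 else 1) * max 0 (1 - n / x) with hS2
  have hS : ‖S1 - poleOrder χ * S2‖ ≤ 24 * D * (x * Real.exp (-(κ / 4) * Y)) := by
    rw [norm_mul, norm_mul, norm_real, Real.norm_eq_abs, abs_of_pos Real.pi_pos] at hinteg
    have h2 : (1 : ℝ) ≤ ‖(2 : ℂ)‖ * Real.pi := by
      rw [Complex.norm_ofNat]
      linarith [Real.pi_gt_three]
    have h3 : x ^ a * T + x ^ b / T ≤ 2 * (x * Real.exp (-(3 * κ / 8 * Y))) := by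
      rw [hxa, hxb]
      have : Real.exp (-(κ / 2 * Y)) ≤ Real.exp (-(3 * κ / 8 * Y)) :=
        Real.exp_le_exp.mpr (by nlinarith)
      nlinarith
    calc ‖S1 - poleOrder χ * S2‖ ≤ ‖(2 : ℂ)‖ * Real.pi * ‖S1 - poleOrder χ * S2‖ :=
          le_mul_of_one_le_left (norm_nonneg _) h2
      _ ≤ 12 * (D * Y ^ 2) * (x ^ a * T + x ^ b / T) := hinteg
      _ ≤ 12 * (D * Real.exp (κ / 8 * Y)) * (2 * (x * Real.exp (-(3 * κ / 8 * Y)))) := by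
          gcongr
      _ = 24 * D * (x * (Real.exp (κ / 8 * Y) * Real.exp (-(3 * κ / 8 * Y)))) := by ring
      _ = _ := by
          rw [← Real.exp_add]
          congr 4
          ring
  have hS3 := abs_tsum_max_sub_le hx1
  rw [← hS2] at hS3
  have h1 : 1 ≤ x * Real.exp (-(κ / 4) * Y) := by
    rw [hx, ← Real.exp_add]
    refine Real.one_le_exp ?_
    nlinarith
  have h2 : S1 - poleOrder χ * (x / 2 : ℝ) = (S1 - poleOrder χ * S2) +
      poleOrder χ * ((S2 - x / 2 : ℝ) : ℂ) := by push_cast; ring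
  rw [h2]
  refine (norm_add_le _ _).trans ?_
  have h3 : ‖poleOrder χ * ((S2 - x / 2 : ℝ) : ℂ)‖ ≤ 1 := by
    rw [norm_mul, norm_real, Real.norm_eq_abs]
    exact mul_le_one₀ (norm_poleOrder_le χ) (abs_nonneg _) hS3
  linarith

end DirichletCharacter

open ArithmeticFunction.vonMangoldt in
theorem exists_riesz_residueClass_le {A : ℝ} (hA : 0 < A) : ∃ κ : ℝ, 0 < κ ∧ κ ≤ 1 ∧ ∃ C : ℝ, 0 < C ∧
    ∀ᶠ x : ℝ in atTop, ∀ q : ℕ, 0 < q → (q : ℝ) ≤ Real.log x ^ A → ∀ a : ZMod q, IsUnit a →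
      |∑ n ∈ Finset.range (⌊x⌋₊ + 1), residueClass a n * (x - n) - x ^ 2 / (2 * q.totient)| ≤
        C * (x ^ 2 * Real.exp (-κ * √(Real.log x))) := by
  obtain ⟨κ, hκ, hκ1, C, hC, hev⟩ :=
    DirichletCharacter.exists_riesz_sum_le (by positivity : 0 < 2 * A)
  refine ⟨κ, hκ, hκ1, C, hC, ?_⟩
  filter_upwards [(Real.tendsto_sqrt_atTop.comp Real.tendsto_log_atTop).eventually hev,
    eventually_ge_atTop 1] with x hx hx1 q hq hqA a ha
  have : NeZero q := ⟨hq.ne'⟩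
  have hx0 : 0 < x := by linarith
  have hlog : 0 ≤ Real.log x := Real.log_nonneg hx1
  simp only [Function.comp_apply] at hx
  rw [Real.sq_sqrt hlog, Real.exp_log hx0] at hx
  have hq2 : (q : ℝ) ≤ √(Real.log x) ^ (2 * A) := by
    rwa [Real.rpow_mul (Real.sqrt_nonneg _), Real.rpow_two, Real.sq_sqrt hlog]
  have hχ := hx q hq2
  set E := C * (x * Real.exp (-κ * √(Real.log x))) with hE
  have hφ : (q.totient : ℂ) ≠ 0 := by exact_mod_cast (Nat.totient_pos.mpr hq).ne'
  have hφr : (0 : ℝ) < q.totient := by exact_mod_cast Nat.totient_pos.mpr hq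
  have hsum : ∀ f : ℕ → ℂ, ∑' n : ℕ, f n * (max 0 (1 - n / x) : ℝ) =
      ∑ n ∈ Finset.range (⌊x⌋₊ + 1), f n * ((x - n) / x : ℝ) := by
    intro f
    rw [tsum_eq_sum (s := Finset.range (⌊x⌋₊ + 1))]
    · refine Finset.sum_congr rfl fun n hn => ?_
      have h1 : (n : ℝ) ≤ x := (Nat.le_floor_iff hx0.le).mp (by
        have := Finset.mem_range.mp hn; omega)
      rw [max_eq_right (by rw [sub_nonneg, div_le_one hx0]; exact h1), sub_div, div_self hx0.ne']
    · intro n hn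
      have : x < n := Nat.lt_of_floor_lt (by simpa using hn)
      rw [max_eq_left (by rw [sub_nonpos, one_le_div hx0]; linarith)]
      simp
  simp only [hsum] at hχ
  have hmain : (((∑ n ∈ Finset.range (⌊x⌋₊ + 1), residueClass a n * ((x - n) / x)) -
      x / (2 * q.totient) : ℝ) : ℂ) = (q.totient : ℂ)⁻¹ * ∑ χ : DirichletCharacter ℂ q, χ a⁻¹ *
        (∑ n ∈ Finset.range (⌊x⌋₊ + 1), DirichletCharacter.mangoldtCoeff χ n * ((x - n) / x : ℝ) -
          DirichletCharacter.poleOrder χ * (x / 2 : ℝ)) := by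
    simp only [mul_sub, Finset.sum_sub_distrib]
    have h1 : ∑ χ : DirichletCharacter ℂ q, χ a⁻¹ * (DirichletCharacter.poleOrder χ *
        (x / 2 : ℝ)) = (x / 2 : ℝ) := by
      rw [Finset.sum_eq_single 1]
      · have : IsUnit a⁻¹ := by
          obtain ⟨u, rfl⟩ := ha
          rw [ZMod.inv_coe_unit]
          exact Units.isUnit _
        rw [MulChar.one_apply this]
        simp [DirichletCharacter.poleOrder]
      · intro χ _ h
        simp [DirichletCharacter.poleOrder, h]
      · simp
    rw [h1, ofReal_sub, ofReal_sum]
    congr 1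
    · simp only [Finset.mul_sum]
      rw [Finset.sum_comm]
      refine Finset.sum_congr rfl fun n _ => ?_
      rw [ofReal_mul, residueClass_apply ha, Finset.mul_sum, Finset.sum_mul]
      refine Finset.sum_congr rfl fun χ _ => ?_
      simp only [DirichletCharacter.mangoldtCoeff, Pi.mul_apply]
      ring
    · push_cast
      field_simp
  have hb : |∑ n ∈ Finset.range (⌊x⌋₊ + 1), residueClass a n * ((x - n) / x) -
      x / (2 * q.totient)| ≤ E := by
    rw [← Real.norm_eq_abs, ← norm_real, hmain, norm_mul, norm_inv, Complex.norm_natCast]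
    calc _ ≤ (q.totient : ℝ)⁻¹ * ∑ χ : DirichletCharacter ℂ q, E := by
          gcongr
          refine (norm_sum_le _ _).trans (Finset.sum_le_sum fun χ _ => ?_)
          rw [norm_mul]
          calc _ ≤ 1 * E := by
                gcongr
                · exact χ.norm_le_one _
                · exact hχ χ
            _ = E := one_mul _
      _ = E := by
          rw [Finset.sum_const, Finset.card_univ, ← Nat.card_eq_fintype_card,
            DirichletCharacter.card_eq_totient_of_hasEnoughRootsOfUnity ℂ q, nsmul_eq_mul]
          field_simp
  have h2 : ∑ n ∈ Finset.range (⌊x⌋₊ + 1), residueClass a n * (x - n) -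
      x ^ 2 / (2 * q.totient) = x * (∑ n ∈ Finset.range (⌊x⌋₊ + 1),
        residueClass a n * ((x - n) / x) - x / (2 * q.totient)) := by
    rw [mul_sub, Finset.mul_sum]
    congr 1
    · refine Finset.sum_congr rfl fun n _ => ?_
      field_simp
    · ring
  rw [h2, abs_mul, abs_of_pos hx0]
  calc _ ≤ x * E := by gcongr
    _ = _ := by rw [hE]; ring

theorem eventually_forall_sqrt_le {A : ℝ} (hA : 0 < A) {p : ℝ → ℕ → Prop}
    (h : ∀ᶠ y : ℝ in atTop, ∀ q : ℕ, 0 < q → (q : ℝ) ≤ Real.log y ^ (A + 1) → p y q) :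
    ∀ᶠ x : ℝ in atTop, ∀ y, √x ≤ y → ∀ q : ℕ, 0 < q → (q : ℝ) ≤ Real.log x ^ A → p y q := by
  obtain ⟨y₀, hy₀⟩ := eventually_atTop.mp h
  filter_upwards [Real.tendsto_sqrt_atTop.eventually_ge_atTop y₀, eventually_ge_atTop 1,
    (Real.tendsto_log_atTop.comp Real.tendsto_sqrt_atTop).eventually_ge_atTop (2 ^ A)]
    with x hx hx1 hx2 y hy q hq hqA
  refine hy₀ y (hx.trans hy) q hq (hqA.trans ?_)
  simp only [Function.comp_apply] at hx2
  have hs : 0 < √x := Real.sqrt_pos.mpr (by linarith)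
  have h2A : (0 : ℝ) < 2 ^ A := by positivity
  have h1 : Real.log √x ≤ Real.log y := Real.log_le_log hs hy
  have h2 : Real.log x = 2 * Real.log √x := by rw [Real.log_sqrt (by linarith)]; ring
  have h3 : 0 < Real.log √x := h2A.trans_le hx2
  calc Real.log x ^ A ≤ (2 * Real.log y) ^ A := by
        gcongr
        · linarith
        · linarith
    _ = 2 ^ A * Real.log y ^ A := by rw [Real.mul_rpow (by norm_num) (by linarith)]
    _ ≤ Real.log y * Real.log y ^ A := by
        gcongr
        · exact Real.rpow_nonneg (by linarith) _
        · linarith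
    _ = _ := by rw [Real.rpow_add_one (by linarith)]; ring

theorem mul_sum_range_le {R : ℕ → ℝ} (hR : ∀ n, 0 ≤ R n) {x y : ℝ} (hx : 0 ≤ x) (hxy : x ≤ y) :
    (y - x) * ∑ n ∈ Finset.range (⌊x⌋₊ + 1), R n ≤
        ∑ n ∈ Finset.range (⌊y⌋₊ + 1), R n * (y - n) -
          ∑ n ∈ Finset.range (⌊x⌋₊ + 1), R n * (x - n) ∧
      ∑ n ∈ Finset.range (⌊y⌋₊ + 1), R n * (y - n) -
          ∑ n ∈ Finset.range (⌊x⌋₊ + 1), R n * (x - n) ≤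
        (y - x) * ∑ n ∈ Finset.range (⌊y⌋₊ + 1), R n := by
  have hsub : Finset.range (⌊x⌋₊ + 1) ⊆ Finset.range (⌊y⌋₊ + 1) :=
    Finset.range_subset_range.mpr (by gcongr)
  constructor
  · have h1 : ∑ n ∈ Finset.range (⌊x⌋₊ + 1), R n * (y - n) ≤
        ∑ n ∈ Finset.range (⌊y⌋₊ + 1), R n * (y - n) := by
      refine Finset.sum_le_sum_of_subset_of_nonneg hsub fun n hn _ => mul_nonneg (hR n) ?_
      have : (n : ℝ) ≤ y := (Nat.le_floor_iff (hx.trans hxy)).mp (by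
        have := Finset.mem_range.mp hn; omega)
      linarith
    have h2 : (y - x) * ∑ n ∈ Finset.range (⌊x⌋₊ + 1), R n =
        ∑ n ∈ Finset.range (⌊x⌋₊ + 1), R n * (y - n) -
          ∑ n ∈ Finset.range (⌊x⌋₊ + 1), R n * (x - n) := by
      rw [← Finset.sum_sub_distrib, Finset.mul_sum]
      exact Finset.sum_congr rfl fun n _ => by ring
    linarith
  · have h1 : ∑ n ∈ Finset.range (⌊y⌋₊ + 1), R n * (x - n) ≤
        ∑ n ∈ Finset.range (⌊x⌋₊ + 1), R n * (x - n) := by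
      rw [← Finset.sum_sdiff hsub]
      have : ∑ n ∈ Finset.range (⌊y⌋₊ + 1) \ Finset.range (⌊x⌋₊ + 1), R n * (x - n) ≤ 0 := by
        refine Finset.sum_nonpos fun n hn => mul_nonpos_of_nonneg_of_nonpos (hR n) ?_
        have : x < n := Nat.lt_of_floor_lt (by
          have := (Finset.mem_sdiff.mp hn).2
          simpa using this)
        linarith
      linarith
    have h2 : (y - x) * ∑ n ∈ Finset.range (⌊y⌋₊ + 1), R n =
        ∑ n ∈ Finset.range (⌊y⌋₊ + 1), R n * (y - n) -
          ∑ n ∈ Finset.range (⌊y⌋₊ + 1), R n * (x - n) := by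
      rw [← Finset.sum_sub_distrib, Finset.mul_sum]
      exact Finset.sum_congr rfl fun n _ => by ring
    linarith

theorem sq_mul_exp_neg_sqrt_log_le {κ x y : ℝ} (hκ1 : κ ≤ 1) (hx : Real.exp 1 ≤ x)
    (hxy : x ≤ y) :
    x ^ 2 * Real.exp (-κ * √(Real.log x)) ≤ y ^ 2 * Real.exp (-κ * √(Real.log y)) := by
  have hx0 : 0 < x := (Real.exp_pos 1).trans_le hx
  have hy0 : 0 < y := hx0.trans_le hxy
  have hlx : 1 ≤ Real.log x := by rwa [Real.le_log_iff_exp_le hx0]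
  have hly : Real.log x ≤ Real.log y := Real.log_le_log hx0 hxy
  have h1 : 1 ≤ √(Real.log x) := Real.one_le_sqrt.mpr hlx
  have h2 : √(Real.log x) ≤ √(Real.log y) := Real.sqrt_le_sqrt hly
  have h3 := Real.sq_sqrt (by linarith : 0 ≤ Real.log x)
  have h4 := Real.sq_sqrt (by linarith : 0 ≤ Real.log y)
  have e : ∀ z : ℝ, 0 < z → z ^ 2 = Real.exp (2 * Real.log z) := by
    intro z hz
    rw [two_mul, Real.exp_add, Real.exp_log hz, sq]
  rw [e x hx0, e y hy0, ← Real.exp_add, ← Real.exp_add, Real.exp_le_exp]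
  set u := √(Real.log x)
  set v := √(Real.log y)
  rw [← h3, ← h4]
  nlinarith [mul_nonneg (sub_nonneg.mpr h2) (by linarith : 0 ≤ 2 * (u + v) - κ)]

open ArithmeticFunction.vonMangoldt in
theorem exists_sum_residueClass_le {A : ℝ} (hA : 0 < A) : ∃ κ : ℝ, 0 < κ ∧ κ ≤ 1 ∧ ∃ C : ℝ, 0 < C ∧
    ∀ᶠ x : ℝ in atTop, ∀ q : ℕ, 0 < q → (q : ℝ) ≤ Real.log x ^ A → ∀ a : ZMod q, IsUnit a →
      |∑ n ∈ Finset.range (⌊x⌋₊ + 1), residueClass a n - x / q.totient| ≤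
        C * (x * Real.exp (-κ * √(Real.log x))) := by
  obtain ⟨κ, hκ, hκ1, C, hC, hev⟩ :=
    exists_riesz_residueClass_le (by positivity : 0 < A + 1)
  have hev' := eventually_forall_sqrt_le hA hev
  have htend : Tendsto (fun x : ℝ => Real.exp (-(κ / 2) * √(Real.log x))) atTop (𝓝 0) := by
    refine Real.tendsto_exp_atBot.comp ?_
    exact (Real.tendsto_sqrt_atTop.comp Real.tendsto_log_atTop).const_mul_atTop_of_neg
      (by linarith)
  refine ⟨κ / 2, by positivity, by linarith, 1 / 2 + 5 * C, by positivity, ?_⟩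
  filter_upwards [hev', htend.eventually_le_const (by norm_num : (0 : ℝ) < 1 / 2),
    eventually_ge_atTop 6] with x hx hη2 hx6 q hq hqA a ha
  set η := Real.exp (-(κ / 2) * √(Real.log x)) with hη
  have hη0 : 0 < η := Real.exp_pos _
  have hx0 : 0 < x := by linarith
  set h := x * η with hh
  have hh0 : 0 < h := by positivity
  have hhx : h ≤ x / 2 := by rw [hh]; nlinarith
  have hsq : √x ≤ x / 2 := by
    rw [Real.sqrt_le_left (by linarith)]
    nlinarith
  have hφ : (1 : ℝ) ≤ q.totient := by exact_mod_cast Nat.totient_pos.mpr hq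
  have hη2' : Real.exp (-κ * √(Real.log x)) = η ^ 2 := by
    rw [hη, ← Real.exp_nat_mul]
    congr 1
    push_cast
    ring
  have e1 := hx x (by linarith) q hq hqA a ha
  have e2 := hx (x + h) (by linarith) q hq hqA a ha
  have e3 := hx (x - h) (by linarith) q hq hqA a ha
  have m2 : (x + h) ^ 2 * Real.exp (-κ * √(Real.log (x + h))) ≤ 4 * (x ^ 2 * η ^ 2) := by
    rw [← hη2']
    have : Real.exp (-κ * √(Real.log (x + h))) ≤ Real.exp (-κ * √(Real.log x)) := by
      refine Real.exp_le_exp.mpr (mul_le_mul_of_nonpos_left (Real.sqrt_le_sqrt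
        (Real.log_le_log hx0 (by linarith))) (by linarith))
    calc _ ≤ (2 * x) ^ 2 * Real.exp (-κ * √(Real.log x)) := by gcongr; linarith
      _ = _ := by ring
  have m3 : (x - h) ^ 2 * Real.exp (-κ * √(Real.log (x - h))) ≤ x ^ 2 * η ^ 2 := by
    rw [← hη2']
    exact sq_mul_exp_neg_sqrt_log_le hκ1 (by linarith [Real.exp_one_lt_d9]) (by linarith)
  have b1 := (mul_sum_range_le (residueClass_nonneg a) hx0.le (by linarith : x ≤ x + h)).1
  have b2 := (mul_sum_range_le (residueClass_nonneg a) (by linarith) (by linarith : x - h ≤ x)).2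
  rw [hη2'] at e1
  rw [add_sub_cancel_left] at b1
  rw [sub_sub_cancel] at b2
  have e2' := e2.trans (mul_le_mul_of_nonneg_left m2 hC.le)
  have e3' := e3.trans (mul_le_mul_of_nonneg_left m3 hC.le)
  rw [abs_le] at e1 e2' e3' ⊢
  set S := ∑ n ∈ Finset.range (⌊x⌋₊ + 1), residueClass a n
  set W1 := ∑ n ∈ Finset.range (⌊x⌋₊ + 1), residueClass a n * (x - n)
  set W2 := ∑ n ∈ Finset.range (⌊x + h⌋₊ + 1), residueClass a n * (x + h - n)
  set W3 := ∑ n ∈ Finset.range (⌊x - h⌋₊ + 1), residueClass a n * (x - h - n)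
  set P := (q.totient : ℝ)
  have hP : 0 < P := by linarith
  have hhP : h ^ 2 / (2 * P) ≤ h ^ 2 / 2 := by gcongr; linarith
  have i2 : (x + h) ^ 2 / (2 * P) - x ^ 2 / (2 * P) = h * (x / P) + h ^ 2 / (2 * P) := by
    field_simp; ring
  have i3 : x ^ 2 / (2 * P) - (x - h) ^ 2 / (2 * P) = h * (x / P) - h ^ 2 / (2 * P) := by
    field_simp; ring
  have hE : x ^ 2 * η ^ 2 = h ^ 2 := by rw [hh]; ring
  rw [hE] at e1 e2' e3'
  have hCh : 0 ≤ C * h ^ 2 := by positivity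
  constructor
  · refine le_of_mul_le_mul_left ?_ hh0
    linarith [e1.1, e3'.2]
  · refine le_of_mul_le_mul_left ?_ hh0
    linarith [e1.1, e2'.2]

open ArithmeticFunction.vonMangoldt in
/-- `log` on the primes congruent to `a` modulo `q`, and zero elsewhere. -/
noncomputable def primeLog {q : ℕ} (a : ZMod q) (n : ℕ) : ℝ :=
  if n.Prime then residueClass a n else 0

theorem primeLog_nonneg {q : ℕ} (a : ZMod q) (n : ℕ) : 0 ≤ primeLog a n := by
  unfold primeLog
  split_ifs
  · exact ArithmeticFunction.vonMangoldt.residueClass_nonneg a n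
  · rfl

theorem inv_log_mul_primeLog {q : ℕ} (a : ZMod q) (n : ℕ) :
    (Real.log n)⁻¹ * primeLog a n = if n.Prime ∧ (n : ZMod q) = a then 1 else 0 := by
  by_cases hp : n.Prime
  · have h1 : (1 : ℝ) < n := by exact_mod_cast hp.one_lt
    have : Real.log n ≠ 0 := (Real.log_pos h1).ne'
    by_cases h : (n : ZMod q) = a
    · simp [primeLog, hp, h, ArithmeticFunction.vonMangoldt_apply_prime hp, this]
    · simp [primeLog, hp, h]
  · simp [primeLog, hp]

theorem sum_primeLog_le_theta {q : ℕ} (a : ZMod q) (x : ℝ) :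
    ∑ n ∈ Finset.Icc 0 ⌊x⌋₊, primeLog a n ≤ Chebyshev.theta x := by
  rw [Chebyshev.theta_eq_sum_Icc, Finset.sum_filter]
  refine Finset.sum_le_sum fun n _ => ?_
  unfold primeLog
  split_ifs with h
  · exact (ArithmeticFunction.vonMangoldt.residueClass_le a n).trans_eq
      (ArithmeticFunction.vonMangoldt_apply_prime h)
  · rfl

theorem eventually_sqrt_mul_log_le : ∀ᶠ x : ℝ in atTop,
    2 * √x * Real.log x ≤ x * Real.exp (-√(Real.log x)) := by
  have h1 := ((isLittleO_pow_exp_pos_mul_atTop 1 (by norm_num : (0 : ℝ) < 1 / 4)).bound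
    (by norm_num : (0 : ℝ) < 1 / 2))
  filter_upwards [Real.tendsto_log_atTop.eventually h1,
    Real.tendsto_log_atTop.eventually_ge_atTop 16, eventually_gt_atTop 0] with x hx hl hx0
  set u := Real.log x with hu
  have hsu : √u ≤ u / 4 := by
    rw [Real.sqrt_le_left (by linarith)]
    nlinarith
  have hxu : x = Real.exp u := (Real.exp_log hx0).symm
  have hsx : √x = Real.exp (u / 2) := by rw [hxu, Real.exp_half]
  rw [pow_one, Real.norm_eq_abs, abs_of_nonneg (by linarith), Real.norm_eq_abs,
    abs_of_pos (Real.exp_pos _)] at hx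
  calc 2 * √x * u ≤ 2 * √x * (1 / 2 * Real.exp (1 / 4 * u)) := by gcongr
    _ = Real.exp (u / 2 + 1 / 4 * u) := by rw [hsx, Real.exp_add]; ring
    _ ≤ Real.exp (u + -√u) := by
        refine Real.exp_le_exp.mpr ?_
        linarith
    _ = _ := by rw [Real.exp_add, ← hxu]

open ArithmeticFunction.vonMangoldt in
theorem exists_sum_primeLog_le {A : ℝ} (hA : 0 < A) : ∃ κ : ℝ, 0 < κ ∧ κ ≤ 1 ∧ ∃ C : ℝ, 0 < C ∧
    ∀ᶠ x : ℝ in atTop, ∀ q : ℕ, 0 < q → (q : ℝ) ≤ Real.log x ^ A → ∀ a : ZMod q, IsUnit a →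
      |∑ n ∈ Finset.Icc 0 ⌊x⌋₊, primeLog a n - x / q.totient| ≤
        C * (x * Real.exp (-κ * √(Real.log x))) := by
  obtain ⟨κ, hκ, hκ1, C, hC, hev⟩ := exists_sum_residueClass_le hA
  refine ⟨κ, hκ, hκ1, C + 1, by positivity, ?_⟩
  filter_upwards [hev, eventually_sqrt_mul_log_le, eventually_ge_atTop 1] with x hx hs hx1 q hq hqA a ha
  have h1 := hx q hq hqA a ha
  rw [Nat.range_succ_eq_Icc_zero] at h1
  have h2 : ∑ n ∈ Finset.Icc 0 ⌊x⌋₊, residueClass a n - ∑ n ∈ Finset.Icc 0 ⌊x⌋₊, primeLog a n ≤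
      Chebyshev.psi x - Chebyshev.theta x := by
    rw [Chebyshev.psi_eq_sum_Icc, Chebyshev.theta_eq_sum_Icc, Finset.sum_filter,
      ← Finset.sum_sub_distrib, ← Finset.sum_sub_distrib]
    refine Finset.sum_le_sum fun n _ => ?_
    by_cases hp : n.Prime
    · simp [primeLog, hp, ArithmeticFunction.vonMangoldt_apply_prime]
    · simpa [primeLog, hp] using residueClass_le a n
  have h3 : 0 ≤ ∑ n ∈ Finset.Icc 0 ⌊x⌋₊, residueClass a n -
      ∑ n ∈ Finset.Icc 0 ⌊x⌋₊, primeLog a n := by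
    rw [← Finset.sum_sub_distrib]
    refine Finset.sum_nonneg fun n _ => ?_
    by_cases hp : n.Prime
    · simp [primeLog, hp]
    · simpa [primeLog, hp] using residueClass_nonneg a n
  have h4 := Chebyshev.psi_sub_theta_le hx1
  have h5 : x * Real.exp (-√(Real.log x)) ≤ x * Real.exp (-κ * √(Real.log x)) := by
    gcongr
    nlinarith [Real.sqrt_nonneg (Real.log x)]
  rw [abs_le] at h1 ⊢
  constructor <;> linarith [h1.1, h1.2]

theorem primePiMod_eq {x : ℝ} (hx : 0 ≤ x) (q a : ℕ) : (primePiMod x q a : ℝ) =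
    ∑ n ∈ Finset.Icc 0 ⌊x⌋₊, (Real.log n)⁻¹ * primeLog (a : ZMod q) n := by
  have h1 : {p : ℕ | p.Prime ∧ (p : ℝ) ≤ x ∧ p ≡ a [MOD q]} =
      ((Finset.Icc 0 ⌊x⌋₊).filter fun n : ℕ => n.Prime ∧ (n : ZMod q) = a : Finset ℕ) := by
    ext n
    simp only [Set.mem_ofPred_eq, Finset.coe_filter, Finset.mem_Icc, zero_le, true_and,
      ZMod.natCast_eq_natCast_iff, Nat.le_floor_iff hx]
    tauto
  rw [primePiMod, h1, Set.ncard_coe_finset, Finset.card_filter]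
  push_cast
  exact Finset.sum_congr rfl fun n _ => (inv_log_mul_primeLog _ n).symm

theorem log_ne_zero_of_two_le {t : ℝ} (ht : 2 ≤ t) : Real.log t ≠ 0 :=
  (Real.log_pos (by linarith)).ne'

theorem continuousOn_inv_mul_log_sq (x : ℝ) :
    ContinuousOn (fun t : ℝ => (t * Real.log t ^ 2)⁻¹) (Icc 2 x) := by
  intro t ht
  have h1 := log_ne_zero_of_two_le ht.1
  have h0 : t ≠ 0 := by linarith [ht.1]
  have h2 : t * Real.log t ^ 2 ≠ 0 := by positivity
  exact ContinuousAt.continuousWithinAt (by fun_prop (disch := assumption))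

theorem li_eq {x : ℝ} (hx : 2 ≤ x) :
    li x = x / Real.log x - 2 / Real.log 2 + ∫ t in (2 : ℝ)..x, (t * Real.log t ^ 2)⁻¹ * t := by
  have hu : uIcc 2 x = Icc 2 x := uIcc_of_le hx
  have hi1 : IntervalIntegrable (fun t : ℝ => 1 / Real.log t) volume 2 x := by
    refine ContinuousOn.intervalIntegrable fun t ht => ?_
    rw [hu] at ht
    have h1 := log_ne_zero_of_two_le ht.1
    have h0 : t ≠ 0 := by linarith [ht.1]
    exact ContinuousAt.continuousWithinAt (by fun_prop (disch := assumption))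
  have hi2 : IntervalIntegrable (fun t : ℝ => (t * Real.log t ^ 2)⁻¹ * t) volume 2 x := by
    refine ContinuousOn.intervalIntegrable ?_
    rw [hu]
    exact (continuousOn_inv_mul_log_sq x).mul continuousOn_id
  have h := intervalIntegral.integral_eq_sub_of_hasDerivAt (a := 2) (b := x)
    (f := fun t => t / Real.log t)
    (f' := fun t => 1 / Real.log t - (t * Real.log t ^ 2)⁻¹ * t) (fun t ht => by
      rw [hu] at ht
      have h1 := log_ne_zero_of_two_le ht.1
      have h0 : t ≠ 0 := by linarith [ht.1]
      have := (hasDerivAt_id t).div (Real.hasDerivAt_log h0) h1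
      refine this.congr_deriv ?_
      simp only [id]
      field_simp) (hi1.sub hi2)
  rw [intervalIntegral.integral_sub hi1 hi2] at h
  rw [li]
  linarith

theorem integrableOn_mul_sum_primeLog {q : ℕ} (a : ZMod q) (x : ℝ) :
    IntegrableOn (fun t : ℝ => (t * Real.log t ^ 2)⁻¹ * ∑ n ∈ Finset.Icc 0 ⌊t⌋₊, primeLog a n)
      (Icc 2 x) :=
  integrableOn_mul_sum_Icc _ (by norm_num) (continuousOn_inv_mul_log_sq x).integrableOn_Icc

theorem sum_inv_log_mul_primeLog {q : ℕ} (a : ZMod q) {x : ℝ} (hx : 2 ≤ x) :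
    ∑ n ∈ Finset.Icc 0 ⌊x⌋₊, (Real.log n)⁻¹ * primeLog a n =
      (∑ n ∈ Finset.Icc 0 ⌊x⌋₊, primeLog a n) / Real.log x +
        ∫ t in (2 : ℝ)..x, (t * Real.log t ^ 2)⁻¹ * ∑ n ∈ Finset.Icc 0 ⌊t⌋₊, primeLog a n := by
  have hd : ∀ t ∈ Icc 2 x, HasDerivAt (fun t : ℝ => (Real.log t)⁻¹) (-(t * Real.log t ^ 2)⁻¹) t := by
    intro t ht
    have h1 := log_ne_zero_of_two_le ht.1
    have h0 : t ≠ 0 := by linarith [ht.1]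
    refine ((Real.hasDerivAt_log h0).inv h1).congr_deriv ?_
    field_simp
  rw [sum_mul_eq_sub_integral_mul₁ (primeLog a) (f := fun t : ℝ => (Real.log t)⁻¹)
    (by simp [primeLog, Nat.not_prime_zero]) (by simp [primeLog, Nat.not_prime_one]) x
    (fun t ht => (hd t ht).differentiableAt)
    ((continuousOn_inv_mul_log_sq x).neg.integrableOn_Icc.congr_fun
      (fun t ht => (hd t ht).deriv.symm) measurableSet_Icc), intervalIntegral.integral_of_le hx]
  rw [setIntegral_congr_fun (g := fun t => -((t * Real.log t ^ 2)⁻¹ *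
    ∑ n ∈ Finset.Icc 0 ⌊t⌋₊, primeLog a n)) measurableSet_Ioc (fun t ht => by
      rw [(hd t (Ioc_subset_Icc_self ht)).deriv, neg_mul]), integral_neg]
  ring

theorem inv_mul_log_sq_le {t : ℝ} (ht : 2 ≤ t) : (t * Real.log t ^ 2)⁻¹ ≤ 3 / t := by
  have h1 : Real.log 2 ≤ Real.log t := Real.log_le_log (by norm_num) ht
  have h2 := Real.log_two_gt_d9
  have h3 : 1 ≤ 3 * Real.log t ^ 2 := by nlinarith
  have h0 : 0 < t := by linarith
  have h4 : 0 < Real.log t := by linarith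
  rw [inv_eq_one_div, div_le_div_iff₀ (by positivity) h0]
  nlinarith

theorem abs_primePiMod_sub_li_div_le {q a : ℕ} (hq : 0 < q) {x δ : ℝ} (hx : 4 ≤ x)
    (h : ∀ t, √x ≤ t → t ≤ x →
      |∑ n ∈ Finset.Icc 0 ⌊t⌋₊, primeLog (a : ZMod q) n - t / q.totient| ≤ δ * t) :
    |(primePiMod x q a : ℝ) - li x / (Nat.totient q : ℝ)| ≤ 5 * (δ * x) + 8 * √x := by
  have hφ : (1 : ℝ) ≤ q.totient := by exact_mod_cast Nat.totient_pos.mpr hq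
  have hx0 : 0 < x := by linarith
  have hs2 : 2 ≤ √x := Real.le_sqrt_of_sq_le (by linarith)
  have hsx : √x ≤ x := by rw [Real.sqrt_le_left hx0.le]; nlinarith
  set E : ℝ → ℝ := fun t => ∑ n ∈ Finset.Icc 0 ⌊t⌋₊, primeLog (a : ZMod q) n - t / q.totient with hE
  set w : ℝ → ℝ := fun t => (t * Real.log t ^ 2)⁻¹ with hw
  have hw0 : ∀ t, 2 ≤ t → 0 ≤ w t := fun t ht => by simp only [hw]; positivity
  have hi1 := integrableOn_mul_sum_primeLog (a : ZMod q) x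
  have hi2 : IntegrableOn (fun t : ℝ => (t * Real.log t ^ 2)⁻¹ * t) (Icc 2 x) :=
    ((continuousOn_inv_mul_log_sq x).mul continuousOn_id).integrableOn_Icc
  have hi1' := (intervalIntegrable_iff_integrableOn_Icc_of_le (by linarith : 2 ≤ x)).mpr hi1
  have hi2' := (intervalIntegrable_iff_integrableOn_Icc_of_le (by linarith : 2 ≤ x)).mpr hi2
  have hwE : (fun t => w t * E t) = fun t : ℝ => (t * Real.log t ^ 2)⁻¹ *
      ∑ n ∈ Finset.Icc 0 ⌊t⌋₊, primeLog (a : ZMod q) n -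
      (t * Real.log t ^ 2)⁻¹ * t * (q.totient : ℝ)⁻¹ := by
    funext t
    simp only [hw, hE]
    ring
  have hiE : IntervalIntegrable (fun t => w t * E t) volume 2 x := by
    rw [hwE]
    exact hi1'.sub (hi2'.mul_const _)
  have hinteg : ∫ t in (2 : ℝ)..x, w t * E t = (∫ t in (2 : ℝ)..x, (t * Real.log t ^ 2)⁻¹ *
      ∑ n ∈ Finset.Icc 0 ⌊t⌋₊, primeLog (a : ZMod q) n) -
      (∫ t in (2 : ℝ)..x, (t * Real.log t ^ 2)⁻¹ * t) * (q.totient : ℝ)⁻¹ := by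
    rw [hwE, intervalIntegral.integral_sub hi1' (hi2'.mul_const _),
      intervalIntegral.integral_mul_const]
  have hid : (primePiMod x q a : ℝ) - li x / (Nat.totient q : ℝ) =
      E x / Real.log x + 2 / Real.log 2 / q.totient + ∫ t in (2 : ℝ)..x, w t * E t := by
    rw [primePiMod_eq hx0.le, sum_inv_log_mul_primeLog _ (by linarith), li_eq (by linarith), hinteg]
    simp only [hE]
    ring
  have hsub : ∀ u v, 2 ≤ u → u ≤ v → v ≤ x → IntervalIntegrable (fun t => w t * E t) volume u v := by
    intro u v hu huv hv
    refine hiE.mono_set ?_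
    rw [uIcc_of_le huv, uIcc_of_le (by linarith)]
    exact Icc_subset_Icc hu hv
  have hsplit := intervalIntegral.integral_add_adjacent_intervals
    (hsub 2 (√x) le_rfl hs2 hsx) (hsub (√x) x hs2 hsx le_rfl)
  have hδ : 0 ≤ δ := by
    have := (abs_nonneg _).trans (h x hsx le_rfl)
    exact nonneg_of_mul_nonneg_left this hx0
  have hlow : |∫ t in (2 : ℝ)..√x, w t * E t| ≤ 6 * (√x - 2) := by
    have := intervalIntegral.norm_integral_le_of_norm_le_const (a := 2) (b := √x) (C := 6)
      (f := fun t => w t * E t) (fun t ht => by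
        rw [uIoc_of_le hs2] at ht
        have ht0 : 0 < t := by linarith [ht.1]
        have h1 : |E t| ≤ 2 * t := by
          have h2 := (sum_primeLog_le_theta (a : ZMod q) t).trans
            (Chebyshev.theta_le_log4_mul_x ht0.le)
          have h3 : 0 ≤ ∑ n ∈ Finset.Icc 0 ⌊t⌋₊, primeLog (a : ZMod q) n :=
            Finset.sum_nonneg fun n _ => primeLog_nonneg _ n
          have h4 : t / q.totient ≤ t := div_le_self ht0.le hφ
          have h5 : 0 ≤ t / q.totient := by positivity
          have h6 : Real.log 4 ≤ 2 := by
            rw [show (4 : ℝ) = 2 ^ 2 by norm_num, Real.log_pow]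
            have := Real.log_two_lt_d9
            push_cast
            linarith
          have h7 : Real.log 4 * t ≤ 2 * t := by gcongr
          simp only [hE]
          rw [abs_le]
          constructor <;> linarith
        rw [Real.norm_eq_abs, abs_mul, abs_of_nonneg (hw0 t ht.1.le)]
        calc w t * |E t| ≤ 3 / t * (2 * t) := by
              gcongr
              exact inv_mul_log_sq_le ht.1.le
          _ = 6 := by field_simp; norm_num)
    rwa [Real.norm_eq_abs, abs_of_nonneg (by linarith : (0 : ℝ) ≤ √x - 2)] at this
  have hhigh : |∫ t in √x..x, w t * E t| ≤ 3 * δ * (x - √x) := by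
    have := intervalIntegral.norm_integral_le_of_norm_le_const (a := √x) (b := x) (C := 3 * δ)
      (f := fun t => w t * E t) (fun t ht => by
        rw [uIoc_of_le hsx] at ht
        have ht2 : 2 ≤ t := by linarith [ht.1]
        have ht0 : 0 < t := by linarith
        rw [Real.norm_eq_abs, abs_mul, abs_of_nonneg (hw0 t ht2)]
        calc w t * |E t| ≤ 3 / t * (δ * t) := by
              gcongr
              · exact inv_mul_log_sq_le ht2
              · exact h t ht.1.le ht.2
          _ = 3 * δ := by field_simp)
    rwa [Real.norm_eq_abs, abs_of_nonneg (by linarith : 0 ≤ x - √x)] at this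
  have hl2 := Real.log_two_gt_d9
  have hlx : 1 / 2 ≤ Real.log x :=
    (by linarith : 1 / 2 ≤ Real.log 2).trans (Real.log_le_log (by norm_num) (by linarith))
  have hEx : |E x / Real.log x| ≤ 2 * (δ * x) := by
    rw [abs_div, abs_of_pos (by linarith : 0 < Real.log x), div_le_iff₀ (by linarith)]
    have h1 := h x hsx le_rfl
    have h2 : 0 ≤ δ * x := by positivity
    calc |E x| ≤ δ * x := h1
      _ = 2 * (δ * x) * (1 / 2) := by ring
      _ ≤ _ := by gcongr
  have hconst : |2 / Real.log 2 / q.totient| ≤ 4 := by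
    rw [abs_of_nonneg (by positivity), div_le_iff₀ (by linarith), div_le_iff₀ (by linarith)]
    nlinarith
  rw [hid, ← hsplit]
  have h1 := abs_add_le (E x / Real.log x + 2 / Real.log 2 / q.totient)
    ((∫ t in (2 : ℝ)..√x, w t * E t) + ∫ t in √x..x, w t * E t)
  have h2 := abs_add_le (E x / Real.log x) (2 / Real.log 2 / q.totient)
  have h3 := abs_add_le (∫ t in (2 : ℝ)..√x, w t * E t) (∫ t in √x..x, w t * E t)
  have h4 : 0 ≤ δ * √x := by positivity
  linarith

theorem abs_primePiMod_sub_li_div_le_mul {q a : ℕ} (hq : 0 < q) {x : ℝ} (hx : 2 ≤ x) :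
    |(primePiMod x q a : ℝ) - li x / (Nat.totient q : ℝ)| ≤ 3 * x := by
  have hφ : (1 : ℝ) ≤ q.totient := by exact_mod_cast Nat.totient_pos.mpr hq
  have hx0 : 0 ≤ x := by linarith
  have h1 : (primePiMod x q a : ℝ) ≤ x + 1 := by
    rw [primePiMod_eq hx0]
    simp only [inv_log_mul_primeLog]
    calc _ ≤ ∑ n ∈ Finset.Icc 0 ⌊x⌋₊, (1 : ℝ) := by
          refine Finset.sum_le_sum fun n _ => ?_
          split_ifs <;> norm_num
      _ = ⌊x⌋₊ + 1 := by simp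
      _ ≤ _ := by linarith [Nat.floor_le hx0]
  have h2 : |li x| ≤ 2 * (x - 2) := by
    have := intervalIntegral.norm_integral_le_of_norm_le_const (a := 2) (b := x) (C := 2)
      (f := fun t : ℝ => 1 / Real.log t) (fun t ht => by
        rw [uIoc_of_le hx] at ht
        have h3 : Real.log 2 ≤ Real.log t := Real.log_le_log (by norm_num) ht.1.le
        have h4 := Real.log_two_gt_d9
        rw [Real.norm_eq_abs, abs_of_pos (one_div_pos.mpr (by linarith)),
          div_le_iff₀ (by linarith)]
        linarith)
    rwa [Real.norm_eq_abs, abs_of_nonneg (by linarith : 0 ≤ x - 2)] at this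
  have h3 : |li x / (Nat.totient q : ℝ)| ≤ 2 * (x - 2) := by
    rw [abs_div, abs_of_pos (by linarith : (0 : ℝ) < q.totient)]
    exact (div_le_self (abs_nonneg _) hφ).trans h2
  have h4 : (0 : ℝ) ≤ primePiMod x q a := Nat.cast_nonneg _
  rw [abs_le] at h3 ⊢
  constructor <;> linarith [h3.1, h3.2]

end

theorem siegel_walfisz :
    ∀ A : ℝ, 0 < A → ∃ c : ℝ, 0 < c ∧ ∃ C : ℝ, 0 < C ∧
      ∀ x : ℝ, 2 ≤ x → ∀ q : ℕ, 0 < q → (q : ℝ) ≤ Real.log x ^ A →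
        ∀ a : ℕ, Nat.Coprime a q →
          |(primePiMod x q a : ℝ) - li x / (Nat.totient q : ℝ)| ≤
            C * x * Real.exp (-c * Real.sqrt (Real.log x)) := by
  intro A hA
  obtain ⟨κ, hκ, hκ1, C, hC, hev⟩ := exists_sum_primeLog_le (by positivity : 0 < A + 1)
  obtain ⟨x₀, hx₀⟩ := Filter.eventually_atTop.mp ((eventually_forall_sqrt_le hA hev).and
    (eventually_sqrt_mul_log_le.and (Filter.eventually_ge_atTop 4)))
  refine ⟨κ / 2, by positivity, 5 * C + 8 + 3 * Real.exp (κ / 2 * √(Real.log x₀)), by positivity,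
    fun x hx q hq hqA a ha => ?_⟩
  have hx0 : 0 < x := by linarith
  rcases le_or_gt x₀ x with hxx | hxx
  · obtain ⟨h1, h2, h4⟩ := hx₀ x hxx
    have hsx0 : 0 < √x := Real.sqrt_pos.mpr hx0
    have hl1 : 1 ≤ Real.log x := by
      rw [Real.le_log_iff_exp_le hx0]
      linarith [Real.exp_one_lt_d9]
    set δ := Real.exp (-(κ / 2) * √(Real.log x)) with hδ
    have hδ0 : 0 < δ := Real.exp_pos _
    have key := abs_primePiMod_sub_li_div_le (a := a) hq (δ := C * δ) h4 (fun t ht htx => by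
      refine (h1 t ht q hq hqA a ((ZMod.isUnit_iff_coprime a q).mpr ha)).trans ?_
      have ht0 : 0 < t := hsx0.trans_le ht
      rw [mul_comm t, ← mul_assoc]
      gcongr
      have h5 : Real.log x / 2 ≤ Real.log t := by
        rw [← Real.log_sqrt hx0.le]
        exact Real.log_le_log hsx0 ht
      have h6 : √(Real.log x) / 2 ≤ √(Real.log t) := by
        refine Real.le_sqrt_of_sq_le ?_
        rw [div_pow, Real.sq_sqrt (by linarith)]
        linarith
      rw [hδ, Real.exp_le_exp]
      nlinarith)
    have h7 : √x ≤ x * δ := by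
      have h8 : Real.exp (-√(Real.log x)) ≤ δ := by
        rw [hδ, Real.exp_le_exp]
        nlinarith [Real.sqrt_nonneg (Real.log x)]
      calc √x = √x * 1 := (mul_one _).symm
        _ ≤ 2 * √x * Real.log x := by nlinarith
        _ ≤ x * Real.exp (-√(Real.log x)) := h2
        _ ≤ _ := by gcongr
    have h9 : 0 ≤ 3 * Real.exp (κ / 2 * √(Real.log x₀)) * (x * δ) := by positivity
    linarith
  · refine (abs_primePiMod_sub_li_div_le_mul hq hx).trans ?_
    have h1 : 1 ≤ Real.exp (κ / 2 * √(Real.log x₀)) * Real.exp (-(κ / 2) * √(Real.log x)) := by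
      rw [← Real.exp_add]
      refine Real.one_le_exp ?_
      have : √(Real.log x) ≤ √(Real.log x₀) := Real.sqrt_le_sqrt (Real.log_le_log hx0 hxx.le)
      nlinarith
    have h2 : 0 < x * Real.exp (-(κ / 2) * √(Real.log x)) := by positivity
    have h3 := mul_le_mul_of_nonneg_left h1 (by linarith : 0 ≤ 3 * x)
    nlinarith
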